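/- Fix ε with 0 < 2πε < 1 and σ > 0, and let τ₁, τ₂ ∈ ℝ be such that both random rotation numbers ρ_{τ₁,ε} and ρ_{τ₂,ε} are irrational. Then the corresponding random circle-map cocycles φ_{τ₁} and φ_{τ₂} over (Ω, P, θ) are stochastically conjugate: there exists a map h assigning to P-almost every ω a homeomorphism h(ω) of ℝ/ℤ, with (ω, x) ↦ h(ω)(x) measurable, such that for every n ∈ ℤ and P-almost every ω, φ_{τ₂}(n, ω) = h(θ^n ω) ∘ φ_{τ₁}(n, ω) ∘ h(ω)⁻¹. In particular, two deterministic circle diffeomorphisms that are not topologically conjugate can fall into the same stochastic equivalence class once the noise is switched on. -/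

import Mathlib

open MeasureTheory Real Filter Set Function

noncomputable section

lemma sin2_periodic : Function.Periodic (fun x : ℝ => Real.sin (2 * π * x)) 1 := by
  intro x
  simp only [mul_add, mul_one]
  exact Real.sin_add_two_pi _

/-- `sin (2πx)` viewed as a function on the circle `ℝ/ℤ`. -/
def sinA : AddCircle (1:ℝ) → ℝ := sin2_periodic.lift

/-- The noisy Arnol'd circle map `F_{τ,w}(x) = x + τ + σ w − ε sin (2πx)  (mod 1)`. -/
def Fmap (τ ε σ w : ℝ) : AddCircle (1:ℝ) → AddCircle (1:ℝ) :=
  fun x => x + (↑(τ + σ * w - ε * sinA x) : AddCircle (1:ℝ))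

/-- The lift `G_{τ,w}(x) = x + τ + σ w − ε sin (2πx)`. -/
def Gmap (τ ε σ w : ℝ) (x : ℝ) : ℝ :=
  x + τ + σ * w - ε * Real.sin (2 * π * x)

/-- Iterated lifts `G^n_{τ,ω} = G_{τ,ω_{n−1}} ∘ ⋯ ∘ G_{τ,ω_0}`. -/
def Gn (τ ε σ : ℝ) (ω : ℤ → ℝ) : ℕ → ℝ → ℝ
  | 0 => id
  | n + 1 => Gmap τ ε σ (ω n) ∘ Gn τ ε σ ω n

/-- The uniform probability measure on `I = [−1/2, 1/2]`. -/
def nuI : Measure ℝ := volume.restrict (Icc (-(1/2) : ℝ) (1/2))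

/-- The left shift `θ^n` on `Ω = I^ℤ`, `(θ^n ω)_k = ω_{k+n}`. -/
def shiftZ (n : ℤ) (ω : ℤ → ℝ) : ℤ → ℝ := fun k => ω (k + n)

/-- `P` is the two-sided infinite product measure `ν^⊗ℤ` on `Ω = I^ℤ`, characterized by
its finite-dimensional marginals. -/
def IsProductNuZ (P : Measure (ℤ → ℝ)) : Prop :=
  IsProbabilityMeasure P ∧
    ∀ s : Finset ℤ, P.map (fun ω (i : s) => ω i) = Measure.pi (fun _ : s => nuI)

/-- Forward random iterates, as bijections of the circle. -/
def phiNE (Fe : ℝ → (AddCircle (1:ℝ) ≃ AddCircle (1:ℝ))) (ω : ℤ → ℝ) :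
    ℕ → (AddCircle (1:ℝ) ≃ AddCircle (1:ℝ))
  | 0 => Equiv.refl _
  | n + 1 => (phiNE Fe ω n).trans (Fe (ω n))

/-- The two-sided cocycle `φ(n,ω)`. -/
def phiZ (Fe : ℝ → (AddCircle (1:ℝ) ≃ AddCircle (1:ℝ))) (n : ℤ) (ω : ℤ → ℝ) :
    AddCircle (1:ℝ) ≃ AddCircle (1:ℝ) :=
  if 0 ≤ n then phiNE Fe ω n.toNat
  else (phiNE Fe (shiftZ n ω) (-n).toNat).symm

set_option linter.unusedVariables false

def gz (τ ε : ℝ) (x : ℝ) : ℝ := x + τ - ε * Real.sin (2 * π * x)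

lemma Gmap_eq (τ ε σ w x : ℝ) : Gmap τ ε σ w x = gz τ ε x + σ * w := by
  unfold Gmap gz; ring

lemma gz_add_int (τ ε x : ℝ) (k : ℤ) : gz τ ε (x + k) = gz τ ε x + k := by
  unfold gz
  have : 2 * π * (x + k) = 2 * π * x + k * (2 * π) := by ring
  rw [this, Real.sin_add_int_mul_two_pi]; ring

lemma gz_cont (τ ε : ℝ) : Continuous (gz τ ε) := by unfold gz; fun_prop

def Jset (τ ε σ x0 : ℝ) : ℕ → Set ℝ
  | 0 => {x0}
  | n + 1 => (fun q : ℝ × ℝ => gz τ ε q.1 + σ * q.2) '' (Jset τ ε σ x0 n ×ˢ Icc (-(1/2)) (1/2))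

lemma Jset_conn (τ ε σ x0 : ℝ) (n : ℕ) : IsPreconnected (Jset τ ε σ x0 n) := by
  induction n with
  | zero => exact isPreconnected_singleton
  | succ n ih =>
    refine IsPreconnected.image (ih.prod isPreconnected_Icc) _ ?_
    have := gz_cont τ ε
    fun_prop

lemma Jset_sub (τ ε σ x0 : ℝ) (O : Set ℝ) (hx : x0 ∈ O)
    (hG : ∀ x ∈ O, ∀ w ∈ Icc (-(1/2) : ℝ) (1/2), gz τ ε x + σ * w ∈ O) (n : ℕ) :
    Jset τ ε σ x0 n ⊆ O := by
  induction n with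
  | zero => simpa [Jset] using hx
  | succ n ih =>
    rintro _ ⟨⟨a, b⟩, ⟨ha, hb⟩, rfl⟩
    exact hG a (ih ha) b hb

lemma Jset_Gn (τ ε σ x0 : ℝ) (ω : ℤ → ℝ) (hω : ∀ k, ω k ∈ Icc (-(1/2) : ℝ) (1/2)) (n : ℕ) :
    Gn τ ε σ ω n x0 ∈ Jset τ ε σ x0 n := by
  induction n with
  | zero => simp [Jset, Gn]
  | succ n ih =>
    refine ⟨(Gn τ ε σ ω n x0, ω n), ⟨ih, hω n⟩, ?_⟩
    simp [Gn, Gmap_eq]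

lemma Jset_step (τ ε σ x0 : ℝ) (m n : ℕ) (k : ℤ) (z : ℝ) (h1 : z ∈ Jset τ ε σ x0 m)
    (h2 : z - k ∈ Jset τ ε σ x0 n) (j : ℕ) :
    ∃ z, z ∈ Jset τ ε σ x0 (m + j) ∧ z - k ∈ Jset τ ε σ x0 (n + j) := by
  induction j with
  | zero => exact ⟨z, h1, h2⟩
  | succ j ih =>
    obtain ⟨z, h1, h2⟩ := ih
    refine ⟨gz τ ε z + σ * 0, ⟨(z, 0), ⟨h1, by constructor <;> norm_num⟩, rfl⟩,
      ⟨(z - k, 0), ⟨h2, by constructor <;> norm_num⟩, ?_⟩⟩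
    have := gz_add_int τ ε (z - k) k
    simp only [sub_add_cancel] at this
    simp only; linarith

lemma preconn_sub (E : Set ℝ) (hE : IsPreconnected E) (y z : ℝ) (h1 : y ∉ E) (h2 : y + 1 ∉ E)
    (hz : z ∈ E) (hz1 : y < z) (hz2 : z < y + 1) : E ⊆ Ioo y (y + 1) := by
  intro u hu
  constructor
  · by_contra h
    exact h1 (hE.ordConnected.out hu hz ⟨not_lt.mp h, hz1.le⟩)
  · by_contra h
    exact h2 (hE.ordConnected.out hz hu ⟨hz2.le, not_lt.mp h⟩)

lemma exists_recur (v : ℕ → ℝ) (σ : ℝ) (hσ : 0 < σ) :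
    ∃ n m : ℕ, n < m ∧ |Int.fract (v m) - Int.fract (v n)| < σ := by
  have hc : IsCompact (Icc (0:ℝ) 1) := isCompact_Icc
  obtain ⟨a, -, φ, hφ, hl⟩ := hc.tendsto_subseq (x := fun n => Int.fract (v n))
    (fun n => ⟨Int.fract_nonneg _, (Int.fract_lt_one _).le⟩)
  have hcs := hl.cauchySeq
  rw [Metric.cauchySeq_iff] at hcs
  obtain ⟨N, hN⟩ := hcs σ hσ
  exact ⟨φ N, φ (N+1), hφ (Nat.lt_succ_self N), by
    simpa [Real.dist_eq] using hN (N+1) (by omega) N (by omega)⟩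

lemma minimality (τ ε σ ρ : ℝ) (hσ : 0 < σ) (hirr : Irrational ρ)
    (ω : ℤ → ℝ) (hω : ∀ k, ω k ∈ Icc (-(1/2) : ℝ) (1/2))
    (hρ : ∀ x : ℝ, Tendsto (fun n : ℕ => (Gn τ ε σ ω n x - x) / n) atTop (nhds ρ))
    (O : Set ℝ) (hne : O.Nonempty) (hper : ∀ x, ∀ k : ℤ, x ∈ O → x + k ∈ O)
    (hG : ∀ x ∈ O, ∀ w ∈ Icc (-(1/2) : ℝ) (1/2), gz τ ε x + σ * w ∈ O) : O = univ := by
  by_contra hO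
  obtain ⟨y, hy⟩ := (ne_univ_iff_exists_notMem O).mp hO
  have hyk : ∀ k : ℤ, y + k ∉ O := fun k h => hy (by
    have := hper _ (-k) h; push_cast at this; simpa using this)
  obtain ⟨x0, hx0⟩ := hne
  set u : ℕ → ℝ := fun n => Gn τ ε σ ω n x0 with hu
  have huJ : ∀ n, u n ∈ Jset τ ε σ x0 n := fun n => Jset_Gn τ ε σ x0 ω hω n
  -- intersecting sets
  obtain ⟨n', m', hnm, hfr⟩ := exists_recur (fun n => gz τ ε (u n)) σ hσ
  obtain ⟨k, z, hz1, hz2⟩ : ∃ k : ℤ, ∃ z, z ∈ Jset τ ε σ x0 (m' + 1) ∧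
      z - k ∈ Jset τ ε σ x0 (n' + 1) := by
    set δ := Int.fract (gz τ ε (u m')) - Int.fract (gz τ ε (u n')) with hδ
    refine ⟨⌊gz τ ε (u m')⌋ - ⌊gz τ ε (u n')⌋, gz τ ε (u m') - δ / 2,
      ⟨(u m', - δ / (2 * σ)), ⟨huJ m', ?_⟩, ?_⟩, ⟨(u n', δ / (2 * σ)), ⟨huJ n', ?_⟩, ?_⟩⟩
    · rw [abs_lt] at hfr
      constructor
      · rw [le_div_iff₀ (by positivity)]; linarith
      · rw [div_le_iff₀ (by positivity)]; linarith
    · simp only; field_simp; ring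
    · rw [abs_lt] at hfr
      constructor
      · rw [le_div_iff₀ (by positivity)]; linarith
      · rw [div_le_iff₀ (by positivity)]; linarith
    · have h1 := Int.self_sub_floor (gz τ ε (u m'))
      have h2 := Int.self_sub_floor (gz τ ε (u n'))
      have h3 : σ * (δ / (2 * σ)) = δ / 2 := by field_simp
      simp only [h3]; push_cast; linarith
  set n := n' + 1 with hn
  obtain ⟨d, hd, hm⟩ : ∃ d : ℕ, 0 < d ∧ m' + 1 = n + d := ⟨m' - n', by omega, by omega⟩
  rw [hm] at hz1
  have hx0y := hyk
  obtain ⟨l, hl1, hl2⟩ : ∃ l : ℤ, y + l < u n ∧ u n < y + l + 1 := by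
    have hun : u n ∈ O := Jset_sub τ ε σ x0 O hx0 hG n (huJ n)
    refine ⟨⌊u n - y⌋, lt_of_le_of_ne (by linarith [Int.floor_le (u n - y)]) ?_,
      by linarith [Int.lt_floor_add_one (u n - y)]⟩
    intro h; exact hyk _ (h ▸ hun)
  have key : ∀ i : ℕ, ∀ v ∈ Jset τ ε σ x0 (n + i * d),
      v - i * k ∈ Ioo (y + l) (y + l + 1) := by
    have hav : ∀ i : ℕ, ∀ q : ℤ, y + q ∉ (fun v => v - (i:ℝ) * k) '' Jset τ ε σ x0 (n + i * d) := by
      rintro i q ⟨v, hv, hvq⟩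
      have := hper _ (-(i * k)) (Jset_sub τ ε σ x0 O hx0 hG _ hv)
      apply hyk q
      rw [← hvq]; push_cast at this; rw [← sub_eq_add_neg] at this; exact this
    have hcon : ∀ i : ℕ, IsPreconnected ((fun v => v - (i:ℝ) * k) '' Jset τ ε σ x0 (n + i * d)) :=
      fun i => (Jset_conn τ ε σ x0 _).image _ (by fun_prop)
    intro i
    induction i with
    | zero =>
      intro v hv
      refine preconn_sub _ (hcon 0) (y + l) (u n) (hav 0 l) ?_ ⟨u n, by simpa using huJ n, by simp⟩
        hl1 hl2 ⟨v, hv, rfl⟩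
      have := hav 0 (l + 1); push_cast at this; rw [← add_assoc] at this; simpa using this
    | succ i ih =>
      intro v hv
      obtain ⟨z', h1, h2⟩ := Jset_step τ ε σ x0 (n + d) n k z hz1 hz2 (i * d)
      have h3 := ih _ h2
      refine preconn_sub _ (hcon (i+1)) (y + l) (z' - (i+1 : ℕ) * k) (hav _ l) ?_
        ⟨z', by convert h1 using 2; ring, rfl⟩ ?_ ?_ ⟨v, hv, rfl⟩
      · have := hav (i+1) (l + 1); push_cast at this ⊢; rw [← add_assoc] at this; exact this
      · have := h3.1; push_cast; linarith
      · have := h3.2; push_cast; linarith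
  -- limit
  have hlim : Tendsto (fun i : ℕ => (u (n + i * d) - x0) / ((n + i * d : ℕ) : ℝ)) atTop (nhds ρ) := by
    have hsub : Tendsto (fun i : ℕ => n + i * d) atTop atTop :=
      tendsto_atTop_mono (fun i => by simp only [id]; nlinarith) tendsto_id
    exact (hρ x0).comp hsub
  have hlim2 : Tendsto (fun i : ℕ => (u (n + i * d) - x0) / ((n + i * d : ℕ) : ℝ)) atTop
      (nhds ((k:ℝ) / d)) := by
    have hd' : (0:ℝ) < d := by exact_mod_cast hd
    have hB : ∃ B, ∀ i : ℕ, |(u (n + i * d) - x0) - (n + i * d : ℕ) * ((k:ℝ) / d)| ≤ B := by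
      refine ⟨|y + l - x0 - n * (k / d)| + 1, fun i => ?_⟩
      have h3 := key i _ (huJ _)
      have e : (u (n + i * d) - x0) - (n + i * d : ℕ) * ((k:ℝ) / d)
        = (u (n + i * d) - i * k - (y + l)) + (y + l - x0 - n * (k / d)) := by
        push_cast; field_simp; ring
      rw [e]
      refine (abs_add_le _ _).trans ?_
      have : |u (n + i * d) - i * k - (y + l)| ≤ 1 := by
        rw [abs_le]; constructor <;> linarith [h3.1, h3.2]
      linarith
    obtain ⟨B, hB⟩ := hB
    have hsub : Tendsto (fun i : ℕ => ((n + i * d : ℕ) : ℝ)) atTop atTop :=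
      tendsto_natCast_atTop_atTop.comp (tendsto_atTop_mono (fun i => by simp only [id]; nlinarith) tendsto_id)
    rw [tendsto_iff_dist_tendsto_zero]
    refine squeeze_zero (fun _ => dist_nonneg) (g := fun i => B / ((n + i * d : ℕ) : ℝ)) (fun i => ?_)
      (hsub.const_div_atTop B)
    have hp : (0:ℝ) < ((n + i * d : ℕ) : ℝ) := by
      have : 0 < n + i * d := by omega
      exact_mod_cast this
    rw [Real.dist_eq, le_div_iff₀ hp, ← abs_of_pos hp, ← abs_mul, abs_of_pos hp, sub_mul,
      div_mul_cancel₀ _ hp.ne', mul_comm ((k:ℝ)/d)]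
    exact hB i
  have := tendsto_nhds_unique hlim hlim2
  apply hirr
  exact ⟨(k:ℚ) / d, by rw [this]; push_cast; rfl⟩

def gd (ε : ℝ) (x : ℝ) : ℝ := 1 - 2 * π * ε * Real.cos (2 * π * x)

lemma gd_cont (ε : ℝ) : Continuous (gd ε) := by unfold gd; fun_prop

lemma gz_hasDeriv (τ ε x : ℝ) : HasDerivAt (gz τ ε) (gd ε x) x := by
  unfold gz gd
  have h1 : HasDerivAt (fun x : ℝ => 2 * π * x) (2 * π) x := by
    simpa using (hasDerivAt_id x).const_mul (2 * π)
  have h2 := ((hasDerivAt_id x).add_const τ).sub ((h1.sin).const_mul ε)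
  have h3 := h2.congr_deriv (show 1 - ε * (Real.cos (2 * π * x) * (2 * π)) = 1 - 2 * π * ε * Real.cos (2 * π * x) by ring)
  exact h3

lemma gd_pos {ε : ℝ} (hε : 0 < ε) (h : 2 * π * ε < 1) (x : ℝ) : 0 < gd ε x := by
  unfold gd
  have h1 := Real.cos_le_one (2 * π * x)
  have : 0 < 2 * π * ε := by positivity
  nlinarith

lemma gd_le {ε : ℝ} (hε : 0 < ε) (h : 2 * π * ε < 1) (x : ℝ) : gd ε x ≤ 2 := by
  unfold gd
  have h1 := Real.neg_one_le_cos (2 * π * x)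
  have : 0 < 2 * π * ε := by positivity
  nlinarith

lemma gd_per (ε : ℝ) : Function.Periodic (gd ε) 1 := by
  intro x
  unfold gd
  rw [show 2 * π * (x + 1) = 2 * π * x + 2 * π by ring, Real.cos_add_two_pi]

def Lam (τ ε σ : ℝ) (f : ℝ → ℝ) (x : ℝ) : ℝ :=
  gd ε x * ∫ w in (-(1/2) : ℝ)..(1/2), f (gz τ ε x + σ * w)

lemma Lam_cont (τ ε σ : ℝ) {f : ℝ → ℝ} (hf : Continuous f) : Continuous (Lam τ ε σ f) := by
  unfold Lam
  have h1 := gd_cont ε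
  have h2 := gz_cont τ ε
  refine h1.mul (intervalIntegral.continuous_parametric_intervalIntegral_of_continuous' ?_ _ _)
  fun_prop

lemma Lam_integral (τ ε σ : ℝ) {f : ℝ → ℝ} (hf : Continuous f) (a b : ℝ) :
    ∫ x in a..b, Lam τ ε σ f x =
      ∫ w in (-(1/2) : ℝ)..(1/2), ∫ u in (gz τ ε a + σ * w)..(gz τ ε b + σ * w), f u := by
  have h1 := gd_cont ε
  have h2 := gz_cont τ ε
  have e1 : ∀ x, Lam τ ε σ f x = ∫ w in (-(1/2) : ℝ)..(1/2), f (gz τ ε x + σ * w) * gd ε x := by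
    intro x; unfold Lam; rw [intervalIntegral.integral_mul_const, mul_comm]
  simp_rw [e1]
  rw [intervalIntegral_intervalIntegral_swap]
  · refine intervalIntegral.integral_congr fun w _ => ?_
    have := intervalIntegral.integral_comp_mul_deriv (a := a) (b := b)
      (f := fun x => gz τ ε x + σ * w) (f' := gd ε) (g := f)
      (fun x _ => (gz_hasDeriv τ ε x).add_const _) h1.continuousOn hf
    simpa using this
  · have hc : Continuous (uncurry fun x w => f (gz τ ε x + σ * w) * gd ε x) := by
      fun_prop
    exact (hc.continuousOn.integrableOn_compact (isCompact_uIcc.prod isCompact_uIcc)).mono_set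
      (Set.prod_mono uIoc_subset_uIcc uIoc_subset_uIcc)

lemma Lam_per (τ ε σ : ℝ) {f : ℝ → ℝ} (hf : Function.Periodic f 1) :
    Function.Periodic (Lam τ ε σ f) 1 := by
  intro x
  unfold Lam
  rw [gd_per]
  congr 1
  refine intervalIntegral.integral_congr fun w _ => ?_
  have := gz_add_int τ ε x 1
  push_cast at this
  simp only [this]
  rw [← hf (gz τ ε x + σ * w)]
  congr 1; ring

lemma Lam_int_one (τ ε σ : ℝ) {f : ℝ → ℝ} (hc : Continuous f) (hf : Function.Periodic f 1)
    (h1 : ∫ x in (0:ℝ)..1, f x = 1) : ∫ x in (0:ℝ)..1, Lam τ ε σ f x = 1 := by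
  rw [Lam_integral τ ε σ hc]
  have : ∀ w, ∫ u in (gz τ ε 0 + σ * w)..(gz τ ε 1 + σ * w), f u = 1 := by
    intro w
    have := gz_add_int τ ε 0 1
    push_cast at this
    rw [zero_add] at this
    rw [this, show gz τ ε 0 + 1 + σ * w = gz τ ε 0 + σ * w + 1 by ring,
      hf.intervalIntegral_add_eq _ 0]
    simpa using h1
  simp_rw [this]
  norm_num

lemma avg_eq (σ : ℝ) (hσ : 0 < σ) (f : ℝ → ℝ) (y : ℝ) :
    ∫ w in (-(1/2) : ℝ)..(1/2), f (y + σ * w) = σ⁻¹ * ∫ u in (y - σ / 2)..(y + σ / 2), f u := by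
  rw [intervalIntegral.integral_comp_add_mul _ hσ.ne']
  simp only [smul_eq_mul]
  congr 2 <;> ring

lemma Lam_nonneg {τ ε σ : ℝ} (hε : 0 < ε) (h : 2 * π * ε < 1) {f : ℝ → ℝ} (hf : ∀ x, 0 ≤ f x) (x : ℝ) :
    0 ≤ Lam τ ε σ f x :=
  mul_nonneg (gd_pos hε h x).le (intervalIntegral.integral_nonneg (by norm_num) fun _ _ => hf _)

lemma Lam_le {τ ε σ : ℝ} (hε : 0 < ε) (h : 2 * π * ε < 1) (hσ : 0 < σ) {f : ℝ → ℝ}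
    (hf : ∀ x, 0 ≤ f x) (hc : Continuous f) (hp : Function.Periodic f 1)
    (h1 : ∫ x in (0:ℝ)..1, f x = 1) (x : ℝ) :
    Lam τ ε σ f x ≤ 2 * (σ⁻¹ * (σ + 1)) := by
  unfold Lam
  rw [avg_eq σ hσ]
  have hi : ∀ a b, IntervalIntegrable f volume a b := fun a b => hc.intervalIntegrable a b
  set y := gz τ ε x
  have hle : ∫ u in (y - σ / 2)..(y + σ / 2), f u ≤ σ + 1 := by
    calc ∫ u in (y - σ / 2)..(y + σ / 2), f u
        ≤ ∫ u in (y - σ / 2)..(y - σ / 2 + (⌈σ⌉ : ℤ) • (1:ℝ)), f u := by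
          refine intervalIntegral.integral_mono_interval le_rfl (by linarith) ?_
            (ae_of_all _ hf) (hi _ _)
          have := Int.le_ceil σ
          simp; linarith
      _ = ⌈σ⌉ • (1:ℝ) := by
          rw [hp.intervalIntegral_add_zsmul_eq _ _ hi, hp.intervalIntegral_add_eq _ 0]
          simp [h1]
      _ ≤ σ + 1 := by
          have := Int.ceil_lt_add_one σ
          simp; linarith
  have h0 : 0 ≤ ∫ u in (y - σ / 2)..(y + σ / 2), f u :=
    intervalIntegral.integral_nonneg (by linarith) fun _ _ => hf _
  have h2 := gd_le hε h x
  have h3 := (gd_pos hε h x).le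
  have h4 : 0 < σ⁻¹ := by positivity
  gcongr
  

def fseq (τ ε σ : ℝ) : ℕ → ℝ → ℝ
  | 0 => fun _ => 1
  | n + 1 => Lam τ ε σ (fseq τ ε σ n)

lemma fseq_props {τ ε σ : ℝ} (hε : 0 < ε) (h : 2 * π * ε < 1) (n : ℕ) :
    Continuous (fseq τ ε σ n) ∧ Function.Periodic (fseq τ ε σ n) 1 ∧ (∀ x, 0 ≤ fseq τ ε σ n x) ∧
      ∫ x in (0:ℝ)..1, fseq τ ε σ n x = 1 := by
  induction n with
  | zero => exact ⟨continuous_const, fun _ => rfl, fun _ => zero_le_one, by simp [fseq]⟩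
  | succ n ih =>
    obtain ⟨h1, h2, h3, h4⟩ := ih
    exact ⟨Lam_cont _ _ _ h1, Lam_per _ _ _ h2, Lam_nonneg hε h h3, Lam_int_one _ _ _ h1 h2 h4⟩

lemma fseq_le {τ ε σ : ℝ} (hε : 0 < ε) (h : 2 * π * ε < 1) (hσ : 0 < σ) (n : ℕ) (x : ℝ) :
    fseq τ ε σ n x ≤ 2 * (σ⁻¹ * (σ + 1)) := by
  cases n with
  | zero =>
    have : σ⁻¹ * (σ + 1) = 1 + σ⁻¹ := by field_simp
    have h4 : 0 < σ⁻¹ := by positivity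
    simp only [fseq]; linarith
  | succ n =>
    obtain ⟨h1, h2, h3, h4⟩ := fseq_props (τ := τ) (σ := σ) hε h n
    exact Lam_le hε h hσ h3 h1 h2 h4 x

def mN (τ ε σ : ℝ) (N : ℕ) (x : ℝ) : ℝ := ((N:ℝ)+1)⁻¹ * ∑ k ∈ Finset.range (N+1), fseq τ ε σ k x

lemma mN_cont {τ ε σ : ℝ} (hε : 0 < ε) (h : 2 * π * ε < 1) (N : ℕ) : Continuous (mN τ ε σ N) :=
  continuous_const.mul (continuous_finsetSum _ fun k _ => (fseq_props hε h k).1)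

lemma mN_nonneg {τ ε σ : ℝ} (hε : 0 < ε) (h : 2 * π * ε < 1) (N : ℕ) (x : ℝ) : 0 ≤ mN τ ε σ N x :=
  mul_nonneg (by positivity) (Finset.sum_nonneg fun k _ => (fseq_props hε h k).2.2.1 x)

lemma mN_le {τ ε σ : ℝ} (hε : 0 < ε) (h : 2 * π * ε < 1) (hσ : 0 < σ) (N : ℕ) (x : ℝ) :
    mN τ ε σ N x ≤ 2 * (σ⁻¹ * (σ + 1)) := by
  unfold mN
  rw [inv_mul_le_iff₀ (by positivity)]
  refine (Finset.sum_le_sum fun k _ => fseq_le hε h hσ k x).trans ?_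
  simp

lemma mN_int {τ ε σ : ℝ} (hε : 0 < ε) (h : 2 * π * ε < 1) (N : ℕ) :
    ∫ x in (0:ℝ)..1, mN τ ε σ N x = 1 := by
  unfold mN
  rw [intervalIntegral.integral_const_mul, intervalIntegral.integral_finsetSum
    (fun k _ => (fseq_props hε h k).1.intervalIntegrable _ _)]
  simp_rw [(fseq_props (τ := τ) (σ := σ) hε h _).2.2.2]
  simp; field_simp

lemma mN_per {τ ε σ : ℝ} (hε : 0 < ε) (h : 2 * π * ε < 1) (N : ℕ) :
    Function.Periodic (mN τ ε σ N) 1 := by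
  intro x
  unfold mN
  simp_rw [(fseq_props (τ := τ) (σ := σ) hε h _).2.1 x]

lemma mN_Lam {τ ε σ : ℝ} (hε : 0 < ε) (h : 2 * π * ε < 1) (N : ℕ) (x : ℝ) :
    mN τ ε σ N x = Lam τ ε σ (mN τ ε σ N) x
      + ((N:ℝ)+1)⁻¹ * (fseq τ ε σ 0 x - fseq τ ε σ (N+1) x) := by
  have h2 := gz_cont τ ε
  have e : Lam τ ε σ (mN τ ε σ N) x = ((N:ℝ)+1)⁻¹ * ∑ k ∈ Finset.range (N+1), fseq τ ε σ (k+1) x := by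
    unfold mN
    conv_lhs => unfold Lam
    rw [intervalIntegral.integral_const_mul, intervalIntegral.integral_finsetSum]
    · rw [mul_left_comm, Finset.mul_sum]; rfl
    · intro k _
      have := (fseq_props (τ := τ) (σ := σ) hε h k).1
      apply Continuous.intervalIntegrable; fun_prop
  rw [e, ← mul_add]
  unfold mN
  congr 1
  have a1 := Finset.sum_range_succ (fun k => fseq τ ε σ k x) (N+1)
  have a2 := Finset.sum_range_succ' (fun k => fseq τ ε σ k x) (N+1)
  linarith

lemma subseq_exists (C : ℝ) (M : ℕ → ℝ → ℝ) (h0 : ∀ N, M N 0 = 0)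
    (hL : ∀ N x y, |M N x - M N y| ≤ C * |x - y|) :
    ∃ φ : ℕ → ℕ, StrictMono φ ∧ ∀ x, ∃ l, Tendsto (fun n => M (φ n) x) atTop (nhds l) := by
  have hc : IsCompact (Set.pi univ fun q : ℚ => Icc (-(C * |(q:ℝ)|)) (C * |(q:ℝ)|)) :=
    isCompact_univ_pi fun q => isCompact_Icc
  obtain ⟨a, -, φ, hφ, hl⟩ := hc.tendsto_subseq (x := fun N (q : ℚ) => M N q) (fun N q _ => by
    have := hL N q 0
    rw [h0, sub_zero, sub_zero] at this
    exact abs_le.mp this)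
  rw [tendsto_pi_nhds] at hl
  refine ⟨φ, hφ, fun x => ?_⟩
  apply cauchySeq_tendsto_of_complete
  rw [Metric.cauchySeq_iff']
  intro e he
  have hC0 : 0 ≤ C := by
    have := (abs_nonneg _).trans (hL 0 1 0); simpa using this
  obtain ⟨q, hq1, hq2⟩ := exists_rat_btwn (show x < x + e / (3 * (C + 1)) by
    have : 0 < e / (3 * (C+1)) := by positivity
    linarith)
  have hq : C * |x - q| ≤ e / 3 := by
    rw [abs_sub_comm, abs_of_pos (by linarith)]
    calc C * (q - x) ≤ (C + 1) * (e / (3 * (C+1))) := by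
          apply mul_le_mul <;> linarith
      _ = e / 3 := by field_simp
  obtain ⟨N, hN⟩ := Metric.cauchySeq_iff'.mp (hl q).cauchySeq (e/3) (by positivity)
  refine ⟨N, fun n hn => ?_⟩
  have h1 := hN n hn
  simp only [Real.dist_eq, Function.comp] at h1 ⊢
  have h2 := hL (φ n) x q
  have h3 := hL (φ N) x q
  rw [abs_lt] at h1 ⊢
  rw [abs_le] at h2 h3
  constructor <;> linarith

theorem exists_density {τ ε σ : ℝ} (hε : 0 < ε) (h : 2 * π * ε < 1) (hσ : 0 < σ) :
    ∃ m : ℝ → ℝ, Continuous m ∧ Function.Periodic m 1 ∧ (∀ x, 0 ≤ m x) ∧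
      ∫ x in (0:ℝ)..1, m x = 1 ∧ ∀ x, Lam τ ε σ m x = m x := by
  set C := 2 * (σ⁻¹ * (σ + 1)) with hC
  have hC0 : 0 ≤ C := by positivity
  have hi : ∀ N a b, IntervalIntegrable (mN τ ε σ N) volume a b :=
    fun N a b => (mN_cont hε h N).intervalIntegrable a b
  have hsub : ∀ N x y, (∫ u in (0:ℝ)..x, mN τ ε σ N u) - (∫ u in (0:ℝ)..y, mN τ ε σ N u)
      = ∫ u in y..x, mN τ ε σ N u := fun N x y =>
    intervalIntegral.integral_interval_sub_left (hi _ _ _) (hi _ _ _)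
  obtain ⟨φ, hφ, hlim⟩ := subseq_exists C (fun N x => ∫ u in (0:ℝ)..x, mN τ ε σ N u)
    (fun N => by simp) (fun N x y => by
      rw [hsub, ← Real.norm_eq_abs]
      refine intervalIntegral.norm_integral_le_of_norm_le_const fun u _ => ?_
      rw [Real.norm_eq_abs, abs_of_nonneg (mN_nonneg hε h N u)]
      exact mN_le hε h hσ N u)
  choose M hM using hlim
  -- pointwise limit of the averages
  set m : ℝ → ℝ := fun x => gd ε x * (σ⁻¹ * (M (gz τ ε x + σ / 2) - M (gz τ ε x - σ / 2))) with hm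
  have hlamlim : ∀ x, Tendsto (fun n => Lam τ ε σ (mN τ ε σ (φ n)) x) atTop (nhds (m x)) := by
    intro x
    unfold Lam
    simp_rw [avg_eq σ hσ]
    refine Tendsto.const_mul _ (Tendsto.const_mul _ ?_)
    exact ((hM _).sub (hM _)).congr fun n => hsub _ _ _
  have hmlim : ∀ x, Tendsto (fun n => mN τ ε σ (φ n) x) atTop (nhds (m x)) := by
    intro x
    have hz : Tendsto (fun n => (((φ n : ℕ):ℝ)+1)⁻¹ * (fseq τ ε σ 0 x - fseq τ ε σ (φ n+1) x)) atTop
        (nhds 0) := by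
      have h1 : Tendsto (fun n => (((φ n : ℕ):ℝ)+1)⁻¹ * C) atTop (nhds 0) := by
        have : Tendsto (fun n => (((φ n : ℕ):ℝ)+1)⁻¹) atTop (nhds 0) :=
          tendsto_inv_atTop_zero.comp (tendsto_atTop_add_const_right _ _
            (tendsto_natCast_atTop_atTop.comp hφ.tendsto_atTop))
        simpa using this.mul_const C
      refine squeeze_zero_norm (fun n => ?_) h1
      rw [norm_mul, Real.norm_eq_abs, Real.norm_eq_abs, abs_of_nonneg (by positivity)]
      refine mul_le_mul_of_nonneg_left ?_ (by positivity)
      have a1 := fseq_le (τ := τ) hε h hσ 0 x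
      have a2 := fseq_le (τ := τ) hε h hσ (φ n + 1) x
      have a3 := (fseq_props (τ := τ) (σ := σ) hε h 0).2.2.1 x
      have a4 := (fseq_props (τ := τ) (σ := σ) hε h (φ n + 1)).2.2.1 x
      rw [abs_le]; constructor <;> linarith
    have := (hlamlim x).add hz
    rw [add_zero] at this
    exact this.congr fun n => (mN_Lam hε h _ x).symm
  have hMLip : ∀ x y, |M x - M y| ≤ C * |x - y| := by
    intro x y
    refine le_of_tendsto ((hM x).sub (hM y)).abs (Eventually.of_forall fun n => ?_)
    rw [hsub, ← Real.norm_eq_abs]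
    refine intervalIntegral.norm_integral_le_of_norm_le_const fun u _ => ?_
    rw [Real.norm_eq_abs, abs_of_nonneg (mN_nonneg hε h _ u)]
    exact mN_le hε h hσ _ u
  have hMc : Continuous M := by
    have : LipschitzWith ⟨C, hC0⟩ M := LipschitzWith.of_dist_le_mul fun x y => by
      rw [Real.dist_eq, Real.dist_eq]; exact hMLip x y
    exact this.continuous
  have hmc : Continuous m := by
    have h1 := gd_cont ε
    have h2 := gz_cont τ ε
    rw [hm]; fun_prop
  have hint : ∀ a b, Tendsto (fun n => ∫ x in a..b, mN τ ε σ (φ n) x) atTop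
      (nhds (∫ x in a..b, m x)) := by
    intro a b
    refine intervalIntegral.tendsto_integral_filter_of_dominated_convergence (fun _ => C) ?_ ?_ ?_ ?_
    · exact Eventually.of_forall fun n => (mN_cont hε h _).aestronglyMeasurable
    · refine Eventually.of_forall fun n => ae_of_all _ fun u _ => ?_
      rw [Real.norm_eq_abs, abs_of_nonneg (mN_nonneg hε h _ u)]
      exact mN_le hε h hσ _ u
    · exact intervalIntegrable_const
    · exact ae_of_all _ fun x _ => hmlim x
  refine ⟨m, hmc, ?_, ?_, ?_, ?_⟩
  · intro x
    refine tendsto_nhds_unique (hmlim (x+1)) ((hmlim x).congr fun n => (mN_per hε h _ x).symm)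
  · intro x
    exact ge_of_tendsto (hmlim x) (Eventually.of_forall fun n => mN_nonneg hε h _ x)
  · refine tendsto_nhds_unique (hint 0 1) ?_
    simp_rw [mN_int hε h]
    exact tendsto_const_nhds
  · intro x
    refine tendsto_nhds_unique ?_ (hlamlim x)
    unfold Lam
    simp_rw [avg_eq σ hσ]
    exact Tendsto.const_mul _ (Tendsto.const_mul _ (hint _ _))

def Mini (τ ε σ : ℝ) : Prop := ∀ O : Set ℝ, O.Nonempty → (∀ x : ℝ, ∀ k : ℤ, x ∈ O → x + k ∈ O) →
  (∀ x ∈ O, ∀ w ∈ Icc (-(1/2) : ℝ) (1/2), gz τ ε x + σ * w ∈ O) → O = univ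

lemma cont_zero {f : ℝ → ℝ} (hf : Continuous f) {a b : ℝ} (hab : a < b) (h0 : ∀ x ∈ Icc a b, 0 ≤ f x)
    (hi : ∫ x in a..b, f x ≤ 0) : ∀ x ∈ Icc a b, f x = 0 := by
  intro x hx
  by_contra hne
  have : 0 < ∫ x in a..b, f x := intervalIntegral.integral_pos hab hf.continuousOn
    (fun y hy => h0 y (Ioc_subset_Icc_self hy)) ⟨x, hx, lt_of_le_of_ne (h0 x hx) (Ne.symm hne)⟩
  linarith

lemma gz_surj (τ ε : ℝ) : Surjective (gz τ ε) := by
  refine (gz_cont τ ε).surjective ?_ ?_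
  · refine tendsto_atTop_mono (f := fun x => x + (τ - |ε|)) (fun x => ?_)
      (tendsto_atTop_add_const_right _ _ tendsto_id)
    unfold gz
    have : |ε * Real.sin (2 * π * x)| ≤ |ε| := by
      rw [abs_mul]; exact mul_le_of_le_one_right (abs_nonneg _) (Real.abs_sin_le_one _)
    have := (abs_le.mp this).2
    linarith
  · refine tendsto_atBot_mono (f := fun x => x + (τ + |ε|)) (fun x => ?_)
      (tendsto_atBot_add_const_right _ _ tendsto_id)
    unfold gz
    have : |ε * Real.sin (2 * π * x)| ≤ |ε| := by
      rw [abs_mul]; exact mul_le_of_le_one_right (abs_nonneg _) (Real.abs_sin_le_one _)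
    have := (abs_le.mp this).1
    linarith

lemma loc_const {τ ε σ : ℝ} (hσ : 0 < σ) (f c : ℝ → ℝ)
    (h : ∀ x, ∀ w ∈ Icc (-(1/2) : ℝ) (1/2), f (gz τ ε x + σ * w) = c x) (x y : ℝ) : f x = f y := by
  have : IsLocallyConstant f := by
    rw [IsLocallyConstant.iff_eventually_eq]
    intro x
    obtain ⟨x', rfl⟩ := gz_surj τ ε x
    filter_upwards [Icc_mem_nhds (show gz τ ε x' - σ / 2 < gz τ ε x' by linarith)
      (show gz τ ε x' < gz τ ε x' + σ / 2 by linarith)] with y hy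
    have h0 := h x' 0 (by constructor <;> norm_num)
    have h1 := h x' ((y - gz τ ε x') / σ) (by
      constructor
      · rw [le_div_iff₀ hσ]; linarith [hy.1]
      · rw [div_le_iff₀ hσ]; linarith [hy.2])
    rw [mul_zero, add_zero] at h0
    rw [mul_div_cancel₀ _ hσ.ne', add_sub_cancel] at h1
    rw [h0, h1]
  exact this.apply_eq_of_preconnectedSpace x y

lemma density_pos {τ ε σ : ℝ} (hε : 0 < ε) (h : 2 * π * ε < 1) (hmin : Mini τ ε σ)
    {m : ℝ → ℝ} (hc : Continuous m) (hp : Function.Periodic m 1) (h0 : ∀ x, 0 ≤ m x)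
    (h1 : ∫ x in (0:ℝ)..1, m x = 1) (hL : ∀ x, Lam τ ε σ m x = m x) (x : ℝ) : 0 < m x := by
  by_contra hx
  have hu := hmin {x | m x = 0} ⟨x, le_antisymm (not_lt.mp hx) (h0 x)⟩ (by
    intro x k hx
    have := hp.int_mul k x
    simp only [mul_one] at this
    simpa [this] using hx) (by
    intro x hx w hw
    have h2 := hL x
    rw [mem_ofPred_eq] at hx
    rw [hx] at h2
    unfold Lam at h2
    have h3 := (mul_eq_zero.mp h2).resolve_left (gd_pos hε h x).ne'
    exact cont_zero (f := fun w => m (gz τ ε x + σ * w)) (by fun_prop) (by norm_num)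
      (fun _ _ => h0 _) h3.le w hw)
  have : ∀ x, m x = 0 := fun x => by
    have : x ∈ {x | m x = 0} := hu ▸ mem_univ x
    exact this
  simp [this] at h1

/-- gap map -/
def Sg (ε x s : ℝ) : ℝ := s - ε * (Real.sin (2 * π * (x + s)) - Real.sin (2 * π * x))

lemma Sg_eq (τ ε x s : ℝ) : Sg ε x s = gz τ ε (x + s) - gz τ ε x := by unfold Sg gz; ring

lemma Sg_cont (ε : ℝ) : Continuous (fun p : ℝ × ℝ => Sg ε p.1 p.2) := by unfold Sg; fun_prop

lemma Sg_per (ε x s : ℝ) : Sg ε (x + 1) s = Sg ε x s := by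
  unfold Sg
  rw [show 2 * π * (x + 1 + s) = 2 * π * (x + s) + 2 * π by ring,
   show 2 * π * (x + 1) = 2 * π * x + 2 * π by ring, Real.sin_add_two_pi, Real.sin_add_two_pi]

/-- averaged function -/
def av (m : ℝ → ℝ) (x s : ℝ) : ℝ := ∫ r in (0:ℝ)..1, m (x + s * r)

lemma av_cont {m : ℝ → ℝ} (hm : Continuous m) : Continuous (fun p : ℝ × ℝ => av m p.1 p.2) := by
  unfold av
  exact intervalIntegral.continuous_parametric_intervalIntegral_of_continuous' (by fun_prop) _ _

lemma av_pos {m : ℝ → ℝ} (hm : Continuous m) (h : ∀ x, 0 < m x) (x s : ℝ) : 0 < av m x s :=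
  intervalIntegral.intervalIntegral_pos_of_pos_on
    (by apply Continuous.intervalIntegrable; fun_prop) (fun _ _ => h _) zero_lt_one

lemma av_mul (m : ℝ → ℝ) (x s : ℝ) : s * av m x s = ∫ u in x..(x + s), m u := by
  unfold av
  rw [intervalIntegral.mul_integral_comp_add_mul]
  simp

lemma av_zero (m : ℝ → ℝ) (x : ℝ) : av m x 0 = m x := by simp [av]

lemma av_per {m : ℝ → ℝ} (hm : Function.Periodic m 1) (x s : ℝ) : av m (x + 1) s = av m x s := by
  unfold av
  refine intervalIntegral.integral_congr fun r _ => ?_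
  rw [← hm (x + s * r)]; congr 1; ring

lemma av_gd (τ ε x s : ℝ) : s * av (gd ε) x s = Sg ε x s := by
  rw [av_mul, intervalIntegral.integral_eq_sub_of_hasDerivAt (fun y _ => gz_hasDeriv τ ε y)
    ((gd_cont ε).intervalIntegrable _ _), Sg_eq τ]

lemma Sg_one (ε x : ℝ) : Sg ε x 1 = 1 := by
  unfold Sg
  rw [show 2 * π * (x + 1) = 2 * π * x + 2 * π by ring, Real.sin_add_two_pi]; ring

lemma Sg_compl (ε x s : ℝ) : 1 - Sg ε x s = (1 - s) * av (gd ε) (x + s) (1 - s) := by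
  rw [av_gd 0, Sg_eq 0, Sg_eq 0]
  have := gz_add_int 0 ε x 1
  push_cast at this
  rw [show x + s + (1 - s) = x + 1 by ring, this]; ring

lemma Sg_zero (ε x : ℝ) : Sg ε x 0 = 0 := by simp [Sg]

lemma av_gd_pos {ε : ℝ} (hε : 0 < ε) (h : 2 * π * ε < 1) (x s : ℝ) : 0 < av (gd ε) x s :=
  av_pos (gd_cont ε) (gd_pos hε h) x s

lemma av_gd_le {ε : ℝ} (hε : 0 < ε) (h : 2 * π * ε < 1) (x s : ℝ) : av (gd ε) x s ≤ 2 := by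
  unfold av
  have hc := gd_cont ε
  calc _ ≤ ∫ r in (0:ℝ)..1, (2:ℝ) := intervalIntegral.integral_mono_on zero_le_one
        (by apply Continuous.intervalIntegrable; fun_prop) (by simp) (fun r _ => gd_le hε h _)
    _ = 2 := by simp

lemma Sg_mem {ε : ℝ} (hε : 0 < ε) (h : 2 * π * ε < 1) (x : ℝ) {s : ℝ} (hs : s ∈ Icc (0:ℝ) 1) :
    Sg ε x s ∈ Icc (0:ℝ) 1 := by
  constructor
  · rw [← av_gd 0]; exact mul_nonneg hs.1 (av_gd_pos hε h _ _).le
  · have := Sg_compl ε x s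
    have := mul_nonneg (sub_nonneg.mpr hs.2) (av_gd_pos hε h (x+s) (1-s)).le
    linarith

def Bf (m : ℝ → ℝ) (x s : ℝ) : ℝ := av m x s * av m (x + s) (1 - s)

lemma Bf_cont {m : ℝ → ℝ} (hm : Continuous m) : Continuous (fun p : ℝ × ℝ => Bf m p.1 p.2) := by
  unfold Bf
  exact (av_cont hm).mul ((av_cont hm).comp (f := fun p : ℝ × ℝ => (p.1 + p.2, 1 - p.2)) (by fun_prop))

lemma Bf_pos {m : ℝ → ℝ} (hm : Continuous m) (h : ∀ x, 0 < m x) (x s : ℝ) : 0 < Bf m x s :=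
  mul_pos (av_pos hm h _ _) (av_pos hm h _ _)

lemma Bf_per {m : ℝ → ℝ} (hm : Function.Periodic m 1) (x s : ℝ) : Bf m (x + 1) s = Bf m x s := by
  unfold Bf
  rw [av_per hm, show x + 1 + s = x + s + 1 by ring, av_per hm]

def Df (m : ℝ → ℝ) (x s : ℝ) : ℝ := s * av m x s

lemma av_one {m : ℝ → ℝ} (hp : Function.Periodic m 1)
    (h1 : ∫ x in (0:ℝ)..1, m x = 1) (x : ℝ) : av m x 1 = 1 := by
  have := av_mul m x 1
  rw [one_mul] at this
  rw [this, hp.intervalIntegral_add_eq _ 0]; simpa using h1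

lemma Df_compl {m : ℝ → ℝ} (hm : Continuous m) (hp : Function.Periodic m 1)
    (h1 : ∫ x in (0:ℝ)..1, m x = 1) (x s : ℝ) : 1 - Df m x s = (1 - s) * av m (x + s) (1 - s) := by
  unfold Df
  rw [av_mul, av_mul]
  have h2 : ∫ u in x..(x+1), m u = 1 := by
    rw [hp.intervalIntegral_add_eq _ 0]; simpa using h1
  have := intervalIntegral.integral_add_adjacent_intervals (hm.intervalIntegrable (μ := volume) x (x+s))
    (hm.intervalIntegrable (μ := volume) (x+s) (x+1))
  rw [show x + s + (1 - s) = x + 1 by ring]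
  linarith

lemma Df_B {m : ℝ → ℝ} (hm : Continuous m) (hp : Function.Periodic m 1)
    (h1 : ∫ x in (0:ℝ)..1, m x = 1) (x s : ℝ) :
    Df m x s * (1 - Df m x s) = s * (1 - s) * Bf m x s := by
  rw [Df_compl hm hp h1]; unfold Df Bf; ring

lemma Df_cont {m : ℝ → ℝ} (hm : Continuous m) : Continuous (fun p : ℝ × ℝ => Df m p.1 p.2) := by
  unfold Df; exact continuous_snd.mul (av_cont hm)

lemma Df_mart {τ ε σ : ℝ} {m : ℝ → ℝ} (hm : Continuous m) (hL : ∀ x, Lam τ ε σ m x = m x) (x s : ℝ) :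
    ∫ w in (-(1/2) : ℝ)..(1/2), Df m (gz τ ε x + σ * w) (Sg ε x s) = Df m x s := by
  unfold Df
  rw [av_mul]
  have := Lam_integral τ ε σ hm x (x + s)
  simp_rw [hL] at this
  rw [this]
  refine intervalIntegral.integral_congr fun w _ => ?_
  rw [av_mul, Sg_eq τ]
  congr 1; ring

lemma Sg_e (ε x s : ℝ) : Sg ε x s * (1 - Sg ε x s) = s * (1 - s) * Bf (gd ε) x s := by
  rw [Sg_compl]; nth_rewrite 1 [← av_gd 0]; unfold Bf; ring

structure Dens (τ ε σ : ℝ) (m : ℝ → ℝ) : Prop where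
  he : 0 < ε
  h2 : 2 * π * ε < 1
  hs : 0 < σ
  c : Continuous m
  p : Function.Periodic m 1
  pos : ∀ x, 0 < m x
  one : ∫ x in (0:ℝ)..1, m x = 1
  L : ∀ x, Lam τ ε σ m x = m x

def Yf (τ ε σ : ℝ) (m : ℝ → ℝ) (x s w : ℝ) : ℝ :=
  Bf (gd ε) x s * Bf m (gz τ ε x + σ * w) (Sg ε x s) / Bf m x s

lemma Yf_cont {τ ε σ : ℝ} {m : ℝ → ℝ} (H : Dens τ ε σ m) :
    Continuous (fun p : (ℝ × ℝ) × ℝ => Yf τ ε σ m p.1.1 p.1.2 p.2) := by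
  unfold Yf
  have h1 := Sg_cont ε
  have h2 := gz_cont τ ε
  refine Continuous.div ?_ ((Bf_cont H.c).comp continuous_fst) fun p => (Bf_pos H.c H.pos _ _).ne'
  refine ((Bf_cont (gd_cont ε)).comp continuous_fst).mul ?_
  refine (Bf_cont H.c).comp (f := fun p : (ℝ × ℝ) × ℝ => (gz τ ε p.1.1 + σ * p.2, Sg ε p.1.1 p.1.2)) ?_
  have : Continuous fun p : (ℝ × ℝ) × ℝ => Sg ε p.1.1 p.1.2 := h1.comp continuous_fst
  fun_prop

lemma Yf_cont1 {τ ε σ : ℝ} {m : ℝ → ℝ} (H : Dens τ ε σ m) (x s : ℝ) :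
    Continuous (fun w => Yf τ ε σ m x s w) :=
  (Yf_cont H).comp (f := fun w : ℝ => ((x, s), w)) (by fun_prop)

lemma Yf_pos {τ ε σ : ℝ} {m : ℝ → ℝ} (H : Dens τ ε σ m) (x s w : ℝ) : 0 < Yf τ ε σ m x s w :=
  div_pos (mul_pos (Bf_pos (gd_cont ε) (gd_pos H.he H.h2) _ _) (Bf_pos H.c H.pos _ _))
    (Bf_pos H.c H.pos _ _)

lemma Yf_mul {τ ε σ : ℝ} {m : ℝ → ℝ} (H : Dens τ ε σ m) (x s w : ℝ) :
    Yf τ ε σ m x s w * (Df m x s * (1 - Df m x s)) =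
      Df m (gz τ ε x + σ * w) (Sg ε x s) * (1 - Df m (gz τ ε x + σ * w) (Sg ε x s)) := by
  rw [Df_B H.c H.p H.one, Df_B H.c H.p H.one, Sg_e]
  unfold Yf
  have := (Bf_pos H.c H.pos x s).ne'
  field_simp

lemma Dz_cont {τ ε σ : ℝ} {m : ℝ → ℝ} (H : Dens τ ε σ m) (x s : ℝ) :
    Continuous (fun w => Df m (gz τ ε x + σ * w) (Sg ε x s)) :=
  (Df_cont H.c).comp (f := fun w : ℝ => (gz τ ε x + σ * w, Sg ε x s)) (by fun_prop)

lemma Dz_var {τ ε σ : ℝ} {m : ℝ → ℝ} (H : Dens τ ε σ m) (x s : ℝ) :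
    ∫ w in (-(1/2) : ℝ)..(1/2), (Df m (gz τ ε x + σ * w) (Sg ε x s) - Df m x s)^2 =
     Df m x s * (1 - Df m x s) - ∫ w in (-(1/2) : ℝ)..(1/2), Df m (gz τ ε x + σ * w) (Sg ε x s) * (1 - Df m (gz τ ε x + σ * w) (Sg ε x s)) := by
  have hc := Dz_cont H x s
  have hM := Df_mart H.c H.L x s
  set t := Df m x s
  set X := fun w => Df m (gz τ ε x + σ * w) (Sg ε x s) with hX
  change ∫ w in (-(1/2) : ℝ)..(1/2), (X w - t)^2 = t * (1 - t) - ∫ w in (-(1/2) : ℝ)..(1/2), X w * (1 - X w)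
  change ∫ w in (-(1/2) : ℝ)..(1/2), X w = t at hM
  have e : ∀ w, (X w - t)^2 = (1 - 2 * t) * X w + t ^ 2 - X w * (1 - X w) := fun w => by ring
  simp_rw [e]
  have i1 : IntervalIntegrable (fun w => (1 - 2 * t) * X w) volume (-(1/2)) (1/2) :=
    (hc.const_mul _).intervalIntegrable _ _
  have i2 : IntervalIntegrable (fun w => X w * (1 - X w)) volume (-(1/2)) (1/2) :=
    (hc.mul (continuous_const.sub hc)).intervalIntegrable _ _
  rw [intervalIntegral.integral_sub (i1.add (by simp)) i2, intervalIntegral.integral_add i1 (by simp),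
    intervalIntegral.integral_const_mul, hM, intervalIntegral.integral_const]
  norm_num
  ring

lemma EYf_le {τ ε σ : ℝ} {m : ℝ → ℝ} (H : Dens τ ε σ m) (x s : ℝ) (hs : s ∈ Icc (0:ℝ) 1) :
    ∫ w in (-(1/2) : ℝ)..(1/2), Yf τ ε σ m x s w ≤ 1 := by
  have hcl : IsClosed {s : ℝ | ∫ w in (-(1/2) : ℝ)..(1/2), Yf τ ε σ m x s w ≤ 1} := by
    refine isClosed_le ?_ continuous_const
    refine intervalIntegral.continuous_parametric_intervalIntegral_of_continuous' ?_ _ _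
    exact (Yf_cont H).comp (f := fun p : ℝ × ℝ => ((x, p.1), p.2)) (by fun_prop)
  have hsub : Ioo (0:ℝ) 1 ⊆ {s : ℝ | ∫ w in (-(1/2) : ℝ)..(1/2), Yf τ ε σ m x s w ≤ 1} := by
    intro s hs
    have hv := Dz_var H x s
    have hpos : 0 < Df m x s * (1 - Df m x s) := by
      rw [Df_B H.c H.p H.one]
      exact mul_pos (mul_pos hs.1 (by linarith [hs.2])) (Bf_pos H.c H.pos _ _)
    simp_rw [← Yf_mul H] at hv
    rw [intervalIntegral.integral_mul_const] at hv
    have h0 : 0 ≤ ∫ w in (-(1/2) : ℝ)..(1/2), (Df m (gz τ ε x + σ * w) (Sg ε x s) - Df m x s)^2 :=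
      intervalIntegral.integral_nonneg (by norm_num) fun _ _ => sq_nonneg _
    rw [mem_ofPred_eq]
    by_contra hc
    push Not at hc
    nlinarith
  have := hcl.closure_subset_iff.mpr hsub
  rw [closure_Ioo (by norm_num)] at this
  exact this hs

def Rf (τ ε σ : ℝ) (m : ℝ → ℝ) (x s w : ℝ) : ℝ := √(Yf τ ε σ m x s w)

lemma Rf_cont {τ ε σ : ℝ} {m : ℝ → ℝ} (H : Dens τ ε σ m) :
    Continuous (fun p : (ℝ × ℝ) × ℝ => Rf τ ε σ m p.1.1 p.1.2 p.2) := (Yf_cont H).sqrt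

lemma Rf_cont1 {τ ε σ : ℝ} {m : ℝ → ℝ} (H : Dens τ ε σ m) (x s : ℝ) :
    Continuous (fun w => Rf τ ε σ m x s w) := (Yf_cont1 H x s).sqrt

lemma Rf_nonneg (τ ε σ : ℝ) (m : ℝ → ℝ) (x s w : ℝ) : 0 ≤ Rf τ ε σ m x s w := Real.sqrt_nonneg _

lemma Rf_sq {τ ε σ : ℝ} {m : ℝ → ℝ} (H : Dens τ ε σ m) (x s : ℝ) (hs : s ∈ Icc (0:ℝ) 1) :
    ∫ w in (-(1/2) : ℝ)..(1/2), (Rf τ ε σ m x s w - 1)^2 ≤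
      2 - 2 * ∫ w in (-(1/2) : ℝ)..(1/2), Rf τ ε σ m x s w := by
  have e : ∀ w, (Rf τ ε σ m x s w - 1)^2 = Yf τ ε σ m x s w + (1 - 2 * Rf τ ε σ m x s w) := fun w => by
    have := Real.sq_sqrt (Yf_pos H x s w).le
    unfold Rf
    nlinarith
  simp_rw [e]
  have hc := Rf_cont1 H x s
  rw [intervalIntegral.integral_add ((Yf_cont1 H x s).intervalIntegrable _ _)
    (by apply Continuous.intervalIntegrable; fun_prop), intervalIntegral.integral_sub (by simp)
    (by apply Continuous.intervalIntegrable; fun_prop), intervalIntegral.integral_const_mul]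
  have := EYf_le H x s hs
  simp only [intervalIntegral.integral_const]
  norm_num
  linarith

lemma ERf_le {τ ε σ : ℝ} {m : ℝ → ℝ} (H : Dens τ ε σ m) (x s : ℝ) (hs : s ∈ Icc (0:ℝ) 1) :
    ∫ w in (-(1/2) : ℝ)..(1/2), Rf τ ε σ m x s w ≤ 1 := by
  have := Rf_sq H x s hs
  have h0 : 0 ≤ ∫ w in (-(1/2) : ℝ)..(1/2), (Rf τ ε σ m x s w - 1)^2 :=
      intervalIntegral.integral_nonneg (by norm_num) fun _ _ => sq_nonneg _
  linarith

lemma ERf_eq {τ ε σ : ℝ} {m : ℝ → ℝ} (H : Dens τ ε σ m) (x s : ℝ) (hs : s ∈ Icc (0:ℝ) 1)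
    (h : 1 ≤ ∫ w in (-(1/2) : ℝ)..(1/2), Rf τ ε σ m x s w) :
    ∀ w ∈ Icc (-(1/2) : ℝ) (1/2), Rf τ ε σ m x s w = 1 := by
  intro w hw
  have := Rf_sq H x s hs
  have hc := Rf_cont1 H x s
  have := cont_zero (f := fun w => (Rf τ ε σ m x s w - 1)^2) (by fun_prop) (by norm_num)
    (fun _ _ => sq_nonneg _) (by linarith) w hw
  have := pow_eq_zero_iff (two_ne_zero) |>.mp this
  linarith

def kap (τ ε σ : ℝ) (m : ℝ → ℝ) : ℕ → ℝ × ℝ → ℝ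
  | 0 => fun _ => 1
  | n + 1 => fun p => ∫ w in (-(1/2) : ℝ)..(1/2), Rf τ ε σ m p.1 p.2 w *
      kap τ ε σ m n (gz τ ε p.1 + σ * w, Sg ε p.1 p.2)

lemma kap_cont {τ ε σ : ℝ} {m : ℝ → ℝ} (H : Dens τ ε σ m) (n : ℕ) : Continuous (kap τ ε σ m n) := by
  induction n with
  | zero => exact continuous_const
  | succ n ih =>
    refine intervalIntegral.continuous_parametric_intervalIntegral_of_continuous' ?_ _ _
    refine (Rf_cont H).mul (ih.comp (f := fun p : (ℝ × ℝ) × ℝ => (gz τ ε p.1.1 + σ * p.2, Sg ε p.1.1 p.1.2)) ?_)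
    have h2 := gz_cont τ ε
    have : Continuous fun p : (ℝ × ℝ) × ℝ => Sg ε p.1.1 p.1.2 := (Sg_cont ε).comp continuous_fst
    fun_prop

lemma kapw_cont {τ ε σ : ℝ} {m : ℝ → ℝ} (H : Dens τ ε σ m) (n : ℕ) (x s : ℝ) :
    Continuous fun w => kap τ ε σ m n (gz τ ε x + σ * w, Sg ε x s) :=
  (kap_cont H n).comp (f := fun w : ℝ => (gz τ ε x + σ * w, Sg ε x s)) (by fun_prop)

lemma kap_nonneg (τ ε σ : ℝ) (m : ℝ → ℝ) (n : ℕ) (p : ℝ × ℝ) : 0 ≤ kap τ ε σ m n p := by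
  induction n generalizing p with
  | zero => exact zero_le_one
  | succ n ih =>
    exact intervalIntegral.integral_nonneg (by norm_num) fun w _ => mul_nonneg (Rf_nonneg _ _ _ _ _ _ _) (ih _)

lemma Rf_per {τ ε σ : ℝ} {m : ℝ → ℝ} (H : Dens τ ε σ m) (x s w : ℝ) : Rf τ ε σ m (x+1) s w = Rf τ ε σ m x s w := by
  unfold Rf Yf
  have := gz_add_int τ ε x 1
  push_cast at this
  rw [Bf_per (gd_per ε), Bf_per H.p, Sg_per, this, show gz τ ε x + 1 + σ * w = gz τ ε x + σ * w + 1 by ring, Bf_per H.p]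

lemma kap_per {τ ε σ : ℝ} {m : ℝ → ℝ} (H : Dens τ ε σ m) (n : ℕ) (x s : ℝ) :
    kap τ ε σ m n (x + 1, s) = kap τ ε σ m n (x, s) := by
  induction n generalizing x s with
  | zero => rfl
  | succ n ih =>
    refine intervalIntegral.integral_congr fun w _ => ?_
    have := gz_add_int τ ε x 1
    push_cast at this
    simp only
    rw [Rf_per H, Sg_per, this, show gz τ ε x + 1 + σ * w = gz τ ε x + σ * w + 1 by ring, ih]

/-- comparison: if kap a ≤ c * kap b on the strip then the same after one step. -/
lemma kap_step {τ ε σ : ℝ} {m : ℝ → ℝ} (H : Dens τ ε σ m) (c : ℝ) (a b : ℕ)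
    (h : ∀ x, ∀ s ∈ Icc (0:ℝ) 1, kap τ ε σ m a (x, s) ≤ c * kap τ ε σ m b (x, s)) (x s : ℝ)
    (hs : s ∈ Icc (0:ℝ) 1) : kap τ ε σ m (a+1) (x, s) ≤ c * kap τ ε σ m (b+1) (x, s) := by
  change (∫ w in (-(1/2) : ℝ)..(1/2), _) ≤ c * ∫ w in (-(1/2) : ℝ)..(1/2), _
  rw [← intervalIntegral.integral_const_mul]
  have h1 := Rf_cont1 H x s
  have h2 := kapw_cont H a x s
  have h3 := kapw_cont H b x s
  refine intervalIntegral.integral_mono_on (by norm_num) ?_ ?_ fun w _ => ?_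
  · exact (h1.mul h2).intervalIntegrable _ _
  · exact ((h1.mul h3).const_mul c).intervalIntegrable _ _
  · have := mul_le_mul_of_nonneg_left (h (gz τ ε x + σ * w) _ (Sg_mem H.he H.h2 x hs)) (Rf_nonneg τ ε σ m x s w)
    simp only at this ⊢
    linarith

lemma kap_anti1 {τ ε σ : ℝ} {m : ℝ → ℝ} (H : Dens τ ε σ m) (n : ℕ) (x s : ℝ) (hs : s ∈ Icc (0:ℝ) 1) :
    kap τ ε σ m (n+1) (x, s) ≤ 1 * kap τ ε σ m n (x, s) := by
  induction n generalizing x s with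
  | zero =>
    have := ERf_le H x s hs
    simpa [kap] using this
  | succ n ih => exact kap_step H 1 _ _ ih x s hs

lemma kap_anti {τ ε σ : ℝ} {m : ℝ → ℝ} (H : Dens τ ε σ m) (x s : ℝ) (hs : s ∈ Icc (0:ℝ) 1) :
    Antitone fun n => kap τ ε σ m n (x, s) :=
  antitone_nat_of_succ_le fun n => by simpa using kap_anti1 H n x s hs

lemma kap_fract {τ ε σ : ℝ} {m : ℝ → ℝ} (H : Dens τ ε σ m) (n : ℕ) (x s : ℝ) (k : ℤ) :
    kap τ ε σ m n (x + k, s) = kap τ ε σ m n (x, s) := by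
  have : Function.Periodic (fun x => kap τ ε σ m n (x, s)) 1 := fun x => kap_per H n x s
  simpa using this.int_mul k x

lemma max_principle {τ ε σ : ℝ} {m : ℝ → ℝ} (H : Dens τ ε σ m)
    (hN : ∀ N, ∃ x, ∃ s ∈ Icc (0:ℝ) 1, 1/2 < kap τ ε σ m N (x, s)) :
    ∃ Z : Set (ℝ × ℝ), Z.Nonempty ∧ (∀ z ∈ Z, z.2 ∈ Icc (0:ℝ) 1) ∧
      (∀ x s, ∀ k : ℤ, (x, s) ∈ Z → (x + k, s) ∈ Z) ∧
      (∀ x s, (x, s) ∈ Z → ∀ w ∈ Icc (-(1/2) : ℝ) (1/2), Yf τ ε σ m x s w = 1) ∧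
      (∀ x s, (x, s) ∈ Z → ∀ w ∈ Icc (-(1/2) : ℝ) (1/2), (gz τ ε x + σ * w, Sg ε x s) ∈ Z) := by
  have hQ : IsCompact (Icc (0:ℝ) 1 ×ˢ Icc (0:ℝ) 1) := isCompact_Icc.prod isCompact_Icc
  have hmax : ∀ n, ∃ z ∈ Icc (0:ℝ) 1 ×ˢ Icc (0:ℝ) 1, ∀ x, ∀ s ∈ Icc (0:ℝ) 1, kap τ ε σ m n (x, s) ≤ kap τ ε σ m n z := by
    intro n
    obtain ⟨z, hz, hm⟩ := hQ.exists_isMaxOn ⟨(0,0), by simp⟩ (kap_cont H n).continuousOn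
    refine ⟨z, hz, fun x s hs => ?_⟩
    have h1 := kap_fract H n x s (-⌊x⌋)
    rw [← h1]
    refine hm ⟨?_, hs⟩
    push_cast
    exact ⟨by linarith [Int.floor_le x], by linarith [Int.lt_floor_add_one x]⟩
  choose z hz hm using hmax
  set M : ℕ → ℝ := fun n => kap τ ε σ m n (z n) with hM
  have hMa : Antitone M := antitone_nat_of_succ_le fun n => by
    have := kap_anti H (z (n+1)).1 (z (n+1)).2 (hz (n+1)).2 (Nat.le_succ n)
    exact this.trans (hm n _ _ (hz (n+1)).2)
  have hMh : ∀ n, 1/2 ≤ M n := fun n => by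
    obtain ⟨x, s, hs, h⟩ := hN n
    exact h.le.trans (hm n x s hs)
  have hbdd : BddBelow (range M) := ⟨1/2, by rintro _ ⟨n, rfl⟩; exact hMh n⟩
  set μ := ⨅ n, M n with hμ
  have hlim : Tendsto M atTop (nhds μ) := tendsto_atTop_ciInf hMa hbdd
  have hμM : ∀ n, μ ≤ M n := fun n => ciInf_le hbdd n
  have hμ0 : 1/2 ≤ μ := le_ciInf hMh
  refine ⟨{p | p.2 ∈ Icc (0:ℝ) 1 ∧ ∀ n, μ ≤ kap τ ε σ m n p}, ?_, fun z hz => hz.1, ?_, ?_⟩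
  · have := IsCompact.nonempty_iInter_of_sequence_nonempty_isCompact_isClosed
      (fun n => (Icc (0:ℝ) 1 ×ˢ Icc (0:ℝ) 1) ∩ {p | μ ≤ kap τ ε σ m n p}) (fun n p hp => ⟨hp.1, by
        have := kap_anti H p.1 p.2 hp.1.2 (Nat.le_succ n)
        exact le_trans hp.2 this⟩) (fun n => ⟨z n, hz n, hμM n⟩)
      (hQ.inter_right (isClosed_le continuous_const (kap_cont H 0)))
      (fun n => hQ.isClosed.inter (isClosed_le continuous_const (kap_cont H n)))
    obtain ⟨p, hp⟩ := this
    rw [mem_iInter] at hp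
    exact ⟨p, (hp 0).1.2, fun n => (hp n).2⟩
  · rintro x s k ⟨h1, h2⟩
    exact ⟨h1, fun n => by rw [kap_fract H]; exact h2 n⟩
  · rw [← forall_and]; intro x
    rw [← forall_and]; intro s
    rw [← forall_and]; rintro ⟨h1, h2⟩
    simp only at h1
    have hR : ∀ w ∈ Icc (-(1/2) : ℝ) (1/2), Rf τ ε σ m x s w = 1 := by
      refine ERf_eq H x s h1 ?_
      have hle : ∀ n, μ ≤ M n * ∫ w in (-(1/2) : ℝ)..(1/2), Rf τ ε σ m x s w := by
        intro n
        refine (h2 (n+1)).trans ?_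
        change (∫ w in (-(1/2) : ℝ)..(1/2), _) ≤ _
        rw [← intervalIntegral.integral_const_mul]
        refine intervalIntegral.integral_mono_on (by norm_num) ?_ ?_ fun w _ => ?_
        · exact ((Rf_cont1 H x s).mul (kapw_cont H n x s)).intervalIntegrable _ _
        · exact ((Rf_cont1 H x s).const_mul _).intervalIntegrable _ _
        · rw [mul_comm]
          exact mul_le_mul_of_nonneg_right (hm n _ _ (Sg_mem H.he H.h2 x h1)) (Rf_nonneg _ _ _ _ _ _ _)
      have := ge_of_tendsto' (hlim.mul_const (∫ w in (-(1/2) : ℝ)..(1/2), Rf τ ε σ m x s w)) hle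
      nlinarith
    constructor
    · intro w hw
      have := hR w hw
      unfold Rf at this
      exact Real.sqrt_eq_one.mp this
    · intro w hw
      refine ⟨Sg_mem H.he H.h2 x h1, fun n => ?_⟩
      have hint : ∀ k, μ ≤ ∫ w in (-(1/2) : ℝ)..(1/2), kap τ ε σ m k (gz τ ε x + σ * w, Sg ε x s) := by
        intro k
        refine (h2 (k+1)).trans (le_of_eq ?_)
        refine intervalIntegral.integral_congr fun w hw => ?_
        rw [uIcc_of_le (by norm_num)] at hw
        simp only
        rw [hR w hw, one_mul]
      have hz0 : ∀ k, n ≤ k → ∫ w in (-(1/2) : ℝ)..(1/2), max 0 (μ - kap τ ε σ m n (gz τ ε x + σ * w, Sg ε x s)) ≤ M k - μ := by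
        intro k hk
        have hc := kapw_cont H n x s
        have hc2 := kapw_cont H k x s
        calc _ ≤ ∫ w in (-(1/2) : ℝ)..(1/2), (M k - kap τ ε σ m k (gz τ ε x + σ * w, Sg ε x s)) := by
              refine intervalIntegral.integral_mono_on (by norm_num) ?_ ?_ fun w _ => ?_
              · exact (continuous_const.max (continuous_const.sub hc)).intervalIntegrable _ _
              · exact (continuous_const.sub hc2).intervalIntegrable _ _
              · have a1 := hm k (gz τ ε x + σ * w) _ (Sg_mem H.he H.h2 x h1)
                have a2 := kap_anti H (gz τ ε x + σ * w) _ (Sg_mem H.he H.h2 x h1) hk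
                have a3 := hμM k
                simp only at a2
                refine max_le ?_ ?_
                · linarith
                · linarith
          _ ≤ _ := by
              rw [intervalIntegral.integral_sub (by simp) (hc2.intervalIntegrable _ _)]
              have := hint k
              simp only [intervalIntegral.integral_const]
              norm_num
              linarith
      have hz1 : ∫ w in (-(1/2) : ℝ)..(1/2), max 0 (μ - kap τ ε σ m n (gz τ ε x + σ * w, Sg ε x s)) ≤ 0 := by
        have h3 : Tendsto (fun k => M k - μ) atTop (nhds 0) := by simpa using hlim.sub_const μ
        exact ge_of_tendsto h3 (eventually_atTop.mpr ⟨n, hz0⟩)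
      have hc := kapw_cont H n x s
      have := cont_zero (f := fun w => max 0 (μ - kap τ ε σ m n (gz τ ε x + σ * w, Sg ε x s)))
        (continuous_const.max (continuous_const.sub hc)) (by norm_num) (fun _ _ => le_max_left _ _) hz1 w hw
      have := le_max_right 0 (μ - kap τ ε σ m n (gz τ ε x + σ * w, Sg ε x s))
      beta_reduce at *
      linarith

lemma Df_strict {m : ℝ → ℝ} (hm : Continuous m) (h : ∀ x, 0 < m x) (x : ℝ) : StrictMono (Df m x) := by
  intro s t hst
  unfold Df
  rw [av_mul, av_mul]
  have := intervalIntegral.integral_add_adjacent_intervals (hm.intervalIntegrable (μ := volume) x (x+s))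
    (hm.intervalIntegrable (μ := volume) (x+s) (x+t))
  have h2 : 0 < ∫ u in (x+s)..(x+t), m u := intervalIntegral.intervalIntegral_pos_of_pos_on
    (hm.intervalIntegrable _ _) (fun _ _ => h _) (by linarith)
  linarith

/-- rigidity on the boundary -/
lemma rigid_bd {τ ε σ : ℝ} {m : ℝ → ℝ} (H : Dens τ ε σ m) (hmin : Mini τ ε σ)
    (Z : Set ℝ) (h0 : Z.Nonempty) (hper : ∀ x, ∀ k : ℤ, x ∈ Z → x + k ∈ Z)
    (hG : ∀ x ∈ Z, ∀ w ∈ Icc (-(1/2) : ℝ) (1/2), gz τ ε x + σ * w ∈ Z)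
    (hY : ∀ x ∈ Z, ∀ w ∈ Icc (-(1/2) : ℝ) (1/2), gd ε x * m (gz τ ε x + σ * w) = m x) : False := by
  have hu := hmin Z h0 hper hG
  subst hu
  have hc := loc_const (τ := τ) (ε := ε) H.hs m (fun x => m x / gd ε x) (fun x w hw => by
    have := hY x trivial w hw
    rw [← this, mul_div_cancel_left₀ _ (gd_pos H.he H.h2 x).ne'])
  have h1 := hY 0 trivial 0 (by constructor <;> norm_num)
  rw [hc _ 0] at h1
  have h2 : gd ε 0 = 1 := by
    have := (H.pos 0).ne'
    field_simp at h1
    exact h1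
  unfold gd at h2
  simp at h2
  exact H.he.ne' h2

lemma sin_rigid {ε : ℝ} (hε : 0 < ε) (s : ℝ) (hs : s ∈ Ioo (0:ℝ) 1) (h : ∀ x, Sg ε x s = s) : False := by
  have h1 : ∀ x, Real.sin (2 * π * (x + s)) = Real.sin (2 * π * x) := fun x => by
    have := h x
    unfold Sg at this
    have : ε * (Real.sin (2 * π * (x + s)) - Real.sin (2 * π * x)) = 0 := by linarith
    have := (mul_eq_zero.mp this).resolve_left hε.ne'
    linarith
  have h2 := h1 (1/4)
  rw [show 2 * π * (1/4 + s) = 2 * π * s + π / 2 by ring, show 2 * π * (1/4) = π / 2 by ring,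
    Real.sin_add_pi_div_two, Real.sin_pi_div_two, Real.cos_eq_one_iff] at h2
  obtain ⟨n, hn⟩ := h2
  have : (n:ℝ) = s := by
    have := Real.pi_pos
    have h3 : (2 * π) * (n:ℝ) = 2 * π * s := by linarith
    exact mul_left_cancel₀ (by positivity) h3
  rw [← this] at hs
  have a := hs.1
  have b := hs.2
  norm_cast at a b
  omega

lemma kap_half {τ ε σ : ℝ} {m : ℝ → ℝ} (H : Dens τ ε σ m) (hmin : Mini τ ε σ) :
    ∃ N, ∀ x, ∀ s ∈ Icc (0:ℝ) 1, kap τ ε σ m N (x, s) ≤ 1/2 := by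
  by_contra hN
  push Not at hN
  obtain ⟨Z, ⟨⟨x0, s0⟩, h0⟩, hI, hper, hY, hG⟩ := max_principle H hN
  have hs0 := hI _ h0
  simp only at hs0
  rcases eq_or_lt_of_le hs0.1 with h | ha
  · subst h
    refine rigid_bd H hmin {x | (x, 0) ∈ Z} ⟨x0, h0⟩ (fun x k hx => hper x 0 k hx) ?_ ?_
    · intro x hx w hw
      have := hG x 0 hx w hw
      rwa [Sg_zero] at this
    · intro x hx w hw
      have := hY x 0 hx w hw
      unfold Yf at this
      rw [div_eq_one_iff_eq (Bf_pos H.c H.pos _ _).ne', Sg_zero] at this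
      unfold Bf at this
      have e := av_gd 0 ε x 1
      rw [Sg_one, one_mul] at e
      simpa [av_zero, av_one H.p H.one, e] using this
  rcases eq_or_lt_of_le hs0.2 with h | hb
  · subst h
    refine rigid_bd H hmin {x | (x, 1) ∈ Z} ⟨x0, h0⟩ (fun x k hx => hper x 1 k hx) ?_ ?_
    · intro x hx w hw
      have := hG x 1 hx w hw
      rwa [Sg_one] at this
    · intro x hx w hw
      have := hY x 1 hx w hw
      unfold Yf at this
      rw [div_eq_one_iff_eq (Bf_pos H.c H.pos _ _).ne', Sg_one] at this
      unfold Bf at this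
      have e := av_gd 0 ε x 1
      rw [Sg_one, one_mul] at e
      simp only [sub_self, av_zero, av_one H.p H.one, e, one_mul] at this
      rwa [H.p, H.p, gd_per] at this
  set t := Df m x0 s0 with ht
  have hX : ∀ x s, (x, s) ∈ Z → ∀ w ∈ Icc (-(1/2) : ℝ) (1/2), Df m (gz τ ε x + σ * w) (Sg ε x s) = Df m x s := by
    intro x s hz w hw
    have hv := Dz_var H x s
    have hcst : ∫ w in (-(1/2) : ℝ)..(1/2), Df m (gz τ ε x + σ * w) (Sg ε x s) * (1 - Df m (gz τ ε x + σ * w) (Sg ε x s)) = Df m x s * (1 - Df m x s) := by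
      have : ∫ w in (-(1/2) : ℝ)..(1/2), Df m (gz τ ε x + σ * w) (Sg ε x s) * (1 - Df m (gz τ ε x + σ * w) (Sg ε x s)) = ∫ w in (-(1/2) : ℝ)..(1/2), Df m x s * (1 - Df m x s) := by
        refine intervalIntegral.integral_congr fun w hw => ?_
        rw [uIcc_of_le (by norm_num)] at hw
        rw [← Yf_mul H, hY x s hz w hw, one_mul]
      rw [this, intervalIntegral.integral_const]; norm_num
    rw [hcst, sub_self] at hv
    have hc := Dz_cont H x s
    have := cont_zero (f := fun w => (Df m (gz τ ε x + σ * w) (Sg ε x s) - Df m x s)^2) (by fun_prop)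
      (by norm_num) (fun _ _ => sq_nonneg _) hv.le w hw
    have := pow_eq_zero_iff (two_ne_zero) |>.mp this
    linarith
  have hu := hmin {x | ∃ s, (x, s) ∈ Z ∧ Df m x s = t} ⟨x0, s0, h0, rfl⟩ (by
    rintro x k ⟨s, h1, h2⟩
    refine ⟨s, hper x s k h1, ?_⟩
    rw [← h2]
    have : Function.Periodic (fun x => Df m x s) 1 := fun x => by unfold Df; simp only; rw [av_per H.p]
    simpa using this.int_mul k x) (by
    rintro x ⟨s, h1, h2⟩ w hw
    exact ⟨_, hG x s h1 w hw, (hX x s h1 w hw).trans h2⟩)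
  have hex : ∀ x, ∃ s, (x, s) ∈ Z ∧ Df m x s = t := fun x => by
    have : x ∈ {x | ∃ s, (x, s) ∈ Z ∧ Df m x s = t} := hu ▸ mem_univ x
    exact this
  choose T hT1 hT2 using hex
  have huniq : ∀ x s, Df m x s = t → s = T x := fun x s hs =>
    (Df_strict H.c H.pos x).injective (hs.trans (hT2 x).symm)
  have hTs : ∀ x, ∀ w ∈ Icc (-(1/2) : ℝ) (1/2), T (gz τ ε x + σ * w) = Sg ε x (T x) := fun x w hw =>
    (huniq _ _ ((hX x _ (hT1 x) w hw).trans (hT2 x))).symm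
  have hcon := loc_const H.hs T (fun x => Sg ε x (T x)) hTs
  have hT0 : T x0 = s0 := (huniq _ _ rfl).symm
  refine sin_rigid H.he s0 ⟨ha, hb⟩ fun x => ?_
  have := hTs x 0 (by constructor <;> norm_num)
  rw [hcon _ x0, hcon x x0, hT0] at this
  exact this.symm

lemma kap_add {τ ε σ : ℝ} {m : ℝ → ℝ} (H : Dens τ ε σ m) (c : ℝ) (N : ℕ)
    (h : ∀ x, ∀ s ∈ Icc (0:ℝ) 1, kap τ ε σ m N (x, s) ≤ c) (n : ℕ) (x s : ℝ)
    (hs : s ∈ Icc (0:ℝ) 1) : kap τ ε σ m (N+n) (x, s) ≤ c * kap τ ε σ m n (x, s) := by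
  induction n generalizing x s with
  | zero => simpa [kap] using h x s hs
  | succ n ih => exact kap_step H c _ _ ih x s hs

lemma kap_sum {τ ε σ : ℝ} {m : ℝ → ℝ} (H : Dens τ ε σ m) (N : ℕ)
    (h : ∀ x, ∀ s ∈ Icc (0:ℝ) 1, kap τ ε σ m N (x, s) ≤ 1/2) (M : ℕ) (x s : ℝ)
    (hs : s ∈ Icc (0:ℝ) 1) : ∑ n ∈ Finset.range M, kap τ ε σ m n (x, s) ≤ 2 * N := by
  have hN : 1 ≤ N := by
    rcases Nat.eq_zero_or_pos N with rfl | hN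
    · have := h 0 0 (by simp)
      simp [kap] at this
      norm_num at this
    · exact hN
  have key : ∀ k, ∑ n ∈ Finset.range (N * k), kap τ ε σ m n (x, s) ≤ 2 * N := by
    intro k
    induction k with
    | zero => simp
    | succ k ih =>
      rw [Nat.mul_succ, Nat.add_comm, Finset.sum_range_add]
      have h1 : ∑ n ∈ Finset.range N, kap τ ε σ m n (x, s) ≤ N := by
        calc _ ≤ ∑ n ∈ Finset.range N, (1:ℝ) :=
              Finset.sum_le_sum fun n _ => kap_anti H x s hs (Nat.zero_le n)
          _ = N := by simp
      have h2 : ∑ n ∈ Finset.range (N * k), kap τ ε σ m (N + n) (x, s) ≤ N := by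
        calc _ ≤ ∑ n ∈ Finset.range (N * k), 1/2 * kap τ ε σ m n (x, s) :=
              Finset.sum_le_sum fun n _ => kap_add H _ N h n x s hs
          _ ≤ N := by rw [← Finset.mul_sum]; linarith
      linarith
  refine le_trans ?_ (key M)
  refine Finset.sum_le_sum_of_subset_of_nonneg ?_ fun n _ _ => kap_nonneg _ _ _ _ _ _
  exact Finset.range_subset_range.mpr (Nat.le_mul_of_pos_left M hN)

def Wf (s : ℝ) : ℝ := √(s * (1 - s))

def Vf (τ ε σ : ℝ) (m : ℝ → ℝ) (n : ℕ) (p : ℝ × ℝ) : ℝ :=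
  √(Df m p.1 p.2 * (1 - Df m p.1 p.2)) * kap τ ε σ m n p

theorem keyC {τ ε σ : ℝ} (hε : 0 < ε) (h : 2 * π * ε < 1) (hσ : 0 < σ) (hmin : Mini τ ε σ) :
    ∃ (V : ℕ → ℝ × ℝ → ℝ) (C : ℝ), 0 ≤ C ∧ (∀ n, Continuous (V n)) ∧ (∀ n p, 0 ≤ V n p) ∧
      (∀ n x, ∀ s ∈ Icc (0:ℝ) 1,
        ∫ w in (-(1/2) : ℝ)..(1/2), V n (gz τ ε x + σ * w, Sg ε x s) = V (n+1) (x, s)) ∧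
      (∀ x, ∀ s ∈ Icc (0:ℝ) 1, Wf s ≤ V 0 (x, s)) ∧
      (∀ M x, ∀ s ∈ Icc (0:ℝ) 1, ∑ n ∈ Finset.range M, V n (x, s) ≤ C * Wf s) := by
  obtain ⟨m, hc, hp, h0, h1, hL⟩ := exists_density (τ := τ) hε h hσ
  have H : Dens τ ε σ m := ⟨hε, h, hσ, hc, hp, density_pos hε h hmin hc hp h0 h1 hL, h1, hL⟩
  obtain ⟨N, hN⟩ := kap_half H hmin
  have hQ : IsCompact (Icc (0:ℝ) 1 ×ˢ Icc (0:ℝ) 1) := isCompact_Icc.prod isCompact_Icc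
  have hBf : ∀ x s, Bf m (x - ⌊x⌋) s = Bf m x s := fun x s => by
    have : Function.Periodic (fun x => Bf m x s) 1 := fun x => Bf_per hp x s
    simpa using this.sub_int_mul_eq (x := x) ⌊x⌋
  have hfl : ∀ x : ℝ, x - ⌊x⌋ ∈ Icc (0:ℝ) 1 := fun x =>
    ⟨by linarith [Int.floor_le x], by linarith [Int.lt_floor_add_one x]⟩
  obtain ⟨z1, -, hz1⟩ := hQ.exists_isMinOn ⟨(0,0), by simp⟩ (Bf_cont hc).continuousOn
  obtain ⟨z2, -, hz2⟩ := hQ.exists_isMaxOn ⟨(0,0), by simp⟩ (Bf_cont hc).continuousOn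
  set b := Bf m z1.1 z1.2
  set b2 := Bf m z2.1 z2.2
  have hb : 0 < b := Bf_pos hc H.pos _ _
  have hb1 : ∀ x, ∀ s ∈ Icc (0:ℝ) 1, b ≤ Bf m x s := fun x s hs => by
    rw [← hBf x s]
    exact hz1 (show (x - ⌊x⌋, s) ∈ Icc (0:ℝ) 1 ×ˢ Icc (0:ℝ) 1 from ⟨hfl x, hs⟩)
  have hb2 : ∀ x, ∀ s ∈ Icc (0:ℝ) 1, Bf m x s ≤ b2 := fun x s hs => by
    rw [← hBf x s]
    exact hz2 (show (x - ⌊x⌋, s) ∈ Icc (0:ℝ) 1 ×ˢ Icc (0:ℝ) 1 from ⟨hfl x, hs⟩)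
  have hW : ∀ x s, s ∈ Icc (0:ℝ) 1 → √(Df m x s * (1 - Df m x s)) = Wf s * √(Bf m x s) := fun x s hs => by
    rw [Df_B hc hp h1, Wf, Real.sqrt_mul (mul_nonneg hs.1 (by linarith [hs.2]))]
  refine ⟨fun n p => (√b)⁻¹ * Vf τ ε σ m n p, (√b)⁻¹ * √b2 * (2 * N), by positivity, ?_, ?_, ?_, ?_, ?_⟩
  · intro n
    have := Df_cont hc
    exact ((this.mul (continuous_const.sub this)).sqrt.mul (kap_cont H n)).const_mul _
  · intro n p
    exact mul_nonneg (by positivity) (mul_nonneg (Real.sqrt_nonneg _) (kap_nonneg _ _ _ _ _ _))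
  · intro n x s hs
    rw [intervalIntegral.integral_const_mul]
    congr 1
    unfold Vf
    simp only [kap]
    rw [← intervalIntegral.integral_const_mul]
    refine intervalIntegral.integral_congr fun w _ => ?_
    beta_reduce
    rw [← Yf_mul H, Real.sqrt_mul (Yf_pos H _ _ _).le]
    unfold Rf
    ring
  · intro x s hs
    simp only [Vf, kap, mul_one]
    rw [hW x s hs, inv_mul_eq_div, le_div_iff₀ (by positivity)]
    exact mul_le_mul_of_nonneg_left (Real.sqrt_le_sqrt (hb1 x s hs)) (Real.sqrt_nonneg _)
  · intro M x s hs
    simp only [Vf]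
    rw [← Finset.mul_sum, ← Finset.mul_sum, hW x s hs, mul_assoc, mul_assoc, mul_assoc, ]
    refine mul_le_mul_of_nonneg_left ?_ (by positivity)
    have a1 := kap_sum H N hN M x s hs
    have a2 := Real.sqrt_le_sqrt (hb2 x s hs)
    have a3 : 0 ≤ Wf s := Real.sqrt_nonneg _
    have a4 : 0 ≤ ∑ n ∈ Finset.range M, kap τ ε σ m n (x, s) := Finset.sum_nonneg fun _ _ => kap_nonneg _ _ _ _ _ _
    have := mul_le_mul a2 a1 a4 (Real.sqrt_nonneg _)
    calc _ ≤ Wf s * (√b2 * (2 * N)) := mul_le_mul_of_nonneg_left this a3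
      _ = _ := by ring

instance nuI_prob : IsProbabilityMeasure nuI := ⟨by unfold nuI; simp; norm_num⟩

lemma P_pi {P : Measure (ℤ → ℝ)} (hP : IsProductNuZ P) (s : Finset ℤ) (t : ℤ → Set ℝ)
    (ht : ∀ i ∈ s, MeasurableSet (t i)) : P (Set.pi s t) = ∏ i ∈ s, nuI (t i) := by
  have h := hP.2 s
  have hm : MeasurableSet (Set.pi univ fun i : s => t i) :=
    MeasurableSet.univ_pi fun i => ht i i.2
  have h2 : P.map (fun ω (i : s) => ω i) (Set.pi univ fun i : s => t i) = ∏ i : s, nuI (t i) := by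
    rw [h, Measure.pi_pi]
  rw [Measure.map_apply (by fun_prop) hm] at h2
  rw [← Finset.prod_coe_sort s (fun i => nuI (t i)), ← h2]
  congr 1
  ext ω
  simp [Set.mem_pi]

lemma P_unique {P Q : Measure (ℤ → ℝ)} (hP : IsProductNuZ P)
    (hQ : ∀ (s : Finset ℤ) (t : ℤ → Set ℝ), (∀ i ∈ s, MeasurableSet (t i)) →
      Q (Set.pi s t) = ∏ i ∈ s, nuI (t i)) : Q = P := by
  rw [Measure.eq_infinitePi (μ := fun _ : ℤ => nuI) (fun s t h => hQ s t fun i _ => h i), Measure.eq_infinitePi (μ := fun _ : ℤ => nuI) (fun s t h => P_pi hP s t fun i _ => h i)]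

lemma shiftZ_meas (n : ℤ) : Measurable (shiftZ n) := by
  unfold shiftZ; fun_prop

lemma P_shift {P : Measure (ℤ → ℝ)} (hP : IsProductNuZ P) (n : ℤ) : MeasurePreserving (shiftZ n) P P := by
  refine ⟨shiftZ_meas n, P_unique hP fun s t ht => ?_⟩
  rw [Measure.map_apply (shiftZ_meas n) (MeasurableSet.pi s.countable_toSet fun i hi => ht i hi)]
  have : shiftZ n ⁻¹' (Set.pi s t) = Set.pi (s.map (Equiv.addRight n).toEmbedding) (fun i => t (i - n)) := by
    ext ω
    simp only [mem_preimage, Set.mem_pi, shiftZ, Finset.mem_coe, Finset.mem_map, Equiv.coe_toEmbedding,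
      Equiv.coe_addRight]
    constructor
    · rintro h i ⟨j, hj, rfl⟩
      simpa using h j hj
    · intro h i hi
      simpa using h (i + n) ⟨i, hi, rfl⟩
  rw [this, P_pi hP]
  · simp
  · intro i hi
    simp only [Finset.mem_map, Equiv.coe_toEmbedding, Equiv.coe_addRight] at hi
    obtain ⟨j, hj, rfl⟩ := hi
    simpa using ht j hj

lemma P_update {P : Measure (ℤ → ℝ)} (hP : IsProductNuZ P) (k : ℤ) :
    (P.prod nuI).map (fun p : (ℤ → ℝ) × ℝ => update p.1 k p.2) = P := by
  have := hP.1
  have hmeas : Measurable (fun p : (ℤ → ℝ) × ℝ => update p.1 k p.2) := by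
    rw [measurable_pi_iff]
    intro i
    by_cases h : i = k
    · subst h; simp; fun_prop
    · simp [h]; fun_prop
  refine P_unique hP fun s t ht => ?_
  rw [Measure.map_apply hmeas (MeasurableSet.pi s.countable_toSet fun i hi => ht i hi)]
  by_cases hk : k ∈ s
  · have : (fun p : (ℤ → ℝ) × ℝ => update p.1 k p.2) ⁻¹' (Set.pi s t) = (Set.pi (s.erase k) t) ×ˢ (t k) := by
      ext ⟨ω, w⟩
      simp only [mem_preimage, Set.mem_pi, mem_prod, Finset.mem_coe, Finset.mem_erase]
      constructor
      · intro h
        refine ⟨fun i hi => ?_, ?_⟩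
        · have := h i hi.2; rwa [update_of_ne hi.1] at this
        · have := h k hk; rwa [update_self] at this
      · rintro ⟨h1, h2⟩ i hi
        by_cases h : i = k
        · subst h; rwa [update_self]
        · rw [update_of_ne h]; exact h1 i ⟨h, hi⟩
    rw [this, Measure.prod_prod, P_pi hP _ _ (fun i hi => ht i (Finset.mem_of_mem_erase hi)), Finset.prod_erase_mul _ _ hk]
  · have : (fun p : (ℤ → ℝ) × ℝ => update p.1 k p.2) ⁻¹' (Set.pi s t) = (Set.pi s t) ×ˢ univ := by
      ext ⟨ω, w⟩
      simp only [mem_preimage, Set.mem_pi, mem_prod, Finset.mem_coe, mem_univ, and_true]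
      refine forall₂_congr fun i hi => ?_
      rw [update_of_ne (show i ≠ k from fun h => hk (h ▸ hi))]
    rw [this, Measure.prod_prod, P_pi hP _ _ ht, measure_univ, mul_one]

lemma upd_meas (k : ℤ) : Measurable (fun p : (ℤ → ℝ) × ℝ => update p.1 k p.2) := by
    rw [measurable_pi_iff]
    intro i
    by_cases h : i = k
    · subst h; simp; fun_prop
    · simp [h]; fun_prop

lemma P_mem {P : Measure (ℤ → ℝ)} (hP : IsProductNuZ P) :
    ∀ᵐ ω ∂P, ∀ k, ω k ∈ Icc (-(1/2) : ℝ) (1/2) := by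
  rw [ae_all_iff]
  intro k
  have := hP.1
  have h := P_pi hP {k} (fun _ => (Icc (-(1/2) : ℝ) (1/2))) (fun _ _ => measurableSet_Icc)
  have h1 : nuI (Icc (-(1/2) : ℝ) (1/2)) = 1 := by
    unfold nuI; rw [Measure.restrict_apply_self]; simp; norm_num
  simp only [Finset.prod_singleton, h1] at h
  have := (prob_compl_eq_zero_iff (μ := P) (MeasurableSet.pi (Finset.countable_toSet _) fun i hi => measurableSet_Icc)).mpr h
  rw [ae_iff]
  refine measure_mono_null ?_ this
  intro ω hω
  simpa using hω

/-- past-measurable -/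
def PastInv {β : Type*} (f : (ℤ → ℝ) → β) : Prop := ∀ ω k w, 0 ≤ k → f (update ω k w) = f ω

def XS (τ ε σ : ℝ) (ω : ℤ → ℝ) (p : ℝ × ℝ) : ℕ → ℝ × ℝ
  | 0 => p
  | n + 1 => (gz τ ε (XS τ ε σ ω p n).1 + σ * ω n, Sg ε (XS τ ε σ ω p n).1 (XS τ ε σ ω p n).2)

lemma XS_upd (τ ε σ : ℝ) (ω : ℤ → ℝ) (p : ℝ × ℝ) (k w) (n : ℕ) (h : (n:ℤ) ≤ k) :
    XS τ ε σ (update ω k w) p n = XS τ ε σ ω p n := by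
  induction n with
  | zero => rfl
  | succ n ih =>
    have := ih (by push_cast at h; omega)
    simp only [XS, this]
    rw [update_of_ne (by push_cast at h; omega)]

lemma XS_mem {τ ε σ : ℝ} (hε : 0 < ε) (h : 2 * π * ε < 1) (ω : ℤ → ℝ) (p : ℝ × ℝ)
    (hp : p.2 ∈ Icc (0:ℝ) 1) (n : ℕ) : (XS τ ε σ ω p n).2 ∈ Icc (0:ℝ) 1 := by
  induction n with
  | zero => exact hp
  | succ n ih => exact Sg_mem hε h _ ih

lemma XS_meas (τ ε σ : ℝ) {f : (ℤ → ℝ) → ℝ × ℝ} (hf : Measurable f) (n : ℕ) :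
    Measurable fun ω => XS τ ε σ ω (f ω) n := by
  induction n with
  | zero => exact hf
  | succ n ih =>
    simp only [XS]
    have h1 := (gz_cont τ ε).measurable.comp (measurable_fst.comp ih)
    have h2 := (Sg_cont ε).measurable.comp ih
    simp only [comp_def] at h1 h2
    exact Measurable.prodMk (h1.add (by fun_prop)) h2

lemma lint_nuI {f : ℝ → ℝ} (hc : Continuous f) (h0 : ∀ w, 0 ≤ f w) :
    ∫⁻ w, ENNReal.ofReal (f w) ∂nuI = ENNReal.ofReal (∫ w in (-(1/2) : ℝ)..(1/2), f w) := by
  rw [intervalIntegral.integral_of_le (by norm_num), ← integral_Icc_eq_integral_Ioc,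
    ofReal_integral_eq_lintegral_ofReal (hc.continuousOn.integrableOn_compact isCompact_Icc) (ae_of_all _ h0)]
  rfl

theorem sumW {τ ε σ : ℝ} (hε : 0 < ε) (h : 2 * π * ε < 1) (hσ : 0 < σ) (hmin : Mini τ ε σ)
    {P : Measure (ℤ → ℝ)} (hP : IsProductNuZ P) :
    ∃ C : ENNReal, C ≠ ⊤ ∧ ∀ f : (ℤ → ℝ) → ℝ × ℝ, Measurable f → PastInv f → (∀ ω, (f ω).2 ∈ Icc (0:ℝ) 1) →
      ∫⁻ ω, ∑' n : ℕ, ENNReal.ofReal (Wf (XS τ ε σ ω (f ω) n).2) ∂P ≤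
        C * ∫⁻ ω, ENNReal.ofReal (Wf (f ω).2) ∂P := by
  obtain ⟨V, C, hC, hVc, hV0, hVi, hVW, hVs⟩ := keyC hε h hσ hmin
  have := hP.1
  refine ⟨ENNReal.ofReal C, ENNReal.ofReal_ne_top, fun f hf hpast hI => ?_⟩
  have hVm : ∀ j n, Measurable fun ω => ENNReal.ofReal (V j (XS τ ε σ ω (f ω) n)) := fun j n =>
    ENNReal.measurable_ofReal.comp ((hVc j).measurable.comp (XS_meas τ ε σ hf n))
  have step : ∀ n j, ∫⁻ ω, ENNReal.ofReal (V j (XS τ ε σ ω (f ω) (n+1))) ∂P =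
      ∫⁻ ω, ENNReal.ofReal (V (j+1) (XS τ ε σ ω (f ω) n)) ∂P := by
    intro n j
    conv_lhs => rw [← P_update hP n]
    rw [lintegral_map (hVm j (n+1)) (upd_meas n)]
    have hme := ((hVm j (n+1)).comp (upd_meas n)).aemeasurable (μ := P.prod nuI)
    simp only [comp_def] at hme
    rw [lintegral_prod _ hme]
    refine lintegral_congr fun ω => ?_
    have e : ∀ w, XS τ ε σ (update ω n w) (f (update ω n w)) (n+1) =
        (gz τ ε (XS τ ε σ ω (f ω) n).1 + σ * w, Sg ε (XS τ ε σ ω (f ω) n).1 (XS τ ε σ ω (f ω) n).2) := by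
      intro w
      rw [hpast ω n w (by positivity)]
      simp only [XS, XS_upd τ ε σ ω (f ω) n w n le_rfl, update_self]
    simp only [e]
    rw [lint_nuI, hVi j _ _ (XS_mem hε h ω _ (hI ω) n)]
    · exact (hVc j).comp (f := fun w => (gz τ ε (XS τ ε σ ω (f ω) n).1 + σ * w, Sg ε (XS τ ε σ ω (f ω) n).1 (XS τ ε σ ω (f ω) n).2)) (by fun_prop)
    · intro w; exact hV0 _ _
  have step2 : ∀ n j, ∫⁻ ω, ENNReal.ofReal (V j (XS τ ε σ ω (f ω) n)) ∂P =
      ∫⁻ ω, ENNReal.ofReal (V (j+n) (f ω)) ∂P := by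
    intro n
    induction n with
    | zero => intro j; rfl
    | succ n ih => intro j; rw [step, ih]; congr! 4; ring
  have hWm : ∀ n, Measurable fun ω => ENNReal.ofReal (Wf (XS τ ε σ ω (f ω) n).2) := fun n => by
    have : Continuous Wf := by unfold Wf; fun_prop
    exact ENNReal.measurable_ofReal.comp (this.measurable.comp (measurable_snd.comp (XS_meas τ ε σ hf n)))
  rw [lintegral_tsum fun n => (hWm n).aemeasurable, ENNReal.tsum_eq_iSup_nat]
  refine iSup_le fun M => ?_
  calc ∑ n ∈ Finset.range M, ∫⁻ ω, ENNReal.ofReal (Wf (XS τ ε σ ω (f ω) n).2) ∂P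
      ≤ ∑ n ∈ Finset.range M, ∫⁻ ω, ENNReal.ofReal (V n (f ω)) ∂P := by
        refine Finset.sum_le_sum fun n _ => ?_
        rw [← zero_add n, ← step2 n 0, zero_add]
        exact lintegral_mono fun ω => ENNReal.ofReal_le_ofReal (hVW _ _ (XS_mem hε h ω _ (hI ω) n))
    _ = ∫⁻ ω, ENNReal.ofReal (∑ n ∈ Finset.range M, V n (f ω)) ∂P := by
        have e0 : ∀ n ∈ Finset.range M, Measurable fun ω => ENNReal.ofReal (V n (f ω)) := fun n _ => hVm n 0
        rw [← lintegral_finsetSum _ e0]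
        refine lintegral_congr fun ω => ?_
        rw [ENNReal.ofReal_sum_of_nonneg fun n _ => hV0 n _]
    _ ≤ ∫⁻ ω, ENNReal.ofReal C * ENNReal.ofReal (Wf (f ω).2) ∂P := by
        refine lintegral_mono fun ω => ?_
        rw [← ENNReal.ofReal_mul hC]
        exact ENNReal.ofReal_le_ofReal (hVs M _ _ (hI ω))
    _ = _ := lintegral_const_mul _ (hWm 0)

lemma shiftZ_upd (n k : ℤ) (ω : ℤ → ℝ) (w : ℝ) : shiftZ n (update ω k w) = update (shiftZ n ω) (k - n) w := by
  ext i
  simp only [shiftZ, update_apply]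
  congr 1
  exact propext ⟨fun h => by omega, fun h => by omega⟩

lemma shiftZ_add (m n : ℤ) (ω : ℤ → ℝ) : shiftZ m (shiftZ n ω) = shiftZ (m + n) ω := by
  ext i; simp only [shiftZ]; congr 1; ring

lemma shiftZ_zero (ω : ℤ → ℝ) : shiftZ 0 ω = ω := by
  ext i; simp [shiftZ]

lemma XS_coc (τ ε σ : ℝ) (ω : ℤ → ℝ) (p : ℝ × ℝ) (k n : ℕ) :
    XS τ ε σ (shiftZ k ω) (XS τ ε σ ω p k) n = XS τ ε σ ω p (k + n) := by
  induction n with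
  | zero => rfl
  | succ n ih =>
    rw [← Nat.add_assoc]
    simp only [XS, ih]
    have : shiftZ k ω n = ω ((k + n : ℕ) : ℤ) := by
      simp only [shiftZ]; congr 1; push_cast; ring
    rw [this]

lemma Wf_cont : Continuous Wf := by unfold Wf; fun_prop

def gN (γ : (ℤ → ℝ) → ℝ ≃o ℝ) (ω : ℤ → ℝ) : ℕ → ℝ ≃o ℝ
  | 0 => OrderIso.refl ℝ
  | n + 1 => (gN γ ω n).trans (γ (shiftZ n ω))

def gZ (γ : (ℤ → ℝ) → ℝ ≃o ℝ) (ω : ℤ → ℝ) : ℤ → ℝ ≃o ℝ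
  | Int.ofNat n => gN γ ω n
  | Int.negSucc n => (gN γ (shiftZ (Int.negSucc n) ω) (n + 1)).symm

lemma gN_coc (γ : (ℤ → ℝ) → ℝ ≃o ℝ) (ω : ℤ → ℝ) (n : ℕ) (s : ℝ) :
    gN γ ω (n + 1) s = gN γ (shiftZ 1 ω) n (γ ω s) := by
  induction n with
  | zero => simp [gN, shiftZ_zero]
  | succ n ih =>
    rw [gN, OrderIso.trans_apply, ih, gN, OrderIso.trans_apply, shiftZ_add]
    norm_cast

lemma gZ_zero (γ : (ℤ → ℝ) → ℝ ≃o ℝ) (ω : ℤ → ℝ) (s : ℝ) : gZ γ ω 0 s = s := rfl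

lemma gZ_orb (γ : (ℤ → ℝ) → ℝ ≃o ℝ) (ω : ℤ → ℝ) (k : ℤ) (s : ℝ) :
    gZ γ ω (k + 1) s = γ (shiftZ k ω) (gZ γ ω k s) := by
  cases k with
  | ofNat n => rfl
  | negSucc n =>
    set y := gZ γ ω (Int.negSucc n) s with hy
    have h1 : gN γ (shiftZ (Int.negSucc n) ω) (n + 1) y = s := by
      rw [hy]; exact OrderIso.apply_symm_apply _ _
    rw [gN_coc, shiftZ_add] at h1
    cases n with
    | zero =>
      exact h1.symm
    | succ n =>
      have e : (Int.negSucc (n+1)) + 1 = Int.negSucc n := by omega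
      have e2 : 1 + (Int.negSucc (n+1)) = Int.negSucc n := by omega
      rw [e2] at h1
      rw [e]
      change (gN γ (shiftZ (Int.negSucc n) ω) (n + 1)).symm s = _
      rw [← h1, OrderIso.symm_apply_apply]

lemma orb_unique (γ : (ℤ → ℝ) → ℝ ≃o ℝ) (ω : ℤ → ℝ) (a b : ℤ → ℝ)
    (ha : ∀ k, a (k+1) = γ (shiftZ k ω) (a k)) (hb : ∀ k, b (k+1) = γ (shiftZ k ω) (b k))
    (h0 : a 0 = b 0) (k : ℤ) : a k = b k := by
  induction k using Int.induction_on with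
  | zero => exact h0
  | succ n ih => rw [ha, hb, ih]
  | pred n ih =>
    have h1 := ha (-n - 1)
    have h2 := hb (-n - 1)
    rw [sub_add_cancel] at h1 h2
    rw [ih, h2] at h1
    exact ((γ _).injective h1).symm

lemma gZ_shift (γ : (ℤ → ℝ) → ℝ ≃o ℝ) (ω : ℤ → ℝ) (n k : ℤ) (s : ℝ) :
    gZ γ (shiftZ n ω) k (gZ γ ω n s) = gZ γ ω (k + n) s := by
  refine orb_unique γ (shiftZ n ω) (fun k => gZ γ (shiftZ n ω) k (gZ γ ω n s))
    (fun k => gZ γ ω (k+n) s) (fun k => gZ_orb _ _ _ _) (fun k => ?_) ?_ k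
  · rw [shiftZ_add, ← gZ_orb]; congr 2; ring
  · simp [gZ_zero]

lemma gZ_one (γ : (ℤ → ℝ) → ℝ ≃o ℝ) (ω : ℤ → ℝ) (s : ℝ) : gZ γ ω 1 s = γ ω s := by
  have := gZ_orb γ ω 0 s
  rw [shiftZ_zero, gZ_zero] at this
  exact this

lemma gZ_fix (γ : (ℤ → ℝ) → ℝ ≃o ℝ) (c : ℝ) (h : ∀ ω, γ ω c = c) (ω : ℤ → ℝ) (k : ℤ) : gZ γ ω k c = c :=
  orb_unique γ ω (fun k => gZ γ ω k c) (fun _ => c) (fun k => gZ_orb _ _ _ _) (fun k => (h _).symm) rfl k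

def MeasF (γ : (ℤ → ℝ) → ℝ ≃o ℝ) : Prop := ∀ s, Measurable fun ω => γ ω s

lemma meas_joint {γ : (ℤ → ℝ) → ℝ ≃o ℝ} (h : MeasF γ) : Measurable fun p : (ℤ → ℝ) × ℝ => γ p.1 p.2 := by
  have := measurable_uncurry_of_continuous_of_measurable (u := fun s : ℝ => fun ω => γ ω s)
    (fun ω => (γ ω).continuous) h
  exact this.comp measurable_swap

lemma meas_symm {γ : (ℤ → ℝ) → ℝ ≃o ℝ} (h : MeasF γ) : MeasF fun ω => (γ ω).symm := by
  intro s
  refine measurable_of_Iio fun c => ?_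
  have : (fun ω => (γ ω).symm s) ⁻¹' Iio c = (fun ω => γ ω c) ⁻¹' Ioi s := by
    ext ω
    simp only [mem_preimage, mem_Iio, mem_Ioi]
    exact (γ ω).symm_apply_lt
  rw [this]
  exact h c measurableSet_Ioi

lemma gN_meas {γ : (ℤ → ℝ) → ℝ ≃o ℝ} (h : MeasF γ) (n : ℕ) : MeasF fun ω => gN γ ω n := by
  intro s
  induction n with
  | zero => exact measurable_const
  | succ n ih =>
    exact (meas_joint h).comp ((shiftZ_meas n).prodMk ih)

lemma gZ_meas {γ : (ℤ → ℝ) → ℝ ≃o ℝ} (h : MeasF γ) (k : ℤ) : MeasF fun ω => gZ γ ω k := by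
  intro s
  cases k with
  | ofNat n => exact gN_meas h n s
  | negSucc n => exact (meas_symm (gN_meas h (n+1)) s).comp (shiftZ_meas (Int.negSucc n))

/-- reflected order isomorphism -/
def rfl1 (e : ℝ ≃o ℝ) : ℝ ≃o ℝ where
  toFun s := 1 - e (1 - s)
  invFun s := 1 - e.symm (1 - s)
  left_inv s := by simp
  right_inv s := by simp
  map_rel_iff' := by
    intro a b
    change 1 - e (1 - a) ≤ 1 - e (1 - b) ↔ a ≤ b
    rw [sub_le_sub_iff_left, e.le_iff_le, sub_le_sub_iff_left]

lemma rfl1_apply (e : ℝ ≃o ℝ) (s : ℝ) : rfl1 e s = 1 - e (1 - s) := rfl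

def rf (γ : (ℤ → ℝ) → ℝ ≃o ℝ) : (ℤ → ℝ) → ℝ ≃o ℝ := fun ω => rfl1 (γ ω)

lemma rf_meas {γ : (ℤ → ℝ) → ℝ ≃o ℝ} (h : MeasF γ) : MeasF (rf γ) := fun s => measurable_const.sub (h (1 - s))

lemma gZ_rf (γ : (ℤ → ℝ) → ℝ ≃o ℝ) (ω : ℤ → ℝ) (k : ℤ) (s : ℝ) : gZ (rf γ) ω k s = 1 - gZ γ ω k (1 - s) := by
  refine orb_unique (rf γ) ω (fun k => gZ (rf γ) ω k s) (fun k => 1 - gZ γ ω k (1 - s)) (fun k => gZ_orb _ _ _ _)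
    (fun k => ?_) (by simp [gZ_zero]) k
  simp [rf, rfl1_apply, gZ_orb]

/-- tail sums -/
def uu (γ : (ℤ → ℝ) → ℝ ≃o ℝ) (ω : ℤ → ℝ) (s : ℝ) (k : ℤ) : ENNReal := ∑' j : ℕ, ENNReal.ofReal (gZ γ ω (k + j) s)

lemma uu_meas {γ : (ℤ → ℝ) → ℝ ≃o ℝ} (h : MeasF γ) (s : ℝ) (k : ℤ) : Measurable fun ω => uu γ ω s k :=
  Measurable.tsum fun j => ENNReal.measurable_ofReal.comp (gZ_meas h (k + j) s)

lemma uu_mono (γ : (ℤ → ℝ) → ℝ ≃o ℝ) (ω : ℤ → ℝ) (k : ℤ) : Monotone fun s => uu γ ω s k := fun s t h =>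
  ENNReal.tsum_le_tsum fun j => ENNReal.ofReal_le_ofReal ((gZ γ ω (k + j)).monotone h)

lemma uu_succ (γ : (ℤ → ℝ) → ℝ ≃o ℝ) (ω : ℤ → ℝ) (s : ℝ) (k : ℤ) :
    uu γ ω s k = ENNReal.ofReal (gZ γ ω k s) + uu γ ω s (k + 1) := by
  unfold uu
  rw [tsum_eq_zero_add' ENNReal.summable]
  congr 1
  · simp
  · congr 1; ext j; congr 3; push_cast; ring

lemma uu_shift (γ : (ℤ → ℝ) → ℝ ≃o ℝ) (ω : ℤ → ℝ) (s : ℝ) (n k : ℤ) :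
    uu γ (shiftZ n ω) (gZ γ ω n s) k = uu γ ω s (k + n) := by
  unfold uu
  congr 1; ext j; rw [gZ_shift]; congr 3; ring

lemma uu_anti (γ : (ℤ → ℝ) → ℝ ≃o ℝ) (ω : ℤ → ℝ) (s : ℝ) : Antitone fun k => uu γ ω s k := by
  refine antitone_int_of_succ_le fun k => ?_
  rw [uu_succ γ ω s k]
  exact le_add_self

lemma uu_top (γ : (ℤ → ℝ) → ℝ ≃o ℝ) (ω : ℤ → ℝ) (s : ℝ) (k : ℤ) : uu γ ω s k = ⊤ ↔ uu γ ω s 0 = ⊤ := by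
  have key : ∀ k, uu γ ω s (k+1) = ⊤ ↔ uu γ ω s k = ⊤ := by
    intro k; rw [uu_succ γ ω s k]; simp
  induction k using Int.induction_on with
  | zero => rfl
  | succ n ih => exact (key _).trans ih
  | pred n ih =>
    have := key (-n - 1)
    rw [sub_add_cancel] at this
    exact this.symm.trans ih

/-- Recurrence lemma. -/
lemma recur {P : Measure (ℤ → ℝ)} [IsProbabilityMeasure P] (T : ℕ → (ℤ → ℝ) → (ℤ → ℝ))
    (hT : ∀ n, MeasurePreserving (T n) P P) (E : ℕ → Set (ℤ → ℝ)) (hE : ∀ j, MeasurableSet (E j))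
    (hanti : Antitone E) (hn : ∀ᵐ ω ∂P, ∃ j, ω ∉ E j) :
    ∀ᵐ ω ∂P, ∃ j, ∃ᶠ n in atTop, T n ω ∉ E j := by
  have h0 : P (⋂ j, E j) = 0 := by
    rw [ae_iff] at hn
    convert hn using 2
    ext; simp
  have hlim := tendsto_measure_iInter_atTop (μ := P) (fun j => (hE j).nullMeasurableSet) hanti ⟨0, measure_ne_top _ _⟩
  rw [h0] at hlim
  have hb : ∀ j, P {ω | ∀ᶠ n in atTop, T n ω ∈ E j} ≤ P (E j) := by
    intro j
    have : {ω | ∀ᶠ n in atTop, T n ω ∈ E j} = ⋃ N : ℕ, ⋂ n ∈ Ici N, T n ⁻¹' E j := by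
      ext ω; simp [eventually_atTop]
    rw [this, Monotone.measure_iUnion]
    · refine iSup_le fun N => ?_
      calc _ ≤ P (T N ⁻¹' E j) := measure_mono (iInter₂_subset N (by simp))
        _ = P (E j) := (hT N).measure_preimage (hE j).nullMeasurableSet
    · intro N M h
      exact biInter_subset_biInter_left (Ici_subset_Ici.mpr h)
  rw [ae_iff]
  refine le_antisymm (ge_of_tendsto' hlim fun j => le_trans (measure_mono ?_) (hb j)) zero_le
  intro ω hω
  simp only [not_exists, not_frequently, not_not, mem_ofPred_eq] at hω ⊢
  exact hω j

def HB (P : Measure (ℤ → ℝ)) (γ : (ℤ → ℝ) → ℝ ≃o ℝ) : Prop :=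
  ∀ᵐ ω ∂P, ∀ c : ENNReal, 0 < c → ∃ j : ℕ, uu γ ω (1 / ((j:ℝ) + 2)) 0 < c

structure Arc (γ : (ℤ → ℝ) → ℝ ≃o ℝ) (ω : ℤ → ℝ) (l : ℝ) : Prop where
  pos : 0 < l
  le1 : l ≤ 1
  fin : ∀ s < l, uu γ ω s 0 < ⊤
  inf : ∀ s, l ≤ s → uu γ ω s 0 = ⊤
  back : ∀ s, 0 < s → ∃ K : ℕ, 2 ≤ uu γ ω s (-K)

lemma seq_anti : Antitone fun j : ℕ => 1 / ((j:ℝ) + 2) := by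
  intro a b h
  have : (a:ℝ) ≤ b := by exact_mod_cast h
  have : (0:ℝ) ≤ a := by positivity
  apply one_div_le_one_div_of_le <;> linarith

lemma gZ_pos {γ : (ℤ → ℝ) → ℝ ≃o ℝ} (h0 : ∀ ω, γ ω 0 = 0) (ω : ℤ → ℝ) (k : ℤ) {s : ℝ} (hs : 0 < s) :
    0 < gZ γ ω k s := by
  have := (gZ γ ω k).strictMono hs
  rwa [gZ_fix γ 0 h0] at this

lemma gZ_nonneg {γ : (ℤ → ℝ) → ℝ ≃o ℝ} (h0 : ∀ ω, γ ω 0 = 0) (ω : ℤ → ℝ) (k : ℤ) {s : ℝ} (hs : 0 ≤ s) :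
    0 ≤ gZ γ ω k s := by
  have := (gZ γ ω k).monotone hs
  rwa [gZ_fix γ 0 h0] at this

lemma uu_zero {γ : (ℤ → ℝ) → ℝ ≃o ℝ} (h0 : ∀ ω, γ ω 0 = 0) (ω : ℤ → ℝ) (k : ℤ) {s : ℝ} (hs : s ≤ 0) :
    uu γ ω s k = 0 := by
  unfold uu
  rw [ENNReal.tsum_eq_zero]
  intro j
  have := (gZ γ ω (k + j)).monotone hs
  rw [gZ_fix γ 0 h0] at this
  exact ENNReal.ofReal_eq_zero.mpr this

lemma uu_ge1 {γ : (ℤ → ℝ) → ℝ ≃o ℝ} (h1 : ∀ ω, γ ω 1 = 1) (ω : ℤ → ℝ) (k : ℤ) {s : ℝ} (hs : 1 ≤ s) :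
    uu γ ω s k = ⊤ := by
  refine top_le_iff.mp (le_trans ?_ (uu_mono γ ω k hs))
  simp only [uu, gZ_fix γ 1 h1, ENNReal.ofReal_one]
  rw [ENNReal.tsum_const_eq_top_of_ne_zero one_ne_zero]

lemma arc_ex {P : Measure (ℤ → ℝ)} (hP : IsProductNuZ P) {γ : (ℤ → ℝ) → ℝ ≃o ℝ} (h0 : ∀ ω, γ ω 0 = 0)
    (h1 : ∀ ω, γ ω 1 = 1) (hm : MeasF γ) (hB : HB P γ) : ∀ᵐ ω ∂P, ∃ l, Arc γ ω l := by
  have := hP.1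
  have R1 := recur (P := P) (fun n => shiftZ n) (fun n => P_shift hP n)
    (fun j => {ω | uu γ ω (1 / ((j:ℝ) + 2)) 0 = ⊤}) (fun j => uu_meas hm _ 0 (measurableSet_singleton _))
    (fun i j hij ω hω => by
      simp only [mem_ofPred_eq] at hω ⊢
      exact top_le_iff.mp (hω ▸ uu_mono γ ω 0 (seq_anti hij)))
    (hB.mono fun ω hω => by
      obtain ⟨j, hj⟩ := hω ⊤ ENNReal.zero_lt_top
      exact ⟨j, hj.ne⟩)
  have R2 : ∀ᵐ ω ∂P, ∀ m : ℕ, ∃ j : ℕ, ∃ᶠ n : ℕ in atTop,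
      shiftZ (-n) ω ∉ {ω | ((m:ENNReal) + 1)⁻¹ ≤ uu γ ω (1 / ((j:ℝ) + 2)) 0} := by
    rw [ae_all_iff]
    intro m
    refine recur (P := P) (fun n => shiftZ (-n)) (fun n => P_shift hP (-n))
      (fun j => {ω | ((m:ENNReal) + 1)⁻¹ ≤ uu γ ω (1 / ((j:ℝ) + 2)) 0})
      (fun j => measurableSet_le measurable_const (uu_meas hm _ 0))
      (fun i j hij ω hω => ?_) (hB.mono fun ω hω => ?_)
    · exact le_trans hω (uu_mono γ ω 0 (seq_anti hij))
    · obtain ⟨j, hj⟩ := hω (((m:ENNReal) + 1)⁻¹) (by simp)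
      exact ⟨j, not_le.mpr hj⟩
  filter_upwards [hB, R1, R2] with ω hω r1 r2
  set S := {s | uu γ ω s 0 < ⊤} with hS
  have hbd : ∀ s ∈ S, s ≤ 1 := by
    intro s hs
    by_contra hc
    push Not at hc
    rw [hS, mem_ofPred_eq, uu_ge1 h1 ω 0 hc.le] at hs
    exact lt_irrefl _ hs
  have hS0 : (0:ℝ) ∈ S := by simp [hS, uu_zero h0 ω 0 le_rfl]
  have hfin : ∀ s < sSup S, uu γ ω s 0 < ⊤ := by
    intro s hs
    obtain ⟨t, ht, hst⟩ := exists_lt_of_lt_csSup ⟨0, hS0⟩ hs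
    exact lt_of_le_of_lt (uu_mono γ ω 0 hst.le) ht
  have hle : ∀ s ∈ S, s ≤ sSup S := fun s hs => le_csSup ⟨1, hbd⟩ hs
  refine ⟨sSup S, ?_, csSup_le ⟨0, hS0⟩ hbd, hfin, ?_, ?_⟩
  · obtain ⟨j, hj⟩ := hω ⊤ ENNReal.zero_lt_top
    exact lt_of_lt_of_le (by positivity) (hle _ hj)
  · intro s hs
    by_contra hc
    have hl : uu γ ω (sSup S) 0 ≠ ⊤ := fun h => hc (top_le_iff.mp (h ▸ uu_mono γ ω 0 hs))
    obtain ⟨j, hj⟩ := r1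
    have ht := ENNReal.tendsto_atTop_zero_of_tsum_ne_top hl
    have hpos : (0:ℝ) < 1 / ((j:ℝ)+2) := by positivity
    have he := ht.eventually_lt_const (ENNReal.ofReal_pos.mpr hpos)
    obtain ⟨n, hn1, hn2⟩ := (hj.and_eventually he).exists
    rw [ENNReal.ofReal_lt_ofReal_iff hpos, zero_add] at hn2
    set t := (gZ γ ω n).symm (1 / ((j:ℝ)+2)) with htd
    have h3 : gZ γ ω n t = 1 / ((j:ℝ)+2) := by rw [htd]; simp
    have h4 : sSup S < t := by
      rw [← h3] at hn2; exact (gZ γ ω n).lt_iff_lt.mp hn2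
    have h5 := uu_shift γ ω t n 0
    rw [h3, zero_add] at h5
    have h6 : t ∈ S := by
      rw [hS, mem_ofPred_eq, lt_top_iff_ne_top, Ne, ← uu_top γ ω t n, ← h5]
      exact hn1
    exact absurd (hle t h6) (not_le.mpr h4)
  · intro s hs
    have hu : uu γ ω s 0 ≠ 0 := by
      rw [uu_succ, gZ_zero]
      have := ENNReal.ofReal_pos.mpr hs
      intro h
      rw [add_eq_zero] at h
      exact this.ne' h.1
    obtain ⟨m, hm1⟩ := ENNReal.exists_inv_nat_lt hu
    obtain ⟨j, hj⟩ := r2 m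
    have hstep : ∀ᶠ n : ℕ in atTop, True := by simp
    have hfr : ∃ᶠ n : ℕ in atTop, 1 / ((j:ℝ)+2) < gZ γ ω (-n) s := by
      refine hj.mono fun n hn => ?_
      by_contra hc
      push Not at hc
      apply hn
      have h5 := uu_shift γ ω s (-n) 0
      rw [zero_add] at h5
      calc ((m:ENNReal) + 1)⁻¹ ≤ (m:ENNReal)⁻¹ := by
            apply ENNReal.inv_le_inv.mpr; exact le_self_add
        _ ≤ uu γ ω s 0 := hm1.le
        _ ≤ uu γ ω s (-n) := uu_anti γ ω s (by omega)
        _ = _ := h5.symm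
        _ ≤ _ := uu_mono γ _ 0 hc
    have hB : ∀ B : ℕ, ∃ K : ℕ, ENNReal.ofReal (B * (1 / ((j:ℝ)+2))) ≤ uu γ ω s (-K) := by
      intro B
      induction B with
      | zero => exact ⟨0, by simp⟩
      | succ B ih =>
        obtain ⟨K, hK⟩ := ih
        obtain ⟨n, hn1, hn2⟩ := (hfr.and_eventually (eventually_ge_atTop (K+1))).exists
        refine ⟨n, ?_⟩
        rw [uu_succ, Nat.cast_succ, add_mul, add_comm, one_mul, ENNReal.ofReal_add (by positivity) (by positivity)]
        refine add_le_add (ENNReal.ofReal_le_ofReal hn1.le) (hK.trans (uu_anti γ ω s (by omega)))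
    obtain ⟨K, hK⟩ := hB (2 * (j + 2))
    refine ⟨K, le_trans (le_of_eq ?_) hK⟩
    have : ((2 * (j + 2) : ℕ) : ℝ) * (1 / ((j:ℝ)+2)) = 2 := by
      push_cast; field_simp
    rw [this]; simp

def psi (u : ENNReal) : ℝ := (min (u - 1) 1).toReal

lemma psi_ne (u : ENNReal) : min (u - 1) 1 ≠ ⊤ := ne_top_of_le_ne_top ENNReal.one_ne_top (min_le_right _ _)

lemma psi_cont : Continuous psi := by
  unfold psi
  refine continuous_iff_continuousAt.mpr fun u => ?_
  have h1 : ContinuousAt (fun u : ENNReal => min (u - 1) 1) u :=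
    ((ENNReal.continuous_sub_right 1).min continuous_const).continuousAt
  exact (ENNReal.tendsto_toReal (psi_ne u)).comp h1

lemma psi_mono : Monotone psi := fun a b h =>
  ENNReal.toReal_mono (psi_ne b) (min_le_min_right _ (tsub_le_tsub_right h 1))

lemma psi_nonneg (u) : 0 ≤ psi u := ENNReal.toReal_nonneg
lemma psi_le (u) : psi u ≤ 1 := by
  have := ENNReal.toReal_mono ENNReal.one_ne_top (min_le_right (u - 1) 1)
  rw [ENNReal.toReal_one] at this
  exact this
lemma psi_lo {u : ENNReal} (h : u ≤ 1) : psi u = 0 := by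
  simp [psi, tsub_eq_zero_of_le h]
lemma psi_hi {u : ENNReal} (h : 2 ≤ u) : psi u = 1 := by
  have : 1 ≤ u - 1 := by
    apply ENNReal.le_sub_of_add_le_right ENNReal.one_ne_top
    rwa [one_add_one_eq_two]
  simp [psi, this]
lemma psi_strict {u u' : ENNReal} (h : u < u') (h1 : 1 < u') (h2 : u < 2) : psi u < psi u' := by
  unfold psi
  refine (ENNReal.toReal_lt_toReal (psi_ne _) (psi_ne _)).mpr ?_
  have hu : u - 1 < 1 := by
    rcases le_or_gt u 1 with h3 | h3
    · rw [tsub_eq_zero_of_le h3]; exact one_pos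
    · refine ENNReal.sub_lt_of_lt_add h3.le ?_
      rwa [one_add_one_eq_two]
  rw [min_eq_left hu.le, lt_min_iff]
  refine ⟨?_, hu⟩
  rcases le_or_gt u 1 with h3 | h3
  · rw [tsub_eq_zero_of_le h3]; exact tsub_pos_of_lt h1
  · exact ENNReal.sub_lt_of_lt_add h3.le (by rwa [tsub_add_cancel_of_le h1.le])

def SK (u : ℤ → ENNReal) (K : ℕ) : ℝ := ∑ i ∈ Finset.range (2 * K), psi (u (i - K)) - K

def TT (u : ℤ → ENNReal) : ℝ := limUnder atTop (SK u)

lemma SK_succ (u : ℤ → ENNReal) (K : ℕ) : SK u (K + 1) = SK u K + (psi (u (-K - 1)) - 1) + psi (u K) := by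
  unfold SK
  rw [show 2 * (K + 1) = 2 * K + 1 + 1 by ring, Finset.sum_range_succ, Finset.sum_range_succ']
  have : ∀ i : ℕ, ((i + 1 : ℕ) : ℤ) - ((K + 1 : ℕ) : ℤ) = i - K := fun i => by push_cast; ring
  simp only [this]
  rw [show (((2 * K : ℕ) : ℤ) - (K : ℤ)) = K by push_cast; ring,
    show (((0 : ℕ) : ℤ) - ((K + 1 : ℕ) : ℤ)) = -K - 1 by push_cast; ring]
  push_cast; ring

lemma SK_shift (u : ℤ → ENNReal) (K : ℕ) :
    SK (fun k => u (k + 1)) K = SK u K + psi (u K) - psi (u (-K)) := by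
  unfold SK
  have h1 := Finset.sum_range_succ (fun i : ℕ => psi (u (i - K))) (2 * K)
  have h2 := Finset.sum_range_succ' (fun i : ℕ => psi (u (i - K))) (2 * K)
  have : ∀ i : ℕ, ((i + 1 : ℕ) : ℤ) - (K : ℤ) = i - K + 1 := fun i => by push_cast; ring
  simp only [this] at h2
  rw [show (((2 * K : ℕ) : ℤ) - (K : ℤ)) = K by push_cast; ring] at h1
  rw [show (((0 : ℕ) : ℤ) - (K : ℤ)) = -K by push_cast; ring] at h2
  linarith

def Reg (u : ℤ → ENNReal) (K0 : ℕ) : Prop := Antitone u ∧ u K0 ≤ 1 ∧ 2 ≤ u (-K0)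

lemma SK_ev {u : ℤ → ENNReal} {K0 : ℕ} (h : Reg u K0) (K : ℕ) (hK : K0 ≤ K) : SK u K = SK u K0 := by
  induction K, hK using Nat.le_induction with
  | base => rfl
  | succ K hK ih =>
    rw [SK_succ, ih, psi_hi (h.2.2.trans (h.1 (by omega))), psi_lo ((h.1 (by omega)).trans h.2.1)]
    ring

lemma TT_eq {u : ℤ → ENNReal} {K0 : ℕ} (h : Reg u K0) : TT u = SK u K0 := by
  refine Tendsto.limUnder_eq ?_
  refine tendsto_const_nhds.congr' ?_
  filter_upwards [eventually_ge_atTop K0] with K hK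
  exact (SK_ev h K hK).symm

lemma TT_shift {u : ℤ → ENNReal} {K0 : ℕ} (h : Reg u K0) : TT (fun k => u (k+1)) = TT u - 1 := by
  refine Tendsto.limUnder_eq ?_
  refine tendsto_const_nhds.congr' ?_
  filter_upwards [eventually_ge_atTop K0] with K hK
  have e1 : psi (u (-K)) = 1 := psi_hi (h.2.2.trans (h.1 (by omega)))
  have e2 : psi (u K) = 0 := psi_lo ((h.1 (by omega)).trans h.2.1)
  rw [SK_shift, SK_ev h K hK, TT_eq h, e1, e2]
  ring

lemma Reg.mono {u : ℤ → ENNReal} {K0 K : ℕ} (h : Reg u K0) (hK : K0 ≤ K) : Reg u K :=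
  ⟨h.1, (h.1 (by omega)).trans h.2.1, h.2.2.trans (h.1 (by omega))⟩

lemma TT_le {u : ℤ → ENNReal} {K0 : ℕ} (h : Reg u K0) (M : ℕ) (hM : u (-M) ≤ 1) : TT u ≤ -M := by
  rw [TT_eq (h.mono (le_max_left K0 M))]
  set K := max K0 M
  have hKM : M ≤ K := le_max_right _ _
  unfold SK
  rw [show 2 * K = (K - M) + (K + M) by omega, Finset.sum_range_add]
  have h1 : ∑ i ∈ Finset.range (K - M), psi (u (i - K)) ≤ (K - M : ℕ) := by
    calc _ ≤ ∑ i ∈ Finset.range (K - M), (1:ℝ) := Finset.sum_le_sum fun i _ => psi_le _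
      _ = _ := by simp
  have h2 : ∑ i ∈ Finset.range (K + M), psi (u ((K - M + i : ℕ) - K)) = 0 := by
    refine Finset.sum_eq_zero fun i _ => psi_lo (le_trans (h.1 ?_) hM)
    omega
  rw [h2]
  rw [Nat.cast_sub hKM] at h1
  linarith

lemma TT_ge {u : ℤ → ENNReal} {K0 : ℕ} (h : Reg u K0) (M : ℕ) (hM : 2 ≤ u M) : M ≤ TT u := by
  rw [TT_eq (h.mono (le_max_left K0 M))]
  set K := max K0 M
  have hKM : M ≤ K := le_max_right _ _
  unfold SK
  rw [show 2 * K = (K + M) + (K - M) by omega, Finset.sum_range_add]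
  have h1 : 0 ≤ ∑ i ∈ Finset.range (K - M), psi (u ((K + M + i : ℕ) - K)) :=
    Finset.sum_nonneg fun i _ => psi_nonneg _
  have h2 : ∑ i ∈ Finset.range (K + M), psi (u (i - K)) = (K + M : ℕ) := by
    rw [Finset.sum_congr rfl (g := fun _ => (1:ℝ)) fun i hi => psi_hi (le_trans hM (h.1 ?_))]
    · simp
    · have := Finset.mem_range.mp hi
      omega
  rw [h2]
  rw [Nat.cast_add]
  linarith

lemma uu_contOn {γ : (ℤ → ℝ) → ℝ ≃o ℝ} (h0 : ∀ ω, γ ω 0 = 0) (ω : ℤ → ℝ) (k : ℤ) (t : ℝ) (ht0 : 0 ≤ t) (ht : uu γ ω t 0 < ⊤) :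
    ContinuousOn (fun s => uu γ ω s k) (Iic t) := by
  have ht' : uu γ ω t k ≠ ⊤ := fun h => ht.ne ((uu_top γ ω t k).mp h)
  have hb : ∀ j : ℕ, ∀ s ∈ Iic t, ‖max (gZ γ ω (k + j) s) 0‖ ≤ (ENNReal.ofReal (gZ γ ω (k + j) t)).toReal := by
    intro j s hs
    have h1 := gZ_nonneg h0 ω (k + j) ht0
    rw [Real.norm_of_nonneg (le_max_right _ _), ENNReal.toReal_ofReal h1]
    exact max_le ((gZ γ ω (k+j)).monotone hs) h1
  have hsum := ENNReal.summable_toReal ht'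
  have hc := continuousOn_tsum (f := fun (j : ℕ) s => max (gZ γ ω (k + j) s) 0) (s := Iic t)
    (fun j => ((gZ γ ω (k+j)).continuous.max continuous_const).continuousOn) hsum hb
  refine (ENNReal.continuous_ofReal.comp_continuousOn hc).congr fun s hs => ?_
  simp only [comp]
  rw [ENNReal.ofReal_tsum_of_nonneg (fun j => le_max_right _ _)
    (Summable.of_norm_bounded hsum fun j => hb j s hs)]
  unfold uu
  congr 1; ext j
  rw [ENNReal.ofReal_max, ENNReal.ofReal_zero, max_eq_left zero_le]

lemma uu_strict {γ : (ℤ → ℝ) → ℝ ≃o ℝ} (h0 : ∀ ω, γ ω 0 = 0) (ω : ℤ → ℝ) (k : ℤ) {s t : ℝ} (hs : 0 ≤ s) (hst : s < t)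
    (ht : uu γ ω t 0 < ⊤) : uu γ ω s k < uu γ ω t k := by
  rw [uu_succ γ ω s, uu_succ γ ω t]
  refine ENNReal.add_lt_add_of_lt_of_le ?_ ?_ (uu_mono γ ω _ hst.le)
  · exact fun h => (lt_of_le_of_lt (uu_mono γ ω 0 hst.le) ht).ne ((uu_top _ _ _ _).mp h)
  · exact (ENNReal.ofReal_lt_ofReal_iff (gZ_pos h0 ω k (hs.trans_lt hst))).mpr ((gZ γ ω k).strictMono hst)

lemma Arc.reg {γ : (ℤ → ℝ) → ℝ ≃o ℝ} {ω : ℤ → ℝ} {l : ℝ} (h : Arc γ ω l) {s0 s1 : ℝ} (hs0 : 0 < s0) (hs1 : s1 < l) :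
    ∃ K0 : ℕ, ∀ s ∈ Icc s0 s1, Reg (uu γ ω s) K0 := by
  obtain ⟨K, hK⟩ := h.back s0 hs0
  have ht := ENNReal.tendsto_sum_nat_add (fun j : ℕ => ENNReal.ofReal (gZ γ ω (0 + j) s1)) (h.fin s1 hs1).ne
  obtain ⟨K', hK'⟩ := (ht.eventually_le_const (show (0:ENNReal) < 1 from one_pos)).exists
  have hK2 : uu γ ω s1 K' ≤ 1 := by
    refine le_trans (le_of_eq ?_) hK'
    unfold uu; congr 1; ext j; congr 3; push_cast; ring
  refine ⟨max K K', fun s hs => ⟨uu_anti γ ω s, ?_, ?_⟩⟩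
  · exact le_trans (uu_anti γ ω s (by exact_mod_cast le_max_right K K')) ((uu_mono γ ω _ hs.2).trans hK2)
  · refine le_trans (hK.trans (uu_mono γ ω _ hs.1)) (uu_anti γ ω s ?_)
    have : (K:ℤ) ≤ (max K K' : ℕ) := by exact_mod_cast le_max_left K K'
    omega

lemma TT_contOn {γ : (ℤ → ℝ) → ℝ ≃o ℝ} (h0 : ∀ ω, γ ω 0 = 0) {ω : ℤ → ℝ} {l : ℝ} (h : Arc γ ω l) (s : ℝ) (hs : s ∈ Ioo 0 l) :
    ContinuousAt (fun s => TT (uu γ ω s)) s := by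
  obtain ⟨s0, hs0, hs0'⟩ := exists_between hs.1
  obtain ⟨s1, hs1', hs1⟩ := exists_between hs.2
  obtain ⟨K, hK⟩ := h.reg hs0 hs1
  have hn : Icc s0 s1 ∈ nhds s := Icc_mem_nhds hs0' hs1'
  have hc : ContinuousOn (fun s => SK (uu γ ω s) K) (Icc s0 s1) := by
    unfold SK
    refine ContinuousOn.sub (continuousOn_finsetSum _ fun i _ => ?_) continuousOn_const
    exact psi_cont.comp_continuousOn ((uu_contOn h0 ω _ s1 (by linarith) (h.fin s1 hs1)).mono fun x hx => hx.2)
  refine (hc.continuousAt hn).congr ?_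
  filter_upwards [hn] with x hx
  exact (TT_eq (hK x hx)).symm

lemma TT_strict {γ : (ℤ → ℝ) → ℝ ≃o ℝ} (h0 : ∀ ω, γ ω 0 = 0) (h1 : ∀ ω, γ ω 1 = 1) {ω : ℤ → ℝ} {l : ℝ} (h : Arc γ ω l)
    {s t : ℝ} (hs : 0 < s) (hst : s < t) (ht : t < l) : TT (uu γ ω s) < TT (uu γ ω t) := by
  obtain ⟨K, hK⟩ := h.reg hs ht
  have hRt := hK t ⟨hst.le, le_rfl⟩
  rw [TT_eq (hK s ⟨le_rfl, hst.le⟩), TT_eq hRt]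
  unfold SK
  refine sub_lt_sub_right ?_ _
  have hk : ∃ i : ℕ, i < 2 * K ∧ 1 < uu γ ω t (i - K) ∧ uu γ ω t (i - K + 1) ≤ 1 := by
    have hex : ∃ i : ℕ, uu γ ω t (i - K) ≤ 1 := ⟨2 * K, by
      rw [show (((2 * K : ℕ) : ℤ) - (K : ℤ)) = K by push_cast; ring]; exact hRt.2.1⟩
    classical
    have hf := Nat.find_spec hex
    have hle : Nat.find hex ≤ 2 * K := Nat.find_min' hex (by
      rw [show (((2 * K : ℕ) : ℤ) - (K : ℤ)) = K by push_cast; ring]; exact hRt.2.1)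
    have hpos : Nat.find hex ≠ 0 := by
      intro h00
      rw [h00] at hf
      simp only [Nat.cast_zero, zero_sub] at hf
      have := hRt.2.2.trans hf
      norm_num at this
    obtain ⟨i, hi⟩ := Nat.exists_eq_succ_of_ne_zero hpos
    refine ⟨i, by omega, ?_, ?_⟩
    · have := Nat.find_min hex (m := i) (by omega)
      exact not_le.mp this
    · rw [hi] at hf
      convert hf using 2
      push_cast; ring
  obtain ⟨i, hi, hi1, hi2⟩ := hk
  refine Finset.sum_lt_sum (fun j _ => psi_mono (uu_mono γ ω _ hst.le)) ⟨i, Finset.mem_range.mpr hi, ?_⟩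
  have hlt := uu_strict h0 ω (i - K) hs.le hst (h.fin t ht)
  refine psi_strict hlt hi1 (hlt.trans ?_)
  rw [uu_succ]
  have hv : gZ γ ω (i - K) t < 1 := by
    have := (gZ γ ω (i - K)).strictMono (show t < 1 from ht.trans_le h.le1)
    rwa [gZ_fix γ 1 h1] at this
  have hv' : ENNReal.ofReal (gZ γ ω (i - K) t) < 1 := by
    rw [← ENNReal.ofReal_one]
    exact (ENNReal.ofReal_lt_ofReal_iff one_pos).mpr hv
  rw [← one_add_one_eq_two]
  exact ENNReal.add_lt_add_of_lt_of_le (ne_top_of_le_ne_top ENNReal.one_ne_top hi2) hv' hi2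

def eta (y : ℝ) : ℝ := y / (y + Real.exp 1 * (1 - y))

def AA (γ : (ℤ → ℝ) → ℝ ≃o ℝ) (ω : ℤ → ℝ) (s : ℝ) : ℝ :=
  if s ≤ 0 then 0 else if uu γ ω s 0 = ⊤ then 1 else (1 + Real.exp (-TT (uu γ ω s)))⁻¹

lemma AA_meas {γ : (ℤ → ℝ) → ℝ ≃o ℝ} (hm : MeasF γ) (s : ℝ) : Measurable fun ω => AA γ ω s := by
  unfold AA
  refine Measurable.ite (by simp) measurable_const (Measurable.ite (uu_meas hm s 0 (measurableSet_singleton _)) measurable_const ?_)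
  have hT : Measurable fun ω => TT (uu γ ω s) := by
    unfold TT
    refine StronglyMeasurable.measurable (StronglyMeasurable.limUnder (f := fun K ω => SK (uu γ ω s) K) fun K => ?_)
    refine Measurable.stronglyMeasurable ?_
    unfold SK
    refine Measurable.sub (Finset.measurable_fun_sum _ fun i _ => ?_) measurable_const
    exact psi_cont.measurable.comp (uu_meas hm s _)
  fun_prop

structure AOK (γ : (ℤ → ℝ) → ℝ ≃o ℝ) (ω : ℤ → ℝ) (l : ℝ) : Prop where
  arc : Arc γ ω l
  cont : Continuous (AA γ ω)
  zero : ∀ s ≤ 0, AA γ ω s = 0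
  one : ∀ s, l ≤ s → AA γ ω s = 1
  lt1 : ∀ s < l, AA γ ω s < 1
  strict : StrictMonoOn (AA γ ω) (Icc 0 l)
  mono : Monotone (AA γ ω)
  eqn : ∀ s, AA γ (shiftZ 1 ω) (γ ω s) = eta (AA γ ω s)

lemma exp_inv_strict {a b : ℝ} (h : a < b) : (1 + Real.exp (-a))⁻¹ < (1 + Real.exp (-b))⁻¹ := by
  have := Real.exp_lt_exp.mpr (neg_lt_neg h)
  have := Real.exp_pos (-b)
  gcongr

lemma AA_mid {γ : (ℤ → ℝ) → ℝ ≃o ℝ} {ω : ℤ → ℝ} {l : ℝ} (h : Arc γ ω l) {s : ℝ} (hs : s ∈ Ioo 0 l) :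
    AA γ ω s = (1 + Real.exp (-TT (uu γ ω s)))⁻¹ := by
  rw [AA, if_neg (not_le.mpr hs.1), if_neg (h.fin s hs.2).ne]

theorem Arc.aok {γ : (ℤ → ℝ) → ℝ ≃o ℝ} (h0 : ∀ ω, γ ω 0 = 0) (h1 : ∀ ω, γ ω 1 = 1) {ω : ℤ → ℝ} {l : ℝ} (h : Arc γ ω l) :
    AOK γ ω l := by
  have hz : ∀ s ≤ 0, AA γ ω s = 0 := fun s hs => by rw [AA, if_pos hs]
  have ho : ∀ s, l ≤ s → AA γ ω s = 1 := fun s hs => by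
    rw [AA, if_neg (not_le.mpr (h.pos.trans_le hs)), if_pos (h.inf s hs)]
  have hmid01 : ∀ s ∈ Ioo 0 l, 0 < AA γ ω s ∧ AA γ ω s < 1 := by
    intro s hs
    rw [AA_mid h hs]
    have := Real.exp_pos (-TT (uu γ ω s))
    exact ⟨by positivity, inv_lt_one_of_one_lt₀ (by linarith)⟩
  have hlt : ∀ s < l, AA γ ω s < 1 := by
    intro s hs
    rcases le_or_gt s 0 with h2 | h2
    · rw [hz s h2]; exact one_pos
    · exact (hmid01 s ⟨h2, hs⟩).2
  have hpos : ∀ s, 0 < s → 0 < AA γ ω s := by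
    intro s hs
    rcases le_or_gt l s with h2 | h2
    · rw [ho s h2]; exact one_pos
    · exact (hmid01 s ⟨hs, h2⟩).1
  have hstr : StrictMonoOn (AA γ ω) (Icc 0 l) := by
    intro s hs t ht hst
    rcases ht.2.eq_or_lt with h2 | h2
    · rw [ho t h2.ge]; exact hlt s (by linarith)
    rcases hs.1.eq_or_lt with h3 | h3
    · rw [hz s h3.ge]; exact hpos t (by linarith)
    rw [AA_mid h ⟨h3, hst.trans h2⟩, AA_mid h ⟨h3.trans hst, h2⟩]
    exact exp_inv_strict (TT_strict h0 h1 h h3 hst h2)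
  have hle1 : ∀ s, AA γ ω s ≤ 1 := fun s => by
    rcases le_or_gt l s with h2 | h2
    · rw [ho s h2]
    · exact (hlt s h2).le
  have hge0 : ∀ s, 0 ≤ AA γ ω s := fun s => by
    rcases le_or_gt s 0 with h2 | h2
    · rw [hz s h2]
    · exact (hpos s h2).le
  have hmono : Monotone (AA γ ω) := by
    intro s t hst
    rcases le_or_gt s 0 with h2 | h2
    · rw [hz s h2]; exact hge0 t
    rcases le_or_gt l t with h3 | h3
    · rw [ho t h3]; exact hle1 s
    exact hstr.monotoneOn ⟨h2.le, by linarith⟩ ⟨by linarith, h3.le⟩ hst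
  -- smallness at zero
  have hlim0 : ∀ c > 0, ∃ s > 0, AA γ ω s < c := by
    intro c hc
    have h3 : Tendsto (fun M : ℕ => (1 + Real.exp (M:ℝ))⁻¹) atTop (nhds 0) := by
      refine tendsto_inv_atTop_zero.comp (tendsto_atTop_add_const_left _ _ ?_)
      exact Real.tendsto_exp_atTop.comp tendsto_natCast_atTop_atTop
    obtain ⟨M, hM⟩ := (h3.eventually_lt_const hc).exists
    have hl2 : l / 2 < l := by linarith [h.pos]
    have hc := uu_contOn h0 ω (-M) (l/2) (by linarith [h.pos]) (h.fin _ hl2)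
    have hc0 : ContinuousAt (fun s => uu γ ω s (-M)) 0 := hc.continuousAt (Iic_mem_nhds (by linarith [h.pos]))
    have he := hc0.eventually_lt_const (show uu γ ω 0 (-M) < 1 by rw [uu_zero h0 ω _ le_rfl]; exact one_pos)
    have he2 : ∀ᶠ s in nhdsWithin (0:ℝ) (Ioi 0), s ∈ Ioo 0 l := Ioo_mem_nhdsGT h.pos
    obtain ⟨s, hs1, hs2⟩ := ((he.filter_mono nhdsWithin_le_nhds).and he2).exists
    refine ⟨s, hs2.1, lt_of_le_of_lt ?_ hM⟩
    rw [AA_mid h hs2]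
    obtain ⟨K, hK⟩ := h.reg hs2.1 hs2.2
    have := TT_le (hK s ⟨le_rfl, le_rfl⟩) M hs1.le
    gcongr
    linarith
  have hlim1 : ∀ c < 1, ∃ s < l, c < AA γ ω s := by
    intro c hc
    have h3 : Tendsto (fun M : ℕ => (1 + Real.exp (-(M:ℝ)))⁻¹) atTop (nhds 1) := by
      have : Tendsto (fun M : ℕ => (1 + Real.exp (-(M:ℝ)))) atTop (nhds (1 + 0)) :=
        tendsto_const_nhds.add (Real.tendsto_exp_atBot.comp (tendsto_neg_atTop_atBot.comp tendsto_natCast_atTop_atTop))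
      simpa using this.inv₀ (by norm_num)
    obtain ⟨M, hM⟩ := (h3.eventually_const_lt hc).exists
    have htop : uu γ ω l M = ⊤ := (uu_top _ _ _ _).mpr (h.inf l le_rfl)
    have hts := ENNReal.tendsto_nat_tsum (fun j : ℕ => ENNReal.ofReal (gZ γ ω (M + j) l))
    have e : ∑' j : ℕ, ENNReal.ofReal (gZ γ ω (M + j) l) = ⊤ := htop
    rw [e] at hts
    obtain ⟨J, hJ⟩ := (hts.eventually_const_lt (show (2:ENNReal) < ⊤ by simp)).exists
    have hcJ : Continuous fun s => ∑ j ∈ Finset.range J, ENNReal.ofReal (gZ γ ω (M + j) s) :=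
      continuous_finsetSum _ fun j _ => ENNReal.continuous_ofReal.comp (gZ γ ω (M+j)).continuous
    have he := hcJ.continuousAt.eventually_const_lt hJ
    have he2 : ∀ᶠ s in nhdsWithin l (Iio l), s ∈ Ioo 0 l := Ioo_mem_nhdsLT h.pos
    obtain ⟨s, hs1, hs2⟩ := ((he.filter_mono nhdsWithin_le_nhds).and he2).exists
    refine ⟨s, hs2.2, lt_of_lt_of_le hM ?_⟩
    rw [AA_mid h hs2]
    obtain ⟨K, hK⟩ := h.reg hs2.1 hs2.2
    have := TT_ge (hK s ⟨le_rfl, le_rfl⟩) M (hs1.le.trans (ENNReal.sum_le_tsum _))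
    gcongr
  refine ⟨h, ?_, hz, ho, hlt, hstr, hmono, ?_⟩
  · refine continuous_iff_continuousAt.mpr fun s => ?_
    rcases lt_trichotomy s 0 with h2 | h2 | h2
    · refine (continuousAt_const (y := (0:ℝ))).congr ?_
      filter_upwards [Iio_mem_nhds h2] with x hx
      exact (hz x (le_of_lt hx)).symm
    · rw [h2]
      refine tendsto_order.mpr ⟨fun c hc => ?_, fun c hc => ?_⟩
      · rw [hz 0 le_rfl] at hc
        exact Eventually.of_forall fun x => hc.trans_le (hge0 x)
      · rw [hz 0 le_rfl] at hc
        obtain ⟨t, ht, htc⟩ := hlim0 c hc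
        filter_upwards [Iio_mem_nhds ht] with x hx
        exact (hmono (le_of_lt hx)).trans_lt htc
    rcases lt_trichotomy s l with h3 | h3 | h3
    · have hT := TT_contOn h0 h s ⟨h2, h3⟩
      have : ContinuousAt (fun s => (1 + Real.exp (-TT (uu γ ω s)))⁻¹) s := by
        refine ContinuousAt.inv₀ (by fun_prop) ?_
        have := Real.exp_pos (-TT (uu γ ω s))
        positivity
      refine this.congr ?_
      filter_upwards [Ioo_mem_nhds h2 h3] with x hx
      exact (AA_mid h hx).symm
    · rw [h3]
      refine tendsto_order.mpr ⟨fun c hc => ?_, fun c hc => ?_⟩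
      · rw [ho l le_rfl] at hc
        obtain ⟨t, ht, htc⟩ := hlim1 c hc
        filter_upwards [Ioi_mem_nhds ht] with x hx
        exact htc.trans_le (hmono (le_of_lt hx))
      · rw [ho l le_rfl] at hc
        exact Eventually.of_forall fun x => (hle1 x).trans_lt hc
    · refine (continuousAt_const (y := (1:ℝ))).congr ?_
      filter_upwards [Ioi_mem_nhds h3] with x hx
      exact (ho x (le_of_lt hx)).symm
  · intro s
    have hsg : γ ω s ≤ 0 ↔ s ≤ 0 := by
      conv_lhs => rw [← h0 ω]
      exact (γ ω).le_iff_le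
    have hu : uu γ (shiftZ 1 ω) (γ ω s) = fun k => uu γ ω s (k + 1) := by
      ext k; rw [← uu_shift, gZ_one]
    rcases le_or_gt s 0 with h2 | h2
    · rw [hz s h2, AA, if_pos (hsg.mpr h2)]; simp [eta]
    rcases le_or_gt l s with h3 | h3
    · rw [ho s h3, AA, if_neg (fun h => absurd (hsg.mp h) (not_le.mpr h2)), if_pos]
      · simp [eta]
      · rw [hu]; exact (uu_top _ _ _ _).mpr (h.inf s h3)
    · rw [AA, if_neg (fun h => absurd (hsg.mp h) (not_le.mpr h2)), if_neg, AA_mid h ⟨h2, h3⟩, hu]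
      · obtain ⟨K, hK⟩ := h.reg h2 h3
        rw [TT_shift (hK s ⟨le_rfl, le_rfl⟩)]
        unfold eta
        rw [show -(TT (uu γ ω s) - 1) = 1 + -TT (uu γ ω s) by ring, Real.exp_add]
        have := Real.exp_pos (-TT (uu γ ω s))
        have := Real.exp_pos 1
        set E := Real.exp (-TT (uu γ ω s))
        set e := Real.exp 1
        have e1 : (1 + E)⁻¹ + e * (1 - (1 + E)⁻¹) = (1 + e * E) / (1 + E) := by
          field_simp
          ring
        rw [e1]
        field_simp
      · rw [hu]; exact fun hh => (h.fin s h3).ne ((uu_top _ _ _ _).mp hh)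

def HA (P : Measure (ℤ → ℝ)) (γ : (ℤ → ℝ) → ℝ ≃o ℝ) : Prop :=
  ∀ᵐ ω ∂P, ∀ q : ℚ, (q:ℝ) ∈ Icc (0:ℝ) 1 → uu γ ω q 0 < ⊤ ∨ uu (rf γ) ω (1 - q) 0 < ⊤

def GoodAA (γ : (ℤ → ℝ) → ℝ ≃o ℝ) (ω : ℤ → ℝ) : Prop := ∃ l, AOK γ ω l ∧ AOK (rf γ) ω (1 - l)

lemma good_ae {P : Measure (ℤ → ℝ)} (hP : IsProductNuZ P) {γ : (ℤ → ℝ) → ℝ ≃o ℝ} (h0 : ∀ ω, γ ω 0 = 0)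
    (h1 : ∀ ω, γ ω 1 = 1) (hm : MeasF γ) (hB : HB P γ) (hB' : HB P (rf γ)) (hA : HA P γ) :
    ∀ᵐ ω ∂P, GoodAA γ ω := by
  have h0' : ∀ ω, rf γ ω 0 = 0 := fun ω => by simp [rf, rfl1_apply, h1]
  have h1' : ∀ ω, rf γ ω 1 = 1 := fun ω => by simp [rf, rfl1_apply, h0]
  filter_upwards [arc_ex hP h0 h1 hm hB, arc_ex hP h0' h1' (rf_meas hm) hB', hA] with ω ⟨l, hl⟩ ⟨l', hl'⟩ ha
  have e1 : l + l' ≤ 1 := by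
    by_contra hc
    push Not at hc
    obtain ⟨s, hs1, hs2⟩ := exists_between (show 1 - l' < l by linarith)
    have f1 := hl.fin s hs2
    have f2 := hl'.fin (1 - s) (by linarith)
    have f3 := ENNReal.add_lt_top.mpr ⟨f1, f2⟩
    unfold uu at f3
    rw [← ENNReal.tsum_add] at f3
    refine f3.ne (top_le_iff.mp ?_)
    rw [← ENNReal.tsum_const_eq_top_of_ne_zero (α := ℕ) (one_ne_zero (α := ENNReal))]
    refine ENNReal.tsum_le_tsum fun j => ?_
    rw [gZ_rf, sub_sub_cancel]
    refine le_trans (le_of_eq ?_) ENNReal.ofReal_add_le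
    simp
  have e2 : 1 ≤ l + l' := by
    by_contra hc
    push Not at hc
    obtain ⟨q, hq1, hq2⟩ := exists_rat_btwn (show l < 1 - l' by linarith)
    have := hl.pos
    have := hl'.pos
    rcases ha q ⟨by linarith, by linarith⟩ with h | h
    · exact h.ne (hl.inf q hq1.le)
    · exact h.ne (hl'.inf (1 - q) (by linarith))
  refine ⟨l, hl.aok h0 h1, ?_⟩
  rw [show 1 - l = l' by linarith]
  exact hl'.aok h0' h1'

def Phi (γ : (ℤ → ℝ) → ℝ ≃o ℝ) (ω : ℤ → ℝ) (s : ℝ) : ℝ :=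
  (AA γ ω s + 1 - AA (rf γ) ω (1 - s)) / 2 + min s 0 + max (s - 1) 0

def NN (y : ℝ) : ℝ := (eta (min (2 * y) 1) + 1 - eta (min (2 - 2 * y) 1)) / 2

lemma Phi_meas {γ : (ℤ → ℝ) → ℝ ≃o ℝ} (hm : MeasF γ) (s : ℝ) : Measurable fun ω => Phi γ ω s := by
  unfold Phi
  have h1 := AA_meas hm s
  have h2 := AA_meas (rf_meas hm) (1 - s)
  fun_prop

lemma AOK.le1 {γ : (ℤ → ℝ) → ℝ ≃o ℝ} {ω : ℤ → ℝ} {l : ℝ} (h : AOK γ ω l) (s : ℝ) : AA γ ω s ≤ 1 := by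
  rcases le_or_gt l s with h2 | h2
  · rw [h.one s h2]
  · exact (h.lt1 s h2).le

lemma AOK.ge0 {γ : (ℤ → ℝ) → ℝ ≃o ℝ} {ω : ℤ → ℝ} {l : ℝ} (h : AOK γ ω l) (s : ℝ) : 0 ≤ AA γ ω s := by
  rcases le_or_gt s 0 with h2 | h2
  · rw [h.zero s h2]
  · rw [← h.zero 0 le_rfl]; exact h.mono h2.le

lemma Phi_strict {γ : (ℤ → ℝ) → ℝ ≃o ℝ} {ω : ℤ → ℝ} (h : GoodAA γ ω) : StrictMono (Phi γ ω) := by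
  obtain ⟨l, h1, h2⟩ := h
  intro s t hst
  unfold Phi
  have m1 := h1.mono hst.le
  have m2 := h2.mono (show 1 - t ≤ 1 - s by linarith)
  have m3 : min s 0 ≤ min t 0 := min_le_min_right _ hst.le
  have m4 : max (s - 1) 0 ≤ max (t - 1) 0 := max_le_max_right _ (by linarith)
  rcases lt_or_ge s 0 with c1 | c1
  · have : min s 0 < min t 0 := by
      rw [min_eq_left c1.le]; exact lt_min hst c1
    linarith
  rcases lt_or_ge 1 t with c2 | c2
  · have : max (s - 1) 0 < max (t - 1) 0 := by
      rw [max_eq_left (show 0 ≤ t - 1 by linarith)]; exact max_lt (by linarith) (by linarith)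
    linarith
  rcases lt_or_ge s l with c3 | c3
  · have : AA γ ω s < AA γ ω t := by
      refine lt_of_lt_of_le (h1.strict (a := s) (b := min t l) ⟨c1, c3.le⟩ ⟨le_min (by linarith) (by linarith), min_le_right _ _⟩
        (lt_min hst c3)) (h1.mono (min_le_left _ _))
    linarith
  · have : AA (rf γ) ω (1 - t) < AA (rf γ) ω (1 - s) :=
      h2.strict ⟨by linarith, by linarith⟩ ⟨by linarith, by linarith⟩ (by linarith)
    linarith

lemma Phi_cont {γ : (ℤ → ℝ) → ℝ ≃o ℝ} {ω : ℤ → ℝ} (h : GoodAA γ ω) : Continuous (Phi γ ω) := by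
  obtain ⟨l, h1, h2⟩ := h
  unfold Phi
  have := h1.cont
  have := h2.cont
  fun_prop

lemma Phi_surj {γ : (ℤ → ℝ) → ℝ ≃o ℝ} {ω : ℤ → ℝ} (h : GoodAA γ ω) : Surjective (Phi γ ω) := by
  have hc := Phi_cont h
  obtain ⟨l, h1, h2⟩ := h
  refine hc.surjective ?_ ?_
  · refine tendsto_atTop_mono' _ ?_ (tendsto_atTop_add_const_right atTop (-1) tendsto_id)
    filter_upwards [eventually_ge_atTop 1] with s hs
    unfold Phi
    have := h1.ge0 s
    have := h2.le1 (1 - s)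
    rw [min_eq_right (by linarith), max_eq_left (by linarith), id]
    linarith
  · refine tendsto_atBot_mono' _ ?_ (tendsto_atBot_add_const_right atBot 1 tendsto_id)
    filter_upwards [eventually_le_atBot 0] with s hs
    unfold Phi
    have := h1.le1 s
    have := h2.ge0 (1 - s)
    rw [min_eq_left (by linarith), max_eq_right (by linarith), id]
    linarith

lemma Phi_zero {γ : (ℤ → ℝ) → ℝ ≃o ℝ} {ω : ℤ → ℝ} (h : GoodAA γ ω) : Phi γ ω 0 = 0 := by
  obtain ⟨l, h1, h2⟩ := h
  unfold Phi
  rw [h1.zero 0 le_rfl, h2.one (1 - 0) (by linarith [h1.arc.pos])]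
  norm_num

lemma Phi_one {γ : (ℤ → ℝ) → ℝ ≃o ℝ} {ω : ℤ → ℝ} (h : GoodAA γ ω) : Phi γ ω 1 = 1 := by
  obtain ⟨l, h1, h2⟩ := h
  unfold Phi
  rw [h1.one 1 h1.arc.le1, h2.zero (1 - 1) (by norm_num)]
  norm_num

lemma Phi_mid (γ : (ℤ → ℝ) → ℝ ≃o ℝ) (ω : ℤ → ℝ) {s : ℝ} (hs : s ∈ Icc (0:ℝ) 1) :
    Phi γ ω s = (AA γ ω s + 1 - AA (rf γ) ω (1 - s)) / 2 := by
  unfold Phi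
  rw [min_eq_right hs.1, max_eq_right (by linarith [hs.2])]
  ring

lemma Phi_eqn {γ : (ℤ → ℝ) → ℝ ≃o ℝ} (h0 : ∀ ω, γ ω 0 = 0) (h1 : ∀ ω, γ ω 1 = 1) {ω : ℤ → ℝ} (h : GoodAA γ ω) {s : ℝ}
    (hs : s ∈ Icc (0:ℝ) 1) : Phi γ (shiftZ 1 ω) (γ ω s) = NN (Phi γ ω s) := by
  obtain ⟨l, a1, a2⟩ := h
  have hs' : γ ω s ∈ Icc (0:ℝ) 1 := by
    have e1 := (γ ω).monotone hs.1
    have e2 := (γ ω).monotone hs.2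
    rw [h0] at e1; rw [h1] at e2
    exact ⟨e1, e2⟩
  rw [Phi_mid _ _ hs', Phi_mid _ _ hs, a1.eqn]
  have : 1 - γ ω s = rf γ ω (1 - s) := by simp [rf, rfl1_apply]
  rw [this, a2.eqn]
  unfold NN
  have b1 := a1.le1 s
  have b2 := a2.le1 (1 - s)
  have key : AA γ ω s = 1 ∨ AA (rf γ) ω (1 - s) = 1 := by
    rcases le_or_gt l s with c | c
    · exact Or.inl (a1.one s c)
    · exact Or.inr (a2.one _ (by linarith))
  have k1 : min (2 * ((AA γ ω s + 1 - AA (rf γ) ω (1 - s)) / 2)) 1 = AA γ ω s := by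
    rcases key with k | k <;> rw [k]
    · rw [min_eq_right]; linarith
    · rw [min_eq_left] <;> linarith
  have k2 : min (2 - 2 * ((AA γ ω s + 1 - AA (rf γ) ω (1 - s)) / 2)) 1 = AA (rf γ) ω (1 - s) := by
    rcases key with k | k <;> rw [k]
    · rw [min_eq_left] <;> linarith
    · rw [min_eq_right]; linarith
  rw [k1, k2]

theorem abstract_conj {P : Measure (ℤ → ℝ)} (hP : IsProductNuZ P) {γ : (ℤ → ℝ) → ℝ ≃o ℝ} (h0 : ∀ ω, γ ω 0 = 0)
    (h1 : ∀ ω, γ ω 1 = 1) (hm : MeasF γ) (hB : HB P γ) (hB' : HB P (rf γ)) (hA : HA P γ) :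
    ∃ e : (ℤ → ℝ) → ℝ ≃o ℝ, MeasF e ∧ (∀ ω, e ω 0 = 0) ∧ (∀ ω, e ω 1 = 1) ∧
      ∀ᵐ ω ∂P, ∀ s ∈ Icc (0:ℝ) 1, e (shiftZ 1 ω) (γ ω s) = NN (e ω s) := by
  have hg := good_ae hP h0 h1 hm hB hB' hA
  obtain ⟨B, hB1, hB2, hB3⟩ := exists_measurable_superset_of_null (ae_iff.mp hg)
  have hG : ∀ ω, ω ∉ B → GoodAA γ ω := fun ω hω => by
    by_contra hc
    exact hω (hB1 hc)
  classical
  set e : (ℤ → ℝ) → ℝ ≃o ℝ := fun ω => if hω : ω ∈ B then OrderIso.refl ℝ else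
    StrictMono.orderIsoOfSurjective (Phi γ ω) (Phi_strict (hG ω hω)) (Phi_surj (hG ω hω)) with he
  have e1 : ∀ ω ∉ B, ∀ s, e ω s = Phi γ ω s := by
    intro ω hω s
    simp only [he, dif_neg hω]
    rfl
  have e2 : ∀ ω ∈ B, ∀ s, e ω s = s := by
    intro ω hω s
    simp only [he, dif_pos hω]
    rfl
  have hae : ∀ᵐ ω ∂P, ω ∉ B := by
    rw [ae_iff]; simpa using hB3
  refine ⟨e, fun s => ?_, fun ω => ?_, fun ω => ?_, ?_⟩
  · have : (fun ω => e ω s) = fun ω => if ω ∈ B then s else Phi γ ω s := by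
      ext ω
      split_ifs with h
      · exact e2 ω h s
      · exact e1 ω h s
    rw [this]
    exact Measurable.ite hB2 measurable_const (Phi_meas hm s)
  · by_cases h : ω ∈ B
    · rw [e2 ω h]
    · rw [e1 ω h, Phi_zero (hG ω h)]
  · by_cases h : ω ∈ B
    · rw [e2 ω h]
    · rw [e1 ω h, Phi_one (hG ω h)]
  · filter_upwards [hae, (P_shift hP 1).quasiMeasurePreserving.ae hae] with ω w1 w2 s hs
    rw [e1 _ w1, e1 _ w2, Phi_eqn h0 h1 (hG ω w1) hs]

lemma Fmap_coe (τ ε σ w x : ℝ) : Fmap τ ε σ w (x : AddCircle (1:ℝ)) = ((gz τ ε x + σ * w : ℝ) : AddCircle (1:ℝ)) := by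
  have : sinA (x : AddCircle (1:ℝ)) = Real.sin (2 * π * x) := rfl
  unfold Fmap
  rw [this, ← AddCircle.coe_add]
  congr 1
  unfold gz; ring

lemma Fmap_cont (τ ε σ w : ℝ) : Continuous (Fmap τ ε σ w) := by
  have hs : Continuous sinA := by
    unfold sinA
    exact continuous_coinduced_dom.mpr (by
      change Continuous fun x : ℝ => Real.sin (2 * π * x)
      fun_prop)
  unfold Fmap
  have h2 : Continuous fun x : AddCircle (1:ℝ) => ((τ + σ * w - ε * sinA x : ℝ) : AddCircle (1:ℝ)) :=
    (AddCircle.continuous_mk' 1).comp (by fun_prop)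
  exact continuous_id.add h2

lemma XS_int (τ ε σ : ℝ) (ω : ℤ → ℝ) (x r r' : ℝ) (k : ℤ) (n : ℕ) :
    (XS τ ε σ ω (x + k, r) n).1 = (XS τ ε σ ω (x, r') n).1 + k := by
  induction n with
  | zero => rfl
  | succ n ih =>
    simp only [XS]
    rw [ih, gz_add_int]; ring

lemma XS_diff (τ ε σ : ℝ) (ω : ℤ → ℝ) (x s r : ℝ) (n : ℕ) :
    (XS τ ε σ ω (x, s) n).2 = (XS τ ε σ ω (x + s, r) n).1 - (XS τ ε σ ω (x, s) n).1 := by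
  induction n with
  | zero => simp [XS]
  | succ n ih =>
    simp only [XS]
    rw [Sg_eq τ, ih]
    rw [add_sub_cancel]; ring

def am (τ ε σ : ℝ) (ω : ℤ → ℝ) (m : ℕ) : AddCircle (1:ℝ) := ((XS τ ε σ (shiftZ (-m) ω) (0, 0) m).1 : ℝ)

lemma am_meas (τ ε σ : ℝ) (m : ℕ) : Measurable fun ω => am τ ε σ ω m := by
  unfold am
  have h1 : Measurable fun ω => XS τ ε σ (shiftZ (-m) ω) (0, 0) m :=
    (XS_meas τ ε σ (f := fun _ => (0, 0)) measurable_const m).comp (shiftZ_meas (-m))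
  exact AddCircle.measurable_mk'.comp (measurable_fst.comp h1)

lemma am_past (τ ε σ : ℝ) (m : ℕ) : PastInv fun ω => am τ ε σ ω m := by
  intro ω k w hk
  simp only [am, shiftZ_upd]
  rw [XS_upd _ _ _ _ _ _ _ _ (by omega)]

lemma am_shift (τ ε σ : ℝ) (ω : ℤ → ℝ) (m : ℕ) :
    am τ ε σ (shiftZ 1 ω) (m + 1) = Fmap τ ε σ (ω 0) (am τ ε σ ω m) := by
  unfold am
  rw [Fmap_coe, shiftZ_add]
  rw [show -((m+1 : ℕ) : ℤ) + 1 = -m by push_cast; ring]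
  simp only [XS]
  have : shiftZ (-m) ω m = ω 0 := by simp [shiftZ]
  rw [this]

def st (τ ε σ : ℝ) (ω : ℤ → ℝ) : ℝ × ℝ := (0, Int.fract (gz τ ε 0 + σ * ω (-1)))

lemma am_succ (τ ε σ : ℝ) (ω : ℤ → ℝ) (m : ℕ) :
    am τ ε σ ω (m + 1) = am τ ε σ ω m + ((XS τ ε σ (shiftZ (-m) ω) (st τ ε σ (shiftZ (-m) ω)) m).2 : ℝ) := by
  unfold am
  rw [add_comm m 1, ← XS_coc τ ε σ _ _ 1 m, shiftZ_add]
  rw [show ((1:ℕ):ℤ) + -((1 + m : ℕ) : ℤ) = -m by push_cast; ring]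
  have h1 : XS τ ε σ (shiftZ (-((1 + m : ℕ) : ℤ)) ω) (0, 0) 1 = (gz τ ε 0 + σ * shiftZ (-m) ω (-1), Sg ε 0 0) := by
    simp only [XS]
    congr 3
    simp only [shiftZ]; congr 1; push_cast; ring
  rw [h1]
  set ω' := shiftZ (-m) ω
  set u := gz τ ε 0 + σ * ω' (-1) with hu
  have h2 := XS_int τ ε σ ω' (Int.fract u) (Sg ε 0 0) 0 ⌊u⌋ m
  rw [Int.fract_add_floor] at h2
  have h3 := XS_diff τ ε σ ω' 0 (Int.fract u) 0 m
  have h4 := XS_int τ ε σ ω' 0 (Int.fract u) 0 0 m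
  simp only [Int.cast_zero, add_zero] at h4
  simp only [st, ← hu]
  rw [h2, h3, h4, zero_add, ← AddCircle.coe_add, add_sub_cancel, AddCircle.coe_add]
  have : (((⌊u⌋ : ℤ) : ℝ) : AddCircle (1:ℝ)) = 0 := by
    rw [AddCircle.coe_eq_zero_iff]; exact ⟨⌊u⌋, by simp⟩
  rw [this, add_zero]

lemma Wf_ge {s t : ℝ} (h0 : 0 ≤ t) (h1 : t ≤ s) (h2 : t ≤ 1 - s) : t ≤ Wf s := by
  unfold Wf
  apply Real.le_sqrt_of_sq_le
  nlinarith

lemma Wf_le1 (s : ℝ) : Wf s ≤ 1 := by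
  unfold Wf
  rw [Real.sqrt_le_left (by norm_num)]
  nlinarith [sq_nonneg (s - 1/2)]

lemma edist_am {τ ε σ : ℝ} (hε : 0 < ε) (h : 2 * π * ε < 1) (ω : ℤ → ℝ) (m : ℕ) :
    edist (am τ ε σ ω m) (am τ ε σ ω (m + 1)) ≤
      ENNReal.ofReal (Wf (XS τ ε σ (shiftZ (-m) ω) (st τ ε σ (shiftZ (-m) ω)) m).2) := by
  rw [am_succ, edist_dist]
  refine ENNReal.ofReal_le_ofReal ?_
  rw [dist_self_add_right, UnitAddCircle.norm_eq]
  have hm := XS_mem (τ := τ) (σ := σ) hε h (shiftZ (-m) ω) (st τ ε σ (shiftZ (-m) ω))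
    ⟨Int.fract_nonneg _, (Int.fract_lt_one _).le⟩ m
  set s := (XS τ ε σ (shiftZ (-m) ω) (st τ ε σ (shiftZ (-m) ω)) m).2
  have a1 := round_le s 0
  have a2 := round_le s 1
  simp only [Int.cast_zero, sub_zero, Int.cast_one] at a1 a2
  rw [abs_of_nonneg hm.1] at a1
  rw [abs_sub_comm s 1, abs_of_nonneg (show 0 ≤ 1 - s by linarith [hm.2])] at a2
  exact Wf_ge (abs_nonneg _) a1 a2

lemma st_meas (τ ε σ : ℝ) : Measurable (st τ ε σ) := by
  unfold st
  exact measurable_const.prodMk (measurable_fract.comp (by fun_prop))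

lemma st_past (τ ε σ : ℝ) : PastInv (st τ ε σ) := by
  intro ω k w hk
  simp only [st]
  rw [update_of_ne (by omega)]

def att (τ ε σ : ℝ) (ω : ℤ → ℝ) : AddCircle (1:ℝ) := limUnder atTop (am τ ε σ ω)

lemma att_meas (τ ε σ : ℝ) : Measurable (att τ ε σ) := by
  unfold att
  exact (StronglyMeasurable.limUnder (f := fun m ω => am τ ε σ ω m) fun m => (am_meas τ ε σ m).stronglyMeasurable).measurable

lemma att_past (τ ε σ : ℝ) : PastInv (att τ ε σ) := by
  intro ω k w hk
  unfold att
  congr 1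
  ext m
  exact am_past τ ε σ m ω k w hk

lemma att_lim {τ ε σ : ℝ} (hε : 0 < ε) (h : 2 * π * ε < 1) (hσ : 0 < σ) (hmin : Mini τ ε σ)
    {P : Measure (ℤ → ℝ)} (hP : IsProductNuZ P) :
    ∀ᵐ ω ∂P, Tendsto (am τ ε σ ω) atTop (nhds (att τ ε σ ω)) := by
  have := hP.1
  obtain ⟨C, hC, H⟩ := sumW hε h hσ hmin hP
  have H1 := H (st τ ε σ) (st_meas τ ε σ) (st_past τ ε σ) (fun ω => ⟨Int.fract_nonneg _, (Int.fract_lt_one _).le⟩)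
  have hWm : ∀ n, Measurable fun ω => ENNReal.ofReal (Wf (XS τ ε σ ω (st τ ε σ ω) n).2) := fun n =>
    ENNReal.measurable_ofReal.comp (Wf_cont.measurable.comp (measurable_snd.comp (XS_meas τ ε σ (st_meas τ ε σ) n)))
  have hfin : C * ∫⁻ ω, ENNReal.ofReal (Wf (st τ ε σ ω).2) ∂P ≠ ⊤ := by
    refine ENNReal.mul_ne_top hC (ne_top_of_le_ne_top ENNReal.one_ne_top ?_)
    calc _ ≤ ∫⁻ ω, 1 ∂P := lintegral_mono fun ω => by
          rw [← ENNReal.ofReal_one]; exact ENNReal.ofReal_le_ofReal (Wf_le1 _)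
      _ = 1 := by simp
  have e1 : ∫⁻ ω, ∑' m : ℕ, ENNReal.ofReal (Wf (XS τ ε σ (shiftZ (-m) ω) (st τ ε σ (shiftZ (-m) ω)) m).2) ∂P ≠ ⊤ := by
    have hWs : ∀ m : ℕ, Measurable fun ω => ENNReal.ofReal (Wf (XS τ ε σ (shiftZ (-m) ω) (st τ ε σ (shiftZ (-m) ω)) m).2) :=
      fun m => (hWm m).comp (shiftZ_meas (-m))
    rw [lintegral_tsum fun m => (hWs m).aemeasurable]
    rw [lintegral_tsum fun m => (hWm m).aemeasurable] at H1
    refine ne_top_of_le_ne_top hfin (le_trans (le_of_eq ?_) H1)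
    congr 1; ext m
    exact (P_shift hP (-m)).lintegral_comp (hWm m)
  have e2 := ae_lt_top (Measurable.tsum fun m => (hWm m).comp (shiftZ_meas (-m))) e1
  filter_upwards [e2] with ω hω
  have hc : CauchySeq (am τ ε σ ω) := cauchySeq_of_edist_le_of_tsum_ne_top _ (edist_am hε h ω) hω.ne
  exact hc.tendsto_limUnder

lemma att_shift {τ ε σ : ℝ} (hε : 0 < ε) (h : 2 * π * ε < 1) (hσ : 0 < σ) (hmin : Mini τ ε σ)
    {P : Measure (ℤ → ℝ)} (hP : IsProductNuZ P) :
    ∀ᵐ ω ∂P, att τ ε σ (shiftZ 1 ω) = Fmap τ ε σ (ω 0) (att τ ε σ ω) := by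
  have h1 := att_lim hε h hσ hmin hP
  filter_upwards [h1, (P_shift hP 1).quasiMeasurePreserving.ae h1] with ω w1 w2
  have h3 := ((Fmap_cont τ ε σ (ω 0)).tendsto _).comp w1
  have h4 := w2.comp (tendsto_add_atTop_nat 1)
  refine tendsto_nhds_unique h4 (h3.congr fun m => ?_)
  exact (am_shift τ ε σ ω m).symm

lemma ae_shifts {P : Measure (ℤ → ℝ)} (hP : IsProductNuZ P) {p : (ℤ → ℝ) → Prop} (h : ∀ᵐ ω ∂P, p ω) :
    ∀ᵐ ω ∂P, ∀ n : ℤ, p (shiftZ n ω) := by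
  rw [ae_all_iff]
  exact fun n => (P_shift hP n).quasiMeasurePreserving.ae h

def rep (x : AddCircle (1:ℝ)) : ℝ := (AddCircle.measurableEquivIco 1 0 x : ℝ)

lemma rep_meas : Measurable rep :=
  measurable_subtype_coe.comp (AddCircle.measurableEquivIco 1 0).measurable

lemma rep_mem (x : AddCircle (1:ℝ)) : rep x ∈ Ico (0:ℝ) 1 := by
  obtain ⟨a, b⟩ := (AddCircle.measurableEquivIco 1 0 x).2
  exact ⟨a, b.trans_eq (zero_add 1)⟩

lemma rep_coe (x : AddCircle (1:ℝ)) : (rep x : AddCircle (1:ℝ)) = x := AddCircle.coe_equivIco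

lemma rep_of_mem {s : ℝ} (hs : s ∈ Ico (0:ℝ) 1) : rep (s : AddCircle (1:ℝ)) = s :=
  AddCircle.equivIco_coe_of_mem (by rwa [zero_add])

lemma Sg_int (ε x s : ℝ) (k : ℤ) : Sg ε (x + k) s = Sg ε x s := by
  rw [Sg_eq 0, Sg_eq 0, gz_add_int, show x + k + s = x + s + k by ring, gz_add_int]; ring

lemma Sg_coe (ε : ℝ) {x y : ℝ} (s : ℝ) (h : (x : AddCircle (1:ℝ)) = y) : Sg ε x s = Sg ε y s := by
  have h2 : ((x - y : ℝ) : AddCircle (1:ℝ)) = 0 := by rw [AddCircle.coe_sub, h, sub_self]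
  obtain ⟨k, hk⟩ := (AddCircle.coe_eq_zero_iff 1).mp h2
  have : x = y + k := by
    simp only [zsmul_eq_mul, mul_one] at hk; linarith
  rw [this, Sg_int]

lemma gz_strict {τ ε : ℝ} (hε : 0 < ε) (h : 2 * π * ε < 1) : StrictMono (gz τ ε) :=
  strictMono_of_deriv_pos fun x => by rw [(gz_hasDeriv τ ε x).deriv]; exact gd_pos hε h x

def gamO {ε : ℝ} (hε : 0 < ε) (h : 2 * π * ε < 1) (x : ℝ) : ℝ ≃o ℝ :=
  StrictMono.orderIsoOfSurjective (Sg ε x)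
    (fun s t hst => by
      rw [Sg_eq 0, Sg_eq 0]
      exact sub_lt_sub_right (gz_strict hε h (by linarith)) _)
    (fun y => by
      obtain ⟨z, hz⟩ := gz_surj 0 ε (y + gz 0 ε x)
      exact ⟨z - x, by rw [Sg_eq 0, add_sub_cancel, hz]; ring⟩)

lemma gamO_apply {ε : ℝ} (hε : 0 < ε) (h : 2 * π * ε < 1) (x s : ℝ) : gamO hε h x s = Sg ε x s := rfl

def gam (τ σ : ℝ) {ε : ℝ} (hε : 0 < ε) (h : 2 * π * ε < 1) (ω : ℤ → ℝ) : ℝ ≃o ℝ := gamO hε h (rep (att τ ε σ ω))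

lemma gam_apply (τ σ : ℝ) {ε : ℝ} (hε : 0 < ε) (h : 2 * π * ε < 1) (ω : ℤ → ℝ) (s : ℝ) :
    gam τ σ hε h ω s = Sg ε (rep (att τ ε σ ω)) s := rfl

lemma gam_meas (τ σ : ℝ) {ε : ℝ} (hε : 0 < ε) (h : 2 * π * ε < 1) : MeasF (gam τ σ hε h) := by
  intro s
  simp only [gam_apply]
  have h1 : Measurable fun ω => (rep (att τ ε σ ω), s) := (rep_meas.comp (att_meas τ ε σ)).prodMk measurable_const
  exact (Sg_cont ε).measurable.comp h1

lemma gam_zero (τ σ : ℝ) {ε : ℝ} (hε : 0 < ε) (h : 2 * π * ε < 1) (ω : ℤ → ℝ) : gam τ σ hε h ω 0 = 0 := by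
  rw [gam_apply, Sg_zero]
lemma gam_one (τ σ : ℝ) {ε : ℝ} (hε : 0 < ε) (h : 2 * π * ε < 1) (ω : ℤ → ℝ) : gam τ σ hε h ω 1 = 1 := by
  rw [gam_apply, Sg_one]

def AG (τ ε σ : ℝ) (ω : ℤ → ℝ) : Prop :=
  ∀ n : ℤ, att τ ε σ (shiftZ (n + 1) ω) = Fmap τ ε σ (ω n) (att τ ε σ (shiftZ n ω))

lemma AG_ae {τ ε σ : ℝ} (hε : 0 < ε) (h : 2 * π * ε < 1) (hσ : 0 < σ) (hmin : Mini τ ε σ)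
    {P : Measure (ℤ → ℝ)} (hP : IsProductNuZ P) : ∀ᵐ ω ∂P, AG τ ε σ ω := by
  filter_upwards [ae_shifts hP (att_shift hε h hσ hmin hP)] with ω hω n
  have := hω n
  rw [shiftZ_add, add_comm] at this
  rw [this]
  congr 1
  simp [shiftZ]

lemma XS_gam {τ ε σ : ℝ} (hε : 0 < ε) (h : 2 * π * ε < 1) {ω : ℤ → ℝ} (hω : AG τ ε σ ω) (s : ℝ) (n : ℕ) :
    ((XS τ ε σ ω (rep (att τ ε σ ω), s) n).1 : AddCircle (1:ℝ)) = att τ ε σ (shiftZ n ω) ∧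
    (XS τ ε σ ω (rep (att τ ε σ ω), s) n).2 = gZ (gam τ σ hε h) ω n s := by
  induction n with
  | zero =>
    refine ⟨?_, rfl⟩
    simp only [XS, rep_coe, Nat.cast_zero, shiftZ_zero]
  | succ n ih =>
    simp only [XS]
    refine ⟨?_, ?_⟩
    · rw [← Fmap_coe, ih.1, Nat.cast_succ, hω]
    · rw [Nat.cast_succ, gZ_orb, gam_apply, ih.2]
      apply Sg_coe
      rw [ih.1, rep_coe]

lemma Wf_small {s : ℝ} (hs : s ∈ Icc (0:ℝ) 1) (h : Wf s < 1/4) : s < 1/8 ∨ 1 - 1/8 < s := by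
  unfold Wf at h
  rw [Real.sqrt_lt' (by norm_num)] at h
  by_contra hc
  push Not at hc
  nlinarith [hc.1, hc.2]

lemma Wf_refl (s : ℝ) : Wf (1 - s) = Wf s := by unfold Wf; congr 1; ring

lemma seq_small (v : ℕ → ℝ) (hm : ∀ n, v n ∈ Icc (0:ℝ) 1) (h2 : ∀ n, v (n+1) ≤ 2 * v n)
    (hW : ∀ n, Wf (v n) < 1/4) (h0 : v 0 ≤ 1/2) (n : ℕ) : v n ≤ Wf (v n) := by
  have key : ∀ n, v n < 1/8 := by
    intro n
    induction n with
    | zero => rcases Wf_small (hm 0) (hW 0) with h | h <;> linarith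
    | succ n ih =>
      have := h2 n
      rcases Wf_small (hm (n+1)) (hW (n+1)) with h | h <;> linarith
  have := key n
  exact Wf_ge (hm n).1 le_rfl (by linarith)

lemma gZ_mem {γ : (ℤ → ℝ) → ℝ ≃o ℝ} (h0 : ∀ ω, γ ω 0 = 0) (h1 : ∀ ω, γ ω 1 = 1) (ω : ℤ → ℝ) (k : ℤ) {s : ℝ}
    (hs : s ∈ Icc (0:ℝ) 1) : gZ γ ω k s ∈ Icc (0:ℝ) 1 := by
  have a := (gZ γ ω k).monotone hs.1
  have b := (gZ γ ω k).monotone hs.2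
  rw [gZ_fix γ 0 h0] at a
  rw [gZ_fix γ 1 h1] at b
  exact ⟨a, b⟩

lemma gam_two (τ σ : ℝ) {ε : ℝ} (hε : 0 < ε) (h : 2 * π * ε < 1) (ω : ℤ → ℝ) {s : ℝ} (hs : s ∈ Icc (0:ℝ) 1) :
    gam τ σ hε h ω s ≤ 2 * s ∧ 1 - gam τ σ hε h ω s ≤ 2 * (1 - s) := by
  rw [gam_apply]
  constructor
  · rw [← av_gd 0]
    nlinarith [av_gd_le hε h (rep (att τ ε σ ω)) s, hs.1]
  · rw [Sg_compl]
    nlinarith [av_gd_le hε h (rep (att τ ε σ ω) + s) (1 - s), hs.2]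

/-- the potential sum -/
def FW (τ σ : ℝ) {ε : ℝ} (hε : 0 < ε) (h : 2 * π * ε < 1) (ω : ℤ → ℝ) (s : ℝ) : ENNReal :=
  ∑' n : ℕ, ENNReal.ofReal (Wf (gZ (gam τ σ hε h) ω n s))

lemma FW_meas (τ σ : ℝ) {ε : ℝ} (hε : 0 < ε) (h : 2 * π * ε < 1) (s : ℝ) : Measurable fun ω => FW τ σ hε h ω s :=
  Measurable.tsum fun n => ENNReal.measurable_ofReal.comp (Wf_cont.measurable.comp (gZ_meas (gam_meas τ σ hε h) n s))

lemma FW_int {τ ε σ : ℝ} (hε : 0 < ε) (h : 2 * π * ε < 1) (hσ : 0 < σ) (hmin : Mini τ ε σ)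
    {P : Measure (ℤ → ℝ)} (hP : IsProductNuZ P) : ∃ C : ENNReal, C ≠ ⊤ ∧ ∀ s ∈ Icc (0:ℝ) 1,
      ∫⁻ ω, FW τ σ hε h ω s ∂P ≤ C * ENNReal.ofReal (Wf s) := by
  have := hP.1
  obtain ⟨C, hC, H⟩ := sumW hε h hσ hmin hP
  refine ⟨C, hC, fun s hs => ?_⟩
  have H1 := H (fun ω => (rep (att τ ε σ ω), s)) ((rep_meas.comp (att_meas τ ε σ)).prodMk measurable_const)
    (fun ω k w hk => by simp only [att_past τ ε σ ω k w hk]) (fun ω => hs)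
  simp only [lintegral_const, measure_univ, mul_one] at H1
  refine le_trans (le_of_eq (lintegral_congr_ae ?_)) H1
  filter_upwards [AG_ae hε h hσ hmin hP] with ω hω
  unfold FW
  congr 1; ext n
  rw [(XS_gam hε h hω s n).2]

lemma FW_small {τ σ ε : ℝ} (hε : 0 < ε) (h : 2 * π * ε < 1) {ω : ℤ → ℝ} {s : ℝ} (hs : s ∈ Icc (0:ℝ) 1)
    (hF : FW τ σ hε h ω s < ENNReal.ofReal (1/4)) :
    (s ≤ 1/2 → uu (gam τ σ hε h) ω s 0 ≤ FW τ σ hε h ω s) ∧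
    (1/2 ≤ s → uu (rf (gam τ σ hε h)) ω (1 - s) 0 ≤ FW τ σ hε h ω s) := by
  have hW : ∀ n : ℕ, Wf (gZ (gam τ σ hε h) ω n s) < 1/4 := fun n =>
    (ENNReal.ofReal_lt_ofReal_iff (by norm_num)).mp (lt_of_le_of_lt (ENNReal.le_tsum n) hF)
  have hm : ∀ n : ℕ, gZ (gam τ σ hε h) ω n s ∈ Icc (0:ℝ) 1 := fun n =>
    gZ_mem (gam_zero τ σ hε h) (gam_one τ σ hε h) ω n hs
  have h2 : ∀ n : ℕ, _ := fun n => gam_two τ σ hε h (shiftZ n ω) (hm n)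
  constructor
  · intro h0
    unfold uu FW
    refine ENNReal.tsum_le_tsum fun n => ENNReal.ofReal_le_ofReal ?_
    rw [zero_add]
    refine seq_small (fun n : ℕ => gZ (gam τ σ hε h) ω n s) hm (fun n => ?_) hW h0 n
    rw [Nat.cast_succ, gZ_orb]; exact (h2 n).1
  · intro h0
    unfold uu FW
    refine ENNReal.tsum_le_tsum fun n => ENNReal.ofReal_le_ofReal ?_
    rw [zero_add, gZ_rf, sub_sub_cancel, ← Wf_refl]
    refine seq_small (fun n : ℕ => 1 - gZ (gam τ σ hε h) ω n s) (fun n => ⟨by linarith [(hm n).2], by linarith [(hm n).1]⟩)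
      (fun n => ?_) (fun n => by rw [Wf_refl]; exact hW n) ?_ n
    · rw [Nat.cast_succ, gZ_orb]; exact (h2 n).2
    · simp only [Nat.cast_zero, gZ_zero]; linarith

lemma FW_shift {τ σ ε : ℝ} (hε : 0 < ε) (h : 2 * π * ε < 1) (ω : ℤ → ℝ) (s : ℝ) (N : ℕ) :
    FW τ σ hε h (shiftZ N ω) (gZ (gam τ σ hε h) ω N s) =
      ∑' n : ℕ, ENNReal.ofReal (Wf (gZ (gam τ σ hε h) ω ((n + N : ℕ) : ℤ) s)) := by
  unfold FW
  congr 1; ext n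
  rw [gZ_shift]; push_cast; rfl

lemma gam_HA {τ ε σ : ℝ} (hε : 0 < ε) (h : 2 * π * ε < 1) (hσ : 0 < σ) (hmin : Mini τ ε σ)
    {P : Measure (ℤ → ℝ)} (hP : IsProductNuZ P) : HA P (gam τ σ hε h) := by
  obtain ⟨C, hC, H⟩ := FW_int hε h hσ hmin hP
  unfold HA
  rw [ae_all_iff]
  intro q
  by_cases hq : (q:ℝ) ∈ Icc (0:ℝ) 1
  · have hlt := ae_lt_top (FW_meas τ σ hε h q)
      (ne_top_of_le_ne_top (ENNReal.mul_ne_top hC ENNReal.ofReal_ne_top) (H q hq))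
    filter_upwards [hlt] with ω hω _
    have ht := ENNReal.tendsto_sum_nat_add (fun n : ℕ => ENNReal.ofReal (Wf (gZ (gam τ σ hε h) ω n q))) hω.ne
    obtain ⟨N, hN⟩ := (ht.eventually_lt_const (show (0:ENNReal) < ENNReal.ofReal (1/4) by simp)).exists
    rw [← FW_shift] at hN
    have hm := gZ_mem (gam_zero τ σ hε h) (gam_one τ σ hε h) ω N hq
    obtain ⟨k1, k2⟩ := FW_small hε h hm hN
    rcases le_total (gZ (gam τ σ hε h) ω N q) (1/2) with c | c
    · left
      have := (k1 c).trans_lt (hN.trans ENNReal.ofReal_lt_top)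
      rw [uu_shift, lt_top_iff_ne_top, Ne, uu_top] at this
      exact lt_top_iff_ne_top.mpr this
    · right
      have := (k2 c).trans_lt (hN.trans ENNReal.ofReal_lt_top)
      have e : 1 - gZ (gam τ σ hε h) ω N q = gZ (rf (gam τ σ hε h)) ω N (1 - q) := by
        rw [gZ_rf, sub_sub_cancel]
      rw [e, uu_shift, lt_top_iff_ne_top, Ne, uu_top] at this
      exact lt_top_iff_ne_top.mpr this
  · exact Eventually.of_forall fun ω hh => absurd hh hq

lemma inf_FW {τ ε σ : ℝ} (hε : 0 < ε) (h : 2 * π * ε < 1) (hσ : 0 < σ) (hmin : Mini τ ε σ)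
    {P : Measure (ℤ → ℝ)} (hP : IsProductNuZ P) (s : ℕ → ℝ) (hs : ∀ j, s j ∈ Icc (0:ℝ) 1)
    (hl : Tendsto (fun j => Wf (s j)) atTop (nhds 0)) :
    ∀ᵐ ω ∂P, ∀ c : ENNReal, 0 < c → ∃ j, FW τ σ hε h ω (s j) < c := by
  obtain ⟨C, hC, H⟩ := FW_int hε h hσ hmin hP
  have hmeas : Measurable fun ω => ⨅ j, FW τ σ hε h ω (s j) := Measurable.iInf fun j => FW_meas τ σ hε h (s j)
  have hz : ∫⁻ ω, ⨅ j, FW τ σ hε h ω (s j) ∂P = 0 := by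
    have hl2 : Tendsto (fun j => C * ENNReal.ofReal (Wf (s j))) atTop (nhds 0) := by
      have := ENNReal.Tendsto.const_mul (ENNReal.tendsto_ofReal hl) (Or.inr hC)
      simpa using this
    refine le_antisymm (ge_of_tendsto' hl2 fun j => ?_) zero_le
    exact (lintegral_mono fun ω => iInf_le _ j).trans (H _ (hs j))
  rw [lintegral_eq_zero_iff hmeas] at hz
  filter_upwards [hz] with ω hω c hc
  simp only [Pi.zero_apply] at hω
  rw [← hω] at hc
  exact iInf_lt_iff.mp hc

lemma seq_lim : Tendsto (fun j : ℕ => 1 / ((j:ℝ) + 2)) atTop (nhds 0) := by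
  have := tendsto_one_div_add_atTop_nhds_zero_nat (𝕜 := ℝ)
  refine (this.comp (tendsto_add_atTop_nat 1)).congr fun j => ?_
  simp only [comp]; push_cast; congr 1; ring

lemma seq_le (j : ℕ) : 1 / ((j:ℝ) + 2) ≤ 1/2 := by
  apply one_div_le_one_div_of_le <;> [norm_num; linarith [show (0:ℝ) ≤ j by positivity]]

lemma gam_HB {τ ε σ : ℝ} (hε : 0 < ε) (h : 2 * π * ε < 1) (hσ : 0 < σ) (hmin : Mini τ ε σ)
    {P : Measure (ℤ → ℝ)} (hP : IsProductNuZ P) : HB P (gam τ σ hε h) := by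
  have hs : ∀ j : ℕ, 1 / ((j:ℝ) + 2) ∈ Icc (0:ℝ) 1 := fun j => ⟨by positivity, by linarith [seq_le j]⟩
  have hl : Tendsto (fun j : ℕ => Wf (1 / ((j:ℝ) + 2))) atTop (nhds 0) := by
    have := (Wf_cont.tendsto 0).comp seq_lim
    rw [show Wf 0 = 0 by simp [Wf]] at this; exact this
  filter_upwards [inf_FW hε h hσ hmin hP _ hs hl] with ω hω c hc
  obtain ⟨j, hj⟩ := hω (min c (ENNReal.ofReal (1/4))) (lt_min hc (by simp))
  exact ⟨j, ((FW_small hε h (hs j) (hj.trans_le (min_le_right _ _))).1 (seq_le j)).trans_lt (hj.trans_le (min_le_left _ _))⟩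

lemma gam_HB' {τ ε σ : ℝ} (hε : 0 < ε) (h : 2 * π * ε < 1) (hσ : 0 < σ) (hmin : Mini τ ε σ)
    {P : Measure (ℤ → ℝ)} (hP : IsProductNuZ P) : HB P (rf (gam τ σ hε h)) := by
  have hs : ∀ j : ℕ, 1 - 1 / ((j:ℝ) + 2) ∈ Icc (0:ℝ) 1 := fun j =>
    ⟨by linarith [seq_le j], by linarith [show 0 ≤ 1 / ((j:ℝ) + 2) by positivity]⟩
  have hl : Tendsto (fun j : ℕ => Wf (1 - 1 / ((j:ℝ) + 2))) atTop (nhds 0) := by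
    simp only [Wf_refl]
    have := (Wf_cont.tendsto 0).comp seq_lim
    rw [show Wf 0 = 0 by simp [Wf]] at this; exact this
  filter_upwards [inf_FW hε h hσ hmin hP _ hs hl] with ω hω c hc
  obtain ⟨j, hj⟩ := hω (min c (ENNReal.ofReal (1/4))) (lt_min hc (by simp))
  have := (FW_small hε h (hs j) (hj.trans_le (min_le_right _ _))).2 (by linarith [seq_le j])
  rw [sub_sub_cancel] at this
  exact ⟨j, this.trans_lt (hj.trans_le (min_le_left _ _))⟩

lemma ico_map {e : ℝ ≃o ℝ} (h0 : e 0 = 0) (h1 : e 1 = 1) {s : ℝ} (hs : s ∈ Ico (0:ℝ) 1) : e s ∈ Ico (0:ℝ) 1 := by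
  have a := e.monotone hs.1
  have b := e.strictMono hs.2
  rw [h0] at a; rw [h1] at b
  exact ⟨a, b⟩

lemma symm_fix {e : ℝ ≃o ℝ} {a : ℝ} (h : e a = a) : e.symm a = a := by
  rw [OrderIso.symm_apply_eq, h]

lemma circ_cont (e : ℝ ≃o ℝ) (h0 : e 0 = 0) (h1 : e 1 = 1) :
    Continuous fun x : AddCircle (1:ℝ) => ((e (rep x) : ℝ) : AddCircle (1:ℝ)) := by
  have hc : Continuous (AddCircle.liftIco (1:ℝ) 0 (fun s => ((e s : ℝ) : AddCircle (1:ℝ)))) := by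
    refine AddCircle.liftIco_zero_continuous ?_ ?_
    · rw [h0, h1, AddCircle.coe_period, AddCircle.coe_zero]
    · exact ((AddCircle.continuous_mk' 1).comp e.continuous).continuousOn
  exact hc

def circE (e : ℝ ≃o ℝ) (h0 : e 0 = 0) (h1 : e 1 = 1) : AddCircle (1:ℝ) ≃ₜ AddCircle (1:ℝ) where
  toFun x := ((e (rep x) : ℝ) : AddCircle (1:ℝ))
  invFun x := ((e.symm (rep x) : ℝ) : AddCircle (1:ℝ))
  left_inv x := by
    simp only [rep_of_mem (ico_map h0 h1 (rep_mem x)), OrderIso.symm_apply_apply, rep_coe]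
  right_inv x := by
    simp only [rep_of_mem (ico_map (symm_fix h0) (symm_fix h1) (rep_mem x)), OrderIso.apply_symm_apply, rep_coe]
  continuous_toFun := circ_cont e h0 h1
  continuous_invFun := circ_cont e.symm (symm_fix h0) (symm_fix h1)

lemma Fmap_add (τ ε σ w : ℝ) (a : AddCircle (1:ℝ)) (s : ℝ) :
    Fmap τ ε σ w (a + (s : AddCircle (1:ℝ))) = Fmap τ ε σ w a + ((Sg ε (rep a) s : ℝ) : AddCircle (1:ℝ)) := by
  conv_lhs => rw [← rep_coe a]
  conv_rhs => rw [← rep_coe a]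
  rw [← AddCircle.coe_add, Fmap_coe, Fmap_coe, ← AddCircle.coe_add, rep_coe]
  congr 1
  rw [Sg_eq τ]; ring

def hhom (a b : AddCircle (1:ℝ)) (e : ℝ ≃o ℝ) (h0 : e 0 = 0) (h1 : e 1 = 1) :
    AddCircle (1:ℝ) ≃ₜ AddCircle (1:ℝ) :=
  ((Homeomorph.subRight a).trans (circE e h0 h1)).trans (Homeomorph.addLeft b)

lemma hhom_apply (a b : AddCircle (1:ℝ)) (e : ℝ ≃o ℝ) (h0 : e 0 = 0) (h1 : e 1 = 1) (x) :
    hhom a b e h0 h1 x = b + ((e (rep (x - a)) : ℝ) : AddCircle (1:ℝ)) := rfl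

lemma phi_rel (Fe₁ Fe₂ : ℝ → (AddCircle (1:ℝ) ≃ AddCircle (1:ℝ)))
    (h : (ℤ → ℝ) → Homeomorph (AddCircle (1:ℝ)) (AddCircle (1:ℝ))) (ω : ℤ → ℝ)
    (hr : ∀ n : ℕ, ∀ x, h (shiftZ 1 (shiftZ n ω)) (Fe₁ (shiftZ n ω 0) x) = Fe₂ (shiftZ n ω 0) (h (shiftZ n ω) x))
    (n : ℕ) (x) : h (shiftZ n ω) (phiNE Fe₁ ω n x) = phiNE Fe₂ ω n (h ω x) := by
  induction n with
  | zero => simp [phiNE, shiftZ_zero]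
  | succ n ih =>
    have := hr n (phiNE Fe₁ ω n x)
    rw [ih, shiftZ_add] at this
    have e : shiftZ n ω 0 = ω n := by simp [shiftZ]
    rw [e] at this
    simp only [phiNE, Equiv.trans_apply]
    rw [← this]
    congr 2
    push_cast; rw [add_comm]

lemma phiZ_rel (Fe₁ Fe₂ : ℝ → (AddCircle (1:ℝ) ≃ AddCircle (1:ℝ)))
    (h : (ℤ → ℝ) → Homeomorph (AddCircle (1:ℝ)) (AddCircle (1:ℝ))) (ω : ℤ → ℝ)
    (hr : ∀ n : ℤ, ∀ x, h (shiftZ 1 (shiftZ n ω)) (Fe₁ (shiftZ n ω 0) x) = Fe₂ (shiftZ n ω 0) (h (shiftZ n ω) x))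
    (n : ℤ) (x) : phiZ Fe₂ n ω x = h (shiftZ n ω) (phiZ Fe₁ n ω ((h ω).symm x)) := by
  unfold phiZ
  split_ifs with hn
  · have := phi_rel Fe₁ Fe₂ h ω (fun n => hr n) n.toNat ((h ω).symm x)
    rw [Int.toNat_of_nonneg hn, Homeomorph.apply_symm_apply] at this
    exact this.symm
  · have := phi_rel Fe₁ Fe₂ h (shiftZ n ω) (fun m x => by
      rw [shiftZ_add m n]; exact hr _ x) (-n).toNat ((phiNE Fe₁ (shiftZ n ω) (-n).toNat).symm ((h ω).symm x))
    rw [Int.toNat_of_nonneg (by omega), shiftZ_add, neg_add_cancel, shiftZ_zero, Equiv.apply_symm_apply,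
      Homeomorph.apply_symm_apply] at this
    rw [Equiv.symm_apply_eq, ← this]

lemma get_mini {τ ε σ ρ : ℝ} (hσ : 0 < σ) {P : Measure (ℤ → ℝ)} (hP : IsProductNuZ P)
    (hρ : ∀ᵐ ω ∂P, ∀ x : ℝ, Tendsto (fun n : ℕ => (Gn τ ε σ ω n x - x) / n) atTop (nhds ρ))
    (hirr : Irrational ρ) : Mini τ ε σ := by
  have := hP.1
  obtain ⟨ω, h1, h2⟩ := (hρ.and (P_mem hP)).exists
  exact minimality τ ε σ ρ hσ hirr ω h2 h1

/-- **Stochastic conjugacy of noisy circle maps with irrational rotation numbers:**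
if the random rotation numbers `ρ_{τ₁,ε}` and `ρ_{τ₂,ε}` are both irrational, the
corresponding random cocycles are stochastically conjugate via a measurable random
homeomorphism `h(ω)` of the circle: `φ_{τ₂}(n,ω) = h(θ^n ω) ∘ φ_{τ₁}(n,ω) ∘ h(ω)⁻¹`. -/
theorem noisy_circle_maps_stochastically_conjugate (ε σ : ℝ)
    (hε : 0 < ε) (hεπ : 2 * π * ε < 1) (hσ : 0 < σ)
    (P : Measure (ℤ → ℝ)) (hP : IsProductNuZ P)
    (τ₁ τ₂ : ℝ)
    (Fe₁ Fe₂ : ℝ → (AddCircle (1:ℝ) ≃ AddCircle (1:ℝ)))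
    (hFe₁ : ∀ w x, Fe₁ w x = Fmap τ₁ ε σ w x)
    (hFe₂ : ∀ w x, Fe₂ w x = Fmap τ₂ ε σ w x)
    (ρ₁ ρ₂ : ℝ)
    (hρ₁ : ∀ᵐ ω ∂P, ∀ x : ℝ,
      Tendsto (fun n : ℕ => (Gn τ₁ ε σ ω n x - x) / n) atTop (nhds ρ₁))
    (hρ₂ : ∀ᵐ ω ∂P, ∀ x : ℝ,
      Tendsto (fun n : ℕ => (Gn τ₂ ε σ ω n x - x) / n) atTop (nhds ρ₂))
    (hirr₁ : Irrational ρ₁) (hirr₂ : Irrational ρ₂) :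
    ∃ h : (ℤ → ℝ) → Homeomorph (AddCircle (1:ℝ)) (AddCircle (1:ℝ)),
      Measurable (fun p : (ℤ → ℝ) × AddCircle (1:ℝ) => h p.1 p.2) ∧
      ∀ n : ℤ, ∀ᵐ ω ∂P, ∀ x : AddCircle (1:ℝ),
        phiZ Fe₂ n ω x = h (shiftZ n ω) (phiZ Fe₁ n ω ((h ω).symm x)) := by
  have m1 := get_mini hσ hP hρ₁ hirr₁
  have m2 := get_mini hσ hP hρ₂ hirr₂
  obtain ⟨e1, me1, e10, e11, r1⟩ := abstract_conj hP (gam_zero τ₁ σ hε hεπ) (gam_one τ₁ σ hε hεπ)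
    (gam_meas τ₁ σ hε hεπ) (gam_HB hε hεπ hσ m1 hP) (gam_HB' hε hεπ hσ m1 hP) (gam_HA hε hεπ hσ m1 hP)
  obtain ⟨e2, me2, e20, e21, r2⟩ := abstract_conj hP (gam_zero τ₂ σ hε hεπ) (gam_one τ₂ σ hε hεπ)
    (gam_meas τ₂ σ hε hεπ) (gam_HB hε hεπ hσ m2 hP) (gam_HB' hε hεπ hσ m2 hP) (gam_HA hε hεπ hσ m2 hP)
  have E0 : ∀ ω, ((e1 ω).trans (e2 ω).symm) 0 = 0 := fun ω => by
    rw [OrderIso.trans_apply, e10, symm_fix (e20 ω)]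
  have E1 : ∀ ω, ((e1 ω).trans (e2 ω).symm) 1 = 1 := fun ω => by
    rw [OrderIso.trans_apply, e11, symm_fix (e21 ω)]
  refine ⟨fun ω => hhom (att τ₁ ε σ ω) (att τ₂ ε σ ω) ((e1 ω).trans (e2 ω).symm) (E0 ω) (E1 ω), ?_, ?_⟩
  · simp only [hhom_apply, OrderIso.trans_apply]
    have hr : Measurable fun p : (ℤ → ℝ) × AddCircle (1:ℝ) => rep (p.2 - att τ₁ ε σ p.1) :=
      rep_meas.comp (measurable_snd.sub ((att_meas τ₁ ε σ).comp measurable_fst))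
    have hr1 : Measurable fun p : (ℤ → ℝ) × AddCircle (1:ℝ) => e1 p.1 (rep (p.2 - att τ₁ ε σ p.1)) :=
      (meas_joint me1).comp (measurable_fst.prodMk hr)
    have hr2 : Measurable fun p : (ℤ → ℝ) × AddCircle (1:ℝ) =>
        (e2 p.1).symm (e1 p.1 (rep (p.2 - att τ₁ ε σ p.1))) :=
      (meas_joint (meas_symm me2)).comp (measurable_fst.prodMk hr1)
    exact ((att_meas τ₂ ε σ).comp measurable_fst).add
      ((AddCircle.continuous_mk' 1).measurable.comp hr2)
  · have key : ∀ᵐ ω ∂P, ∀ x,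
        hhom (att τ₁ ε σ (shiftZ 1 ω)) (att τ₂ ε σ (shiftZ 1 ω)) ((e1 (shiftZ 1 ω)).trans (e2 (shiftZ 1 ω)).symm)
          (E0 (shiftZ 1 ω)) (E1 (shiftZ 1 ω)) (Fe₁ (ω 0) x) =
        Fe₂ (ω 0) (hhom (att τ₁ ε σ ω) (att τ₂ ε σ ω) ((e1 ω).trans (e2 ω).symm) (E0 ω) (E1 ω) x) := by
      filter_upwards [r1, r2, att_shift hε hεπ hσ m1 hP, att_shift hε hεπ hσ m2 hP] with ω k1 k2 s1 s2 x
      rw [hFe₁, hFe₂, hhom_apply, hhom_apply, Fmap_add, s1, s2]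
      have hs := rep_mem (x - att τ₁ ε σ ω)
      have hx : x = att τ₁ ε σ ω + (rep (x - att τ₁ ε σ ω) : AddCircle (1:ℝ)) := by rw [rep_coe]; abel
      set s := rep (x - att τ₁ ε σ ω)
      rw [hx, Fmap_add, add_sub_cancel_left, ← gam_apply τ₁ σ hε hεπ, ← gam_apply τ₂ σ hε hεπ,
        rep_of_mem (ico_map (gam_zero τ₁ σ hε hεπ ω) (gam_one τ₁ σ hε hεπ ω) hs)]
      congr 2
      have a1 := k1 s ⟨hs.1, hs.2.le⟩
      have hE := ico_map (E0 ω) (E1 ω) hs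
      have a2 := k2 _ ⟨hE.1, hE.2.le⟩
      rw [OrderIso.trans_apply, a1, OrderIso.symm_apply_eq, a2, OrderIso.trans_apply, OrderIso.apply_symm_apply]
    intro n
    filter_upwards [ae_shifts hP key] with ω hω x
    exact phiZ_rel Fe₁ Fe₂ (fun ω => hhom (att τ₁ ε σ ω) (att τ₂ ε σ ω) ((e1 ω).trans (e2 ω).symm) (E0 ω) (E1 ω)) ω hω n x
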